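/- Under the stated assumptions, there exist a coercive, locally Lipschitz function H̄ : ℝ → ℝ and a measurable set Ω₀ ⊆ Ω with ℙ(Ω₀) = 1 such that for every ω ∈ Ω₀ and every uniformly continuous g : ℝ → ℝ, the unique uniformly continuous viscosity solution u_g^ε(·,·,ω) of ∂_t u = ε a(x/ε,ω) ∂²_{xx} u + H(∂_x u, x/ε, ω) with u_g^ε(0,·,ω) = g converges, as ε → 0⁺, locally uniformly on [0,∞) × ℝ to the unique uniformly continuous viscosity solution ū_g of the effective equation ∂_t ū = H̄(∂_x ū) with ū_g(0,·) = g. -/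

import Mathlib

open MeasureTheory Filter Set

def IsViscositySubsolution (alpha : ℝ → ℝ) (h : ℝ → ℝ → ℝ) (v : ℝ → ℝ → ℝ) : Prop :=
  ∀ t₀ x₀ : ℝ, 0 < t₀ →
    ∀ φ : ℝ × ℝ → ℝ, ContDiffOn ℝ 2 φ {q : ℝ × ℝ | 0 < q.1} →
      IsLocalMax (fun q : ℝ × ℝ => v q.1 q.2 - φ q) (t₀, x₀) →
      deriv (fun t => φ (t, x₀)) t₀ ≤
        alpha x₀ * deriv (deriv fun x => φ (t₀, x)) x₀ +
          h (deriv (fun x => φ (t₀, x)) x₀) x₀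

def IsViscositySupersolution (alpha : ℝ → ℝ) (h : ℝ → ℝ → ℝ) (v : ℝ → ℝ → ℝ) : Prop :=
  ∀ t₀ x₀ : ℝ, 0 < t₀ →
    ∀ φ : ℝ × ℝ → ℝ, ContDiffOn ℝ 2 φ {q : ℝ × ℝ | 0 < q.1} →
      IsLocalMin (fun q : ℝ × ℝ => v q.1 q.2 - φ q) (t₀, x₀) →
      alpha x₀ * deriv (deriv fun x => φ (t₀, x)) x₀ +
          h (deriv (fun x => φ (t₀, x)) x₀) x₀ ≤
        deriv (fun t => φ (t, x₀)) t₀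

def IsViscositySolution (alpha : ℝ → ℝ) (h : ℝ → ℝ → ℝ) (v : ℝ → ℝ → ℝ) : Prop :=
  IsViscositySubsolution alpha h v ∧ IsViscositySupersolution alpha h v

structure HJSetting {Ω : Type} [MeasurableSpace Ω] (P : Measure Ω) (τ : ℝ → Ω → Ω)
    (a : ℝ → Ω → ℝ) (H : ℝ → ℝ → Ω → ℝ) (G_L G_U : ℝ → ℝ) : Prop where
  prob : IsProbabilityMeasure P
  meas_tau : Measurable fun q : ℝ × Ω => τ q.1 q.2
  mp_tau : ∀ x, MeasurePreserving (τ x) P P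
  tau_zero : ∀ ω, τ 0 ω = ω
  tau_add : ∀ x y ω, τ (x + y) ω = τ x (τ y ω)
  ergodic : ∀ A : Set Ω, MeasurableSet A → (∀ x, τ x ⁻¹' A = A) → P A = 0 ∨ P A = 1
  meas_a : Measurable fun q : ℝ × Ω => a q.1 q.2
  a_pos : ∀ x ω, 0 < a x ω
  a_le_one : ∀ x ω, a x ω ≤ 1
  a_stat : ∀ x ω, a x ω = a 0 (τ x ω)
  a_sqrt_lip : ∃ κ > (0:ℝ), ∀ x ω, |Real.sqrt (a x ω) - Real.sqrt (a 0 ω)| ≤ κ * |x|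
  meas_H : Measurable fun q : ℝ × ℝ × Ω => H q.1 q.2.1 q.2.2
  H_stat : ∀ p x ω, H p x ω = H p 0 (τ x ω)
  GL_cont : Continuous G_L
  GU_cont : Continuous G_U
  GL_even : ∀ p, G_L (-p) = G_L p
  GU_even : ∀ p, G_U (-p) = G_U p
  GL_mono : MonotoneOn G_L (Ici 0)
  GU_mono : MonotoneOn G_U (Ici 0)
  GL_coercive : Tendsto G_L atTop atTop
  GU_coercive : Tendsto G_U atTop atTop
  H_lower : ∀ p ω, G_L p ≤ H p 0 ω
  H_upper : ∀ p ω, H p 0 ω ≤ G_U p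
  H_lip : ∀ R > (0:ℝ), ∃ K > (0:ℝ), ∀ p q ω, |p| ≤ R → |q| ≤ R →
      |H p 0 ω - H q 0 ω| ≤ K * |p - q|
  H_mod : ∀ R > (0:ℝ), ∃ m : ℝ → ℝ, (∀ r, 0 ≤ m r) ∧ MonotoneOn m (Ici 0) ∧
      Tendsto m (nhdsWithin 0 (Ioi 0)) (nhds 0) ∧
      ∀ p x ω, |p| ≤ R → |H p x ω - H p 0 ω| ≤ m |x|

/-- Well-posedness of the Cauchy problem in `UC([0,∞) × ℝ)`. -/
def WellPosedUC (alpha : ℝ → ℝ) (h : ℝ → ℝ → ℝ) : Prop :=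
  (∀ g : ℝ → ℝ, UniformContinuous g → ∃ v : ℝ → ℝ → ℝ,
      IsViscositySolution alpha h v ∧
      UniformContinuousOn (fun q : ℝ × ℝ => v q.1 q.2) {q : ℝ × ℝ | 0 ≤ q.1} ∧
      ∀ x, v 0 x = g x) ∧
  (∀ v₁ v₂ : ℝ → ℝ → ℝ,
      IsViscositySolution alpha h v₁ →
      UniformContinuousOn (fun q : ℝ × ℝ => v₁ q.1 q.2) {q : ℝ × ℝ | 0 ≤ q.1} →
      IsViscositySolution alpha h v₂ →
      UniformContinuousOn (fun q : ℝ × ℝ => v₂ q.1 q.2) {q : ℝ × ℝ | 0 ≤ q.1} →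
      ∀ c : ℝ, (∀ x, |v₁ 0 x - v₂ 0 x| ≤ c) → ∀ t x, 0 ≤ t → |v₁ t x - v₂ t x| ≤ c)

namespace HJ1D

/-- A scalar vector field that is jointly continuous, and bounded and Lipschitz in the unknown
uniformly on compact time intervals. -/
structure TameField (b : ℝ → ℝ → ℝ) : Prop where
  cont : Continuous fun q : ℝ × ℝ => b q.1 q.2
  lip : ∀ X : ℝ, ∃ L : ℝ, ∀ x, |x| ≤ X → ∀ p q, |b p x - b q x| ≤ L * |p - q|
  bdd : ∀ X : ℝ, ∃ C : ℝ, ∀ x, |x| ≤ X → ∀ p, |b p x| ≤ C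

theorem le_of_le_of_deriv_le {b : ℝ → ℝ → ℝ} {f g f' g' : ℝ → ℝ} {x₀ x₁ L : ℝ}
    (hL : ∀ x ∈ Icc x₀ x₁, ∀ p q, |b p x - b q x| ≤ L * |p - q|)
    (hf : ∀ x, HasDerivAt f (f' x) x) (hf' : ∀ x, f' x ≤ b (f x) x)
    (hg : ∀ x, HasDerivAt g (g' x) x) (hg' : ∀ x, b (g x) x ≤ g' x)
    (h0 : f x₀ ≤ g x₀) (h : x₀ ≤ x₁) : f x₁ ≤ g x₁ := by
  by_contra! hlt
  have hfc : Continuous f := continuous_iff_continuousAt.2 fun x => (hf x).continuousAt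
  have hgc : Continuous g := continuous_iff_continuousAt.2 fun x => (hg x).continuousAt
  have hS : IsCompact (Icc x₀ x₁ ∩ {x | f x ≤ g x}) :=
    isCompact_Icc.inter_right (isClosed_le hfc hgc)
  obtain ⟨z, ⟨hz, hfz⟩, hmax⟩ := hS.exists_isMaxOn ⟨x₀, ⟨le_rfl, h⟩, h0⟩ continuousOn_id
  have hzx : z < x₁ := lt_of_le_of_ne hz.2 (by rintro rfl; exact absurd hfz (not_le.2 hlt))
  have hneg : ∀ x ∈ Ioo z x₁, g x < f x := by
    intro x hx
    by_contra! hc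
    have : x ≤ z := hmax (show x ∈ Icc x₀ x₁ ∩ {x | f x ≤ g x} from
      ⟨⟨hz.1.trans hx.1.le, hx.2.le⟩, hc⟩)
    exact absurd hx.1 (not_lt.2 this)
  have hd : ∀ x, HasDerivAt (fun x => (g x - f x) * Real.exp (-L * x))
      ((g' x - f' x) * Real.exp (-L * x) + (g x - f x) * (Real.exp (-L * x) * (-L * 1))) x :=
    fun x => ((hg x).sub (hf x)).mul (((hasDerivAt_id x).const_mul (-L)).exp)
  have hmono : MonotoneOn (fun x => (g x - f x) * Real.exp (-L * x)) (Icc z x₁) := by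
    apply monotoneOn_of_deriv_nonneg (convex_Icc _ _)
    · exact fun x _ => (hd x).continuousAt.continuousWithinAt
    · exact fun x _ => (hd x).differentiableAt.differentiableWithinAt
    · intro x hx
      rw [interior_Icc] at hx
      rw [(hd x).deriv]
      have h1 := hneg x hx
      have h2 := (abs_le.1 (hL x ⟨hz.1.trans hx.1.le, hx.2.le⟩ (g x) (f x))).1
      rw [abs_of_neg (by linarith : g x - f x < 0)] at h2
      have h3 : 0 ≤ (g' x - f' x) - L * (g x - f x) := by
        have := hf' x; have := hg' x; linarith
      have := mul_nonneg h3 (Real.exp_pos (-L * x)).le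
      linarith
  have := hmono (left_mem_Icc.2 hzx.le) (right_mem_Icc.2 hzx.le) hzx.le
  have h1 : 0 ≤ (g z - f z) * Real.exp (-L * z) :=
    mul_nonneg (by simpa using hfz) (Real.exp_pos _).le
  have h2 : (g x₁ - f x₁) * Real.exp (-L * x₁) < 0 :=
    mul_neg_of_neg_of_pos (by linarith) (Real.exp_pos _)
  simp only at this
  linarith

namespace TameField

variable {b : ℝ → ℝ → ℝ} {f g f' g' : ℝ → ℝ} {x₀ x₁ : ℝ}

theorem le_right (hb : TameField b)
    (hf : ∀ x, HasDerivAt f (f' x) x) (hf' : ∀ x, f' x ≤ b (f x) x)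
    (hg : ∀ x, HasDerivAt g (g' x) x) (hg' : ∀ x, b (g x) x ≤ g' x)
    (h0 : f x₀ ≤ g x₀) (h : x₀ ≤ x₁) : f x₁ ≤ g x₁ := by
  obtain ⟨L, hL⟩ := hb.lip (max |x₀| |x₁|)
  exact le_of_le_of_deriv_le (fun x hx => hL x (abs_le_max_abs_abs hx.1 hx.2)) hf hf' hg hg' h0 h

theorem le_left (hb : TameField b)
    (hf : ∀ x, HasDerivAt f (f' x) x) (hf' : ∀ x, f' x ≤ b (f x) x)
    (hg : ∀ x, HasDerivAt g (g' x) x) (hg' : ∀ x, b (g x) x ≤ g' x)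
    (h0 : g x₁ ≤ f x₁) (h : x₀ ≤ x₁) : g x₀ ≤ f x₀ := by
  obtain ⟨L, hL⟩ := hb.lip (max |x₀| |x₁|)
  have key := le_of_le_of_deriv_le (b := fun p x => -b p (-x)) (f := fun x => g (-x))
    (g := fun x => f (-x)) (f' := fun x => -g' (-x)) (g' := fun x => -f' (-x)) (x₀ := -x₁)
    (x₁ := -x₀) (L := L) (fun x hx p q => ?_) (fun x => ?_) (fun x => neg_le_neg (hg' _))
    (fun x => ?_) (fun x => neg_le_neg (hf' _)) (by simpa using h0) (by linarith)
  · simpa using key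
  · rw [← abs_neg]
    convert hL (-x) (abs_le_max_abs_abs (by linarith [hx.2]) (by linarith [hx.1])) p q using 2
    ring
  · simpa [Function.comp_def] using (hg (-x)).comp x (hasDerivAt_neg x)
  · simpa [Function.comp_def] using (hf (-x)).comp x (hasDerivAt_neg x)

theorem exists_local_solution (hb : TameField b) (p X : ℝ) (hX : 0 < X) :
    ∃ f : ℝ → ℝ, f 0 = p ∧ ContinuousOn f (Icc (-X) X) ∧
      ∀ x ∈ Ioo (-X) X, HasDerivAt f (b (f x) x) x := by
  obtain ⟨L, hL⟩ := hb.lip X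
  obtain ⟨C, hC⟩ := hb.bdd X
  have hC0 : 0 ≤ C := (abs_nonneg _).trans (hC 0 (by simpa using hX.le) 0)
  have hpl : IsPicardLindelof (fun t p => b p t) (tmin := -X) (tmax := X)
      ⟨0, by linarith, hX.le⟩ p ⟨C * X, by positivity⟩ 0 ⟨C, hC0⟩ L.toNNReal := by
    refine ⟨fun t ht => ?_, fun q _ => ?_, fun t ht q _ => ?_, ?_⟩
    · refine LipschitzOnWith.of_dist_le_mul fun q _ r _ => ?_
      rw [Real.dist_eq, Real.dist_eq]
      exact (hL t (abs_le.2 ht) q r).trans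
        (mul_le_mul_of_nonneg_right (Real.le_coe_toNNReal L) (abs_nonneg _))
    · exact (hb.cont.comp (by fun_prop : Continuous fun t : ℝ => (q, t))).continuousOn
    · exact hC t (abs_le.2 ht) q
    · change C * max (X - 0) (0 - -X) ≤ C * X - 0
      simp
  obtain ⟨f, hf0, hf⟩ := hpl.exists_eq_forall_mem_Icc_hasDerivWithinAt₀
  exact ⟨f, hf0, fun x hx => (hf x hx).continuousWithinAt,
    fun x hx => (hf x (Ioo_subset_Icc_self hx)).hasDerivAt (Icc_mem_nhds hx.1 hx.2)⟩

theorem exists_solution (hb : TameField b) (p : ℝ) :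
    ∃ f : ℝ → ℝ, f 0 = p ∧ ∀ x, HasDerivAt f (b (f x) x) x := by
  choose F hF0 hFc hF using fun n : ℕ => hb.exists_local_solution p (n + 1) (by positivity)
  have agree : ∀ n m : ℕ, n ≤ m → ∀ x ∈ Ioo (-(n + 1 : ℝ)) (n + 1), F m x = F n x := by
    intro n m hnm x hx
    obtain ⟨L, hL⟩ := hb.lip (n + 1)
    have hnm' : (n : ℝ) ≤ m := by exact_mod_cast hnm
    have hn0 : (0 : ℝ) ≤ n := n.cast_nonneg
    have hsub : ∀ t ∈ Ioo (-(n + 1 : ℝ)) (n + 1), t ∈ Ioo (-(m + 1 : ℝ)) (m + 1) :=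
      fun t ht => ⟨by linarith [ht.1], by linarith [ht.2]⟩
    refine ODE_solution_unique_of_mem_Icc (v := fun t p => b p t) (s := fun _ => univ)
      (K := L.toNNReal) (t₀ := 0) (fun t ht => ?_) ⟨by linarith, by linarith⟩
      ((hFc m).mono (Icc_subset_Icc (by linarith) (by linarith)))
      (fun t ht => hF m t (hsub t ht)) (fun _ _ => trivial) (hFc n) (hF n)
      (fun _ _ => trivial) (by rw [hF0, hF0]) (Ioo_subset_Icc_self hx)
    refine LipschitzOnWith.of_dist_le_mul fun q _ r _ => ?_
    rw [Real.dist_eq, Real.dist_eq]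
    exact (hL t (abs_le.2 (Ioo_subset_Icc_self ht)) q r).trans
      (mul_le_mul_of_nonneg_right (Real.le_coe_toNNReal L) (abs_nonneg _))
  have key : ∀ n : ℕ, ∀ x ∈ Ioo (-(n + 1 : ℝ)) (n + 1), F ⌈|x|⌉₊ x = F n x := by
    intro n x hx
    have hx' : x ∈ Ioo (-((⌈|x|⌉₊ : ℝ) + 1)) (⌈|x|⌉₊ + 1) := by
      rw [mem_Ioo, ← abs_lt]
      linarith [Nat.le_ceil |x|]
    rcases le_total n ⌈|x|⌉₊ with h | h
    · exact agree _ _ h x hx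
    · exact (agree _ _ h x hx').symm
  refine ⟨fun x => F ⌈|x|⌉₊ x, by simp [hF0], fun x => ?_⟩
  have hx' : x ∈ Ioo (-((⌈|x|⌉₊ : ℝ) + 1)) (⌈|x|⌉₊ + 1) := by
    rw [mem_Ioo, ← abs_lt]
    linarith [Nat.le_ceil |x|]
  refine (hF _ x hx').congr_of_eventuallyEq ?_
  filter_upwards [isOpen_Ioo.mem_nhds hx'] with y hy using key _ y hy

end TameField

/-- Picard iterates for the Cauchy problem with datum `p` at `0`. -/
noncomputable def picardIter (b : ℝ → ℝ → ℝ) (p : ℝ) : ℕ → ℝ → ℝ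
  | 0 => fun _ => p
  | n + 1 => fun x => p + x * ∫ s in (0 : ℝ)..1, b (picardIter b p n (s * x)) (s * x)

theorem mul_integral_comp_mul (φ : ℝ → ℝ) (x : ℝ) :
    x * ∫ s in (0 : ℝ)..1, φ (s * x) = ∫ y in (0 : ℝ)..x, φ y := by
  rw [intervalIntegral.mul_integral_comp_mul_right]
  simp

theorem TameField.continuous_picardIter {b : ℝ → ℝ → ℝ} (hb : TameField b) (p : ℝ) (n : ℕ) :
    Continuous (picardIter b p n) := by
  induction n with
  | zero => exact continuous_const
  | succ n ih =>
    have hc : Continuous fun y => b (picardIter b p n y) y :=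
      hb.cont.comp (ih.prodMk continuous_id)
    have : picardIter b p (n + 1) = fun x => p + ∫ y in (0 : ℝ)..x, b (picardIter b p n y) y := by
      funext x
      rw [← mul_integral_comp_mul (fun y => b (picardIter b p n y) y) x]
      rfl
    rw [this]
    exact continuous_const.add
      (intervalIntegral.continuous_primitive (fun _ _ => hc.intervalIntegrable _ _) 0)

theorem TameField.tendsto_picardIter {b : ℝ → ℝ → ℝ} (hb : TameField b) {p : ℝ} {f : ℝ → ℝ}
    (hf0 : f 0 = p) (hf : ∀ x, HasDerivAt f (b (f x) x) x) (x : ℝ) :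
    Tendsto (fun n => picardIter b p n x) atTop (nhds (f x)) := by
  have hfc : Continuous f := continuous_iff_continuousAt.2 fun x => (hf x).continuousAt
  obtain ⟨L, hL⟩ := hb.lip |x|
  obtain ⟨C, hC⟩ := isCompact_Icc.exists_bound_of_continuousOn
    (s := Icc (-|x|) |x|) (f := fun y => p - f y) (by fun_prop)
  have hL0 : 0 ≤ L := by
    have := (abs_nonneg _).trans (hL 0 (by simp) 1 0)
    simpa using this
  have hfy : ∀ y, f y = p + y * ∫ s in (0 : ℝ)..1, b (f (s * y)) (s * y) := by
    intro y
    rw [mul_integral_comp_mul (fun z => b (f z) z) y,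
      intervalIntegral.integral_eq_sub_of_hasDerivAt (f := f) (fun z _ => hf z)
        ((hb.cont.comp (hfc.prodMk continuous_id)).intervalIntegrable _ _), hf0]
    ring
  have key : ∀ n : ℕ, ∀ y, |y| ≤ |x| →
      |picardIter b p n y - f y| ≤ C * ((L * |y|) ^ n / n.factorial) := by
    intro n
    induction n with
    | zero => intro y hy; simpa [picardIter] using hC y (abs_le.1 hy)
    | succ n ih =>
      intro y hy
      have hc1 : Continuous fun s : ℝ => b (picardIter b p n (s * y)) (s * y) :=
        hb.cont.comp (((hb.continuous_picardIter p n).comp (by fun_prop)).prodMk (by fun_prop))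
      have hc2 : Continuous fun s : ℝ => b (f (s * y)) (s * y) :=
        hb.cont.comp ((hfc.comp (by fun_prop)).prodMk (by fun_prop))
      have e : picardIter b p (n + 1) y - f y
          = y * ∫ s in (0 : ℝ)..1, (b (picardIter b p n (s * y)) (s * y) - b (f (s * y)) (s * y)) := by
        rw [intervalIntegral.integral_sub (hc1.intervalIntegrable _ _)
          (hc2.intervalIntegrable _ _), hfy y]
        simp only [picardIter]
        ring
      have hle : |∫ s in (0 : ℝ)..1,
          (b (picardIter b p n (s * y)) (s * y) - b (f (s * y)) (s * y))| ≤
          ∫ s in (0 : ℝ)..1, L * (C * ((L * |y|) ^ n / n.factorial)) * s ^ n := by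
        rw [← Real.norm_eq_abs]
        refine intervalIntegral.norm_integral_le_of_norm_le zero_le_one
          (ae_of_all _ fun s hs => ?_) (by apply Continuous.intervalIntegrable; fun_prop)
        have hsy : |s * y| ≤ |x| := by
          rw [abs_mul, abs_of_pos hs.1]
          exact (mul_le_of_le_one_left (abs_nonneg _) hs.2).trans hy
        refine (hL _ hsy _ _).trans ?_
        have := mul_le_mul_of_nonneg_left (ih (s * y) hsy) hL0
        refine this.trans (le_of_eq ?_)
        rw [abs_mul, abs_of_pos hs.1]
        ring
      rw [e, abs_mul]
      refine (mul_le_mul_of_nonneg_left hle (abs_nonneg _)).trans (le_of_eq ?_)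
      rw [intervalIntegral.integral_const_mul, integral_pow, Nat.factorial_succ]
      push_cast
      have : (n.factorial : ℝ) ≠ 0 := by positivity
      have : (n + 1 : ℝ) ≠ 0 := by positivity
      field_simp
      simp
      ring
  rw [tendsto_iff_dist_tendsto_zero]
  refine squeeze_zero (fun _ => dist_nonneg) (fun n => ?_) (g := fun n : ℕ =>
    C * ((L * |x|) ^ n / n.factorial)) ?_
  · rw [Real.dist_eq]; exact key n x le_rfl
  · simpa using (FloorSemiring.tendsto_pow_div_factorial_atTop (L * |x|)).const_mul C

/-- Joint measurability of solutions in the time variable and in a parameter. -/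
theorem measurable_solution {Ω : Type*} [MeasurableSpace Ω] {b : Ω → ℝ → ℝ → ℝ}
    (hbm : Measurable fun q : Ω × ℝ × ℝ => b q.1 q.2.1 q.2.2) (hb : ∀ ω, TameField (b ω))
    {p : Ω → ℝ} (hp : Measurable p) {f : Ω → ℝ → ℝ} (hf0 : ∀ ω, f ω 0 = p ω)
    (hf : ∀ ω x, HasDerivAt (f ω) (b ω (f ω x) x) x) :
    Measurable fun q : Ω × ℝ => f q.1 q.2 := by
  have hit : ∀ n, Measurable fun q : Ω × ℝ => picardIter (b q.1) (p q.1) n q.2 := by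
    intro n
    induction n with
    | zero => exact hp.comp measurable_fst
    | succ n ih =>
      simp only [picardIter]
      refine (hp.comp measurable_fst).add (measurable_snd.mul ?_)
      simp only [intervalIntegral.integral_of_le zero_le_one]
      have : Measurable fun r : (Ω × ℝ) × ℝ =>
          b r.1.1 (picardIter (b r.1.1) (p r.1.1) n (r.2 * r.1.2)) (r.2 * r.1.2) := by
        refine hbm.comp ((measurable_fst.comp measurable_fst).prodMk (Measurable.prodMk ?_ ?_))
        · exact ih.comp ((measurable_fst.comp measurable_fst).prodMk
            (measurable_snd.mul (measurable_snd.comp measurable_fst)))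
        · exact measurable_snd.mul (measurable_snd.comp measurable_fst)
      exact this.stronglyMeasurable.integral_prod_right.measurable
  refine measurable_of_tendsto_metrizable hit ?_
  rw [tendsto_pi_nhds]
  exact fun q => (hb q.1).tendsto_picardIter (hf0 q.1) (hf q.1) q.2

/-- A nonnegative function on the whole line whose derivative is at least `d - K * D` whenever this
quantity is nonnegative stays above `d / (2 * K)`. -/
theorem lower_bound_of_deriv_ge {D D' : ℝ → ℝ} {d K : ℝ} (hd : 0 < d) (hK : 0 < K)
    (hD : ∀ x, 0 ≤ D x) (hDd : ∀ x, HasDerivAt D (D' x) x)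
    (hD' : ∀ x, 0 ≤ d - K * D x → d - K * D x ≤ D' x) (x : ℝ) : d / (2 * K) ≤ D x := by
  by_contra! hlt
  have hDc : Continuous D := continuous_iff_continuousAt.2 fun x => (hDd x).continuousAt
  have hslope : ∀ y, D y < d / (2 * K) → d / 2 ≤ D' y := by
    intro y hy
    have : K * D y < d / 2 := by
      rw [lt_div_iff₀ (by positivity)] at hy
      linarith
    exact le_trans (by linarith) (hD' y (by linarith))
  have hbelow : ∀ y ≤ x, D y < d / (2 * K) := by
    intro y hyx
    by_contra! hc
    have hS : IsCompact (Icc y x ∩ {z | d / (2 * K) ≤ D z}) :=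
      isCompact_Icc.inter_right (isClosed_le continuous_const hDc)
    obtain ⟨z, ⟨hz, hDz⟩, hmax⟩ := hS.exists_isMaxOn ⟨y, ⟨le_rfl, hyx⟩, hc⟩ continuousOn_id
    have hmono : MonotoneOn D (Icc z x) := by
      apply monotoneOn_of_deriv_nonneg (convex_Icc _ _) hDc.continuousOn
        (fun w _ => (hDd w).differentiableAt.differentiableWithinAt)
      intro w hw
      rw [interior_Icc] at hw
      rw [(hDd w).deriv]
      refine (by positivity : (0 : ℝ) ≤ d / 2).trans (hslope w ?_)
      by_contra! hcw
      have : w ≤ z := hmax (show w ∈ Icc y x ∩ {z | d / (2 * K) ≤ D z} from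
        ⟨⟨hz.1.trans hw.1.le, hw.2.le⟩, hcw⟩)
      exact absurd hw.1 (not_lt.2 this)
    have := hmono (left_mem_Icc.2 hz.2) (right_mem_Icc.2 hz.2) hz.2
    exact absurd hlt (not_lt.2 (le_trans hDz this))
  have hmono : MonotoneOn (fun y => D y - d / 2 * y) (Iic x) := by
    have hdd : ∀ y, HasDerivAt (fun y => D y - d / 2 * y) (D' y - d / 2 * 1) y :=
      fun y => (hDd y).sub ((hasDerivAt_id y).const_mul _)
    apply monotoneOn_of_deriv_nonneg (convex_Iic _)
      (fun w _ => (hdd w).continuousAt.continuousWithinAt)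
      (fun w _ => (hdd w).differentiableAt.differentiableWithinAt)
    intro w hw
    rw [interior_Iic] at hw
    rw [(hdd w).deriv]
    linarith [hslope w (hbelow w (le_of_lt hw))]
  have h1 := hmono (show x - (1 + 2 * D x / d) ∈ Iic x from by
    have : 0 ≤ 2 * D x / d := div_nonneg (by linarith [hD x]) hd.le
    simp only [mem_Iic]; linarith) (show x ∈ Iic x from le_refl x) (by
    have : 0 ≤ 2 * D x / d := div_nonneg (by linarith [hD x]) hd.le
    linarith)
  simp only at h1
  have h2 := hD (x - (1 + 2 * D x / d))
  have h3 : d / 2 * (2 * D x / d) = D x := by field_simp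
  nlinarith

/-- A measurable, measure-preserving, ergodic flow on a probability space. -/
structure ErgodicFlow {Ω : Type*} [MeasurableSpace Ω] (P : Measure Ω) (τ : ℝ → Ω → Ω) : Prop where
  prob : IsProbabilityMeasure P
  meas : Measurable fun q : ℝ × Ω => τ q.1 q.2
  mp : ∀ x, MeasurePreserving (τ x) P P
  zero : ∀ ω, τ 0 ω = ω
  add : ∀ x y ω, τ (x + y) ω = τ x (τ y ω)
  ergodic : ∀ A : Set Ω, MeasurableSet A → (∀ x, τ x ⁻¹' A = A) → P A = 0 ∨ P A = 1

/-- The running maximum, along an orbit, of the partial sums of `f`. -/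
noncomputable def maxPartialSum {Ω : Type*} (T : Ω → Ω) (f : Ω → ℝ) : ℕ → Ω → ℝ
  | 0 => fun _ => 0
  | n + 1 => fun ω => max 0 (f ω + maxPartialSum T f n (T ω))

section maxPartialSum

variable {Ω : Type*} {T : Ω → Ω} {f : Ω → ℝ}

theorem maxPartialSum_nonneg (n : ℕ) (ω : Ω) : 0 ≤ maxPartialSum T f n ω := by
  cases n with
  | zero => exact le_rfl
  | succ n => exact le_max_left _ _

theorem maxPartialSum_le_succ (n : ℕ) (ω : Ω) :
    maxPartialSum T f n ω ≤ maxPartialSum T f (n + 1) ω := by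
  induction n generalizing ω with
  | zero => exact maxPartialSum_nonneg _ _
  | succ n ih =>
    simp only [maxPartialSum] at ih ⊢
    exact max_le_max le_rfl (add_le_add le_rfl (ih _))

theorem maxPartialSum_sub_comp_le (n : ℕ) (ω : Ω) :
    maxPartialSum T f n ω - maxPartialSum T f n (T ω) ≤
      {ω | 0 < maxPartialSum T f n ω}.indicator f ω := by
  by_cases h : 0 < maxPartialSum T f n ω
  · rw [indicator_of_mem (by exact h)]
    cases n with
    | zero => simp [maxPartialSum] at h
    | succ n =>
      have h2 := maxPartialSum_le_succ (T := T) (f := f) n (T ω)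
      have h3 : maxPartialSum T f (n + 1) ω = f ω + maxPartialSum T f n (T ω) := by
        simp only [maxPartialSum] at h ⊢
        rcases le_total 0 (f ω + maxPartialSum T f n (T ω)) with h' | h'
        · exact max_eq_right h'
        · rw [max_eq_left h'] at h; exact absurd h (lt_irrefl _)
      linarith
  · rw [indicator_of_notMem (by exact h)]
    linarith [maxPartialSum_nonneg (T := T) (f := f) n (T ω)]

variable [MeasurableSpace Ω] {P : Measure Ω}

theorem measurable_maxPartialSum (hT : Measurable T) (hf : Measurable f) (n : ℕ) :
    Measurable (maxPartialSum T f n) := by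
  induction n with
  | zero => exact measurable_const
  | succ n ih => exact measurable_const.max (hf.add (ih.comp hT))

theorem integrable_maxPartialSum (hT : MeasurePreserving T P P) (hfi : Integrable f P) (n : ℕ) :
    Integrable (maxPartialSum T f n) P := by
  induction n with
  | zero => exact integrable_zero _ _ _
  | succ n ih => exact (integrable_zero _ _ _).sup (hfi.add (hT.integrable_comp_of_integrable ih))

/-- The maximal ergodic inequality. -/
theorem integral_indicator_maxPartialSum_nonneg (hT : MeasurePreserving T P P)
    (hf : Measurable f) (hfi : Integrable f P) (n : ℕ) :
    0 ≤ ∫ ω, {ω | 0 < maxPartialSum T f n ω}.indicator f ω ∂P := by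
  have hM := integrable_maxPartialSum hT hfi n
  have hMT := hT.integrable_comp_of_integrable hM
  have hms : MeasurableSet {ω | 0 < maxPartialSum T f n ω} :=
    measurableSet_lt measurable_const (measurable_maxPartialSum hT.measurable hf n)
  have h := integral_mono (hM.sub hMT) (hfi.indicator hms)
    (fun ω => maxPartialSum_sub_comp_le (T := T) (f := f) n ω)
  refine le_trans (le_of_eq ?_) h
  have e : ∫ ω, maxPartialSum T f n (T ω) ∂P = ∫ ω, maxPartialSum T f n ω ∂P := by
    rw [← integral_map hT.measurable.aemeasurable
      (by rw [hT.map_eq]; exact hM.aestronglyMeasurable), hT.map_eq]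
  have h2 := integral_sub hM hMT
  simp only [Function.comp_apply, Pi.sub_apply] at h2 ⊢
  rw [h2, e, sub_self]

theorem integral_nonneg_of_forall_maxPartialSum_pos (hT : MeasurePreserving T P P)
    (hf : Measurable f) (hfi : Integrable f P)
    (hpos : ∀ᵐ ω ∂P, ∃ n, 0 < maxPartialSum T f n ω) : 0 ≤ ∫ ω, f ω ∂P := by
  refine ge_of_tendsto' (f := fun n => ∫ ω, {ω | 0 < maxPartialSum T f n ω}.indicator f ω ∂P)
    (x := atTop) ?_ (integral_indicator_maxPartialSum_nonneg hT hf hfi)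
  refine tendsto_integral_of_dominated_convergence (fun ω => ‖f ω‖) (fun n => ?_) hfi.norm
    (fun n => ae_of_all _ fun ω => norm_indicator_le_norm_self _ _) ?_
  · exact (hfi.indicator (measurableSet_lt measurable_const
      (measurable_maxPartialSum hT.measurable hf n))).aestronglyMeasurable
  · filter_upwards [hpos] with ω ⟨n, hn⟩
    refine tendsto_const_nhds.congr' ?_
    filter_upwards [eventually_ge_atTop n] with m hm
    rw [indicator_of_mem]
    exact hn.trans_le (monotone_nat_of_le_succ
      (fun k => maxPartialSum_le_succ (T := T) (f := f) k ω) hm)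

end maxPartialSum

theorem abs_integral_orbit_le {Ω : Type*} {τ : ℝ → Ω → Ω} {k : Ω → ℝ} {C : ℝ} (hC : ∀ ω, |k ω| ≤ C)
    (ω : Ω) (x y : ℝ) :
    |∫ s in x..y, k (τ s ω)| ≤ C * |y - x| := by
  rw [← Real.norm_eq_abs]
  exact intervalIntegral.norm_integral_le_of_norm_le_const fun s _ => by simpa using hC _

namespace ErgodicFlow

variable {Ω : Type*} [MeasurableSpace Ω] {P : Measure Ω} {τ : ℝ → Ω → Ω} {k : Ω → ℝ} {C : ℝ}

theorem neg (h : ErgodicFlow P τ) : ErgodicFlow P (fun x => τ (-x)) where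
  prob := h.prob
  meas := h.meas.comp ((measurable_fst.neg).prodMk measurable_snd)
  mp x := h.mp (-x)
  zero ω := by simpa using h.zero ω
  add x y ω := by rw [neg_add]; exact h.add _ _ _
  ergodic A hA hinv := h.ergodic A hA fun x => by simpa using hinv (-x)

theorem measurable_orbit (h : ErgodicFlow P τ) (hk : Measurable k) (ω : Ω) :
    Measurable fun x => k (τ x ω) :=
  hk.comp (h.meas.comp (measurable_id.prodMk measurable_const))

theorem intervalIntegrable (h : ErgodicFlow P τ) (hk : Measurable k) (hC : ∀ ω, |k ω| ≤ C)
    (ω : Ω) (x y : ℝ) : IntervalIntegrable (fun x => k (τ x ω)) volume x y := by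
  refine (intervalIntegrable_const (c := C)).mono_fun'
    (h.measurable_orbit hk ω).aestronglyMeasurable (ae_of_all _ fun x => ?_)
  simpa using hC _

theorem measurable_integral (h : ErgodicFlow P τ) (hk : Measurable k) (z : ℝ) :
    Measurable fun ω => ∫ x in (0 : ℝ)..z, k (τ x ω) := by
  have hm : Measurable fun q : Ω × ℝ => k (τ q.2 q.1) :=
    hk.comp (h.meas.comp measurable_swap)
  simp only [intervalIntegral]
  exact hm.stronglyMeasurable.integral_prod_right.measurable.sub
    hm.stronglyMeasurable.integral_prod_right.measurable

theorem integral_comp (h : ErgodicFlow P τ) (hk : Measurable k) (y : ℝ) :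
    ∫ ω, k (τ y ω) ∂P = ∫ ω, k ω ∂P := by
  rw [← integral_map (h.mp y).measurable.aemeasurable hk.aestronglyMeasurable, (h.mp y).map_eq]

theorem integral_window (h : ErgodicFlow P τ) (ω : Ω) (x y z : ℝ) :
    ∫ s in x..z, k (τ s (τ y ω)) = ∫ s in (x + y)..(z + y), k (τ s ω) := by
  rw [← intervalIntegral.integral_comp_add_right (fun s => k (τ s ω)) y]
  simp only [h.add]

theorem integral_integral_orbit (h : ErgodicFlow P τ) (hk : Measurable k) (hC : ∀ ω, |k ω| ≤ C) :
    ∫ ω, (∫ x in (0 : ℝ)..1, k (τ x ω)) ∂P = ∫ ω, k ω ∂P := by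
  have := h.prob
  simp only [intervalIntegral.integral_of_le zero_le_one]
  rw [integral_integral_swap]
  · simp [h.integral_comp hk]
  · refine (integrable_const C).mono' ?_ (ae_of_all _ fun q => ?_)
    · exact (hk.comp (h.meas.comp measurable_swap)).aestronglyMeasurable
    · exact (Real.norm_eq_abs _).le.trans (hC _)

theorem abs_integral_shift_sub_le (h : ErgodicFlow P τ) (hk : Measurable k) (hC : ∀ ω, |k ω| ≤ C)
    (ω : Ω) (y z : ℝ) :
    |(∫ s in (0 : ℝ)..z, k (τ s (τ y ω))) - ∫ s in (0 : ℝ)..z, k (τ s ω)| ≤ 2 * C * |y| := by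
  have hi := h.intervalIntegrable hk hC ω
  rw [h.integral_window]
  have e : (∫ s in (0 + y)..(z + y), k (τ s ω)) - ∫ s in (0 : ℝ)..z, k (τ s ω) =
      (∫ s in z..(z + y), k (τ s ω)) - ∫ s in (0 : ℝ)..y, k (τ s ω) := by
    have h1 := intervalIntegral.integral_add_adjacent_intervals (hi 0 y) (hi y (z + y))
    have h2 := intervalIntegral.integral_add_adjacent_intervals (hi 0 z) (hi z (z + y))
    rw [zero_add]
    linarith
  rw [e]
  have h1 := abs_le.1 (abs_integral_orbit_le (τ := τ) hC ω z (z + y))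
  have h2 := abs_le.1 (abs_integral_orbit_le (τ := τ) hC ω 0 y)
  rw [add_sub_cancel_left] at h1
  rw [sub_zero] at h2
  rw [abs_le]
  constructor <;> linarith

theorem not_frequently_gt (h : ErgodicFlow P τ) (hk : Measurable k) (hC : ∀ ω, |k ω| ≤ C)
    {δ : ℝ} (hδ : 0 < δ) :
    ∀ᵐ ω ∂P, ∀ q : ℚ, ∫ ω, k ω ∂P + δ < q →
      ∀ᶠ n : ℕ in atTop, ∫ x in (0 : ℝ)..n, k (τ x ω) ≤ q * n := by
  have := h.prob
  set E := ∫ ω, k ω ∂P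
  set A : Set Ω := {ω | ∃ q : ℚ, E + δ < q ∧ ∀ N : ℕ, ∃ n : ℕ, N ≤ n ∧
    q * n < ∫ x in (0 : ℝ)..n, k (τ x ω)} with hA
  have hAm : MeasurableSet A := by
    have : A = ⋃ q : ℚ, ⋃ _ : E + δ < q, ⋂ N : ℕ, ⋃ n : ℕ, ⋃ _ : N ≤ n,
        {ω | (q : ℝ) * n < ∫ x in (0 : ℝ)..n, k (τ x ω)} := by
      ext ω; simp [hA]
    rw [this]
    exact MeasurableSet.iUnion fun q => MeasurableSet.iUnion fun _ => MeasurableSet.iInter fun N =>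
      MeasurableSet.iUnion fun n => MeasurableSet.iUnion fun _ =>
      measurableSet_lt measurable_const (h.measurable_integral hk _)
  have hsub : ∀ y, A ⊆ τ y ⁻¹' A := by
    rintro y ω ⟨q, hq, hqn⟩
    obtain ⟨q', hq', hq'q⟩ := exists_rat_btwn hq
    refine ⟨q', hq', fun N => ?_⟩
    obtain ⟨N', hN'⟩ := exists_nat_ge (2 * C * |y| / (q - q'))
    obtain ⟨n, hn, hlt⟩ := hqn (max N N')
    refine ⟨n, (le_max_left _ _).trans hn, ?_⟩
    have h1 := (abs_le.1 (h.abs_integral_shift_sub_le hk hC ω y n)).1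
    have h2 : (N' : ℝ) ≤ n := by exact_mod_cast (le_max_right _ _).trans hn
    have h3 := (div_le_iff₀ (by linarith)).1 (hN'.trans h2)
    nlinarith
  have hinv : ∀ y, τ y ⁻¹' A = A := by
    refine fun y => Subset.antisymm (fun ω hω => ?_) (hsub y)
    have := hsub (-y) hω
    rwa [mem_preimage, ← h.add, neg_add_cancel, h.zero] at this
  rcases h.ergodic A hAm hinv with h0 | h1
  · rw [measure_eq_zero_iff_ae_notMem] at h0
    filter_upwards [h0] with ω hω q hq
    by_contra hc
    refine hω ⟨q, hq, fun N => ?_⟩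
    by_contra! hc'
    exact hc (eventually_atTop.2 ⟨N, hc'⟩)
  · exfalso
    have hae : ∀ᵐ ω ∂P, ω ∈ A := by
      rw [← prob_compl_eq_zero_iff hAm] at h1
      exact measure_eq_zero_iff_ae_notMem.1 h1 |>.mono fun ω hω => by simpa using hω
    set F : Ω → ℝ := fun ω => (∫ x in (0 : ℝ)..1, k (τ x ω)) - (E + δ)
    have hFm : Measurable F := (h.measurable_integral hk 1).sub measurable_const
    have hI : Integrable (fun ω => ∫ x in (0 : ℝ)..1, k (τ x ω)) P :=
      (integrable_const C).mono' (h.measurable_integral hk 1).aestronglyMeasurable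
        (ae_of_all _ fun ω => by simpa using abs_integral_orbit_le (τ := τ) hC ω 0 1)
    have hle : ∀ (n : ℕ) (ω : Ω),
        (∫ x in (0 : ℝ)..n, k (τ x ω)) - (E + δ) * n ≤ maxPartialSum (τ 1) F n ω := by
      intro n
      induction n with
      | zero => intro ω; simp [maxPartialSum]
      | succ n ih =>
        intro ω
        refine le_trans ?_ (le_max_right _ _)
        have h1 := ih (τ 1 ω)
        rw [h.integral_window, zero_add] at h1
        have h2 := intervalIntegral.integral_add_adjacent_intervals
          (h.intervalIntegrable hk hC ω 0 1) (h.intervalIntegrable hk hC ω 1 (n + 1))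
        push_cast
        simp only [F]
        linarith
    have := integral_nonneg_of_forall_maxPartialSum_pos (h.mp 1) hFm (hI.sub (integrable_const _))
      (hae.mono fun ω ⟨q, hq, hqn⟩ => by
        obtain ⟨n, hn, hlt⟩ := hqn 0
        refine ⟨n, lt_of_lt_of_le ?_ (hle n ω)⟩
        have : (0 : ℝ) ≤ n := n.cast_nonneg
        nlinarith)
    rw [integral_sub hI (integrable_const _), h.integral_integral_orbit hk hC] at this
    simp at this
    linarith

theorem integral_orbit_le (h : ErgodicFlow P τ) (hk : Measurable k) (hC : ∀ ω, |k ω| ≤ C) :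
    ∀ᵐ ω ∂P, ∀ δ > (0 : ℝ), ∃ B, ∀ z ≥ (0 : ℝ),
      ∫ x in (0 : ℝ)..z, k (τ x ω) ≤ (∫ ω, k ω ∂P + δ) * z + B := by
  have hall : ∀ᵐ ω ∂P, ∀ m : ℕ, ∀ q : ℚ, ∫ ω, k ω ∂P + 1 / ((m : ℝ) + 1) < q →
      ∀ᶠ n : ℕ in atTop, ∫ x in (0 : ℝ)..n, k (τ x ω) ≤ q * n :=
    ae_all_iff.2 fun m => h.not_frequently_gt hk hC (by positivity)
  filter_upwards [hall] with ω hω δ hδ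
  set E := ∫ ω, k ω ∂P
  obtain ⟨m, hm⟩ := exists_nat_one_div_lt hδ
  obtain ⟨q, hq, hq'⟩ := exists_rat_btwn (show E + 1 / ((m : ℝ) + 1) < E + δ by linarith)
  obtain ⟨N, hN⟩ := eventually_atTop.1 (hω m q hq)
  have hC0 : 0 ≤ C := (abs_nonneg _).trans (hC ω)
  refine ⟨C + (C + |E + δ|) * (N + 1) + |E + δ|, fun z hz => ?_⟩
  have hE := abs_le.1 (le_refl |E + δ|)
  rcases le_total z N with hzN | hzN
  · have h1 := (abs_le.1 (abs_integral_orbit_le (τ := τ) hC ω 0 z)).2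
    rw [sub_zero, abs_of_nonneg hz] at h1
    have h2 : C * z ≤ C * N := mul_le_mul_of_nonneg_left hzN hC0
    have h3 : |E + δ| * z ≤ |E + δ| * N := mul_le_mul_of_nonneg_left hzN (abs_nonneg _)
    nlinarith [abs_nonneg (E + δ)]
  · have hfl := Nat.floor_le hz
    have hfl' := Nat.lt_floor_add_one z
    have h1 := hN ⌊z⌋₊ (Nat.le_floor hzN)
    have h2 := (abs_le.1 (abs_integral_orbit_le (τ := τ) hC ω ⌊z⌋₊ z)).2
    rw [abs_of_nonneg (by linarith)] at h2
    have h3 := intervalIntegral.integral_add_adjacent_intervals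
      (h.intervalIntegrable hk hC ω 0 ⌊z⌋₊) (h.intervalIntegrable hk hC ω ⌊z⌋₊ z)
    have h4 : (q : ℝ) * ⌊z⌋₊ ≤ (E + δ) * ⌊z⌋₊ :=
      mul_le_mul_of_nonneg_right hq'.le (Nat.cast_nonneg _)
    have h5 : C * (z - ⌊z⌋₊) ≤ C * 1 := mul_le_mul_of_nonneg_left (by linarith) hC0
    have h6 : 0 ≤ (C + |E + δ|) * (N + 1) := by positivity
    have h7 : -(|E + δ|) * 1 ≤ (E + δ) * (z - ⌊z⌋₊) := by
      nlinarith [abs_nonneg (E + δ)]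
    nlinarith

/-- The pointwise ergodic theorem for bounded observables. -/
theorem abs_integral_orbit_sub_le (h : ErgodicFlow P τ) (hk : Measurable k)
    (hC : ∀ ω, |k ω| ≤ C) :
    ∀ᵐ ω ∂P, ∀ δ > (0 : ℝ), ∃ B, ∀ z : ℝ,
      |(∫ x in (0 : ℝ)..z, k (τ x ω)) - (∫ ω, k ω ∂P) * z| ≤ δ * |z| + B := by
  have hC' : ∀ ω, |(-k) ω| ≤ C := fun ω => by simpa using hC ω
  filter_upwards [h.integral_orbit_le hk hC, h.integral_orbit_le hk.neg hC',
    h.neg.integral_orbit_le hk hC, h.neg.integral_orbit_le hk.neg hC'] with ω h1 h2 h3 h4 δ hδ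
  obtain ⟨B1, h1⟩ := h1 δ hδ
  obtain ⟨B2, h2⟩ := h2 δ hδ
  obtain ⟨B3, h3⟩ := h3 δ hδ
  obtain ⟨B4, h4⟩ := h4 δ hδ
  refine ⟨max (max B1 B2) (max B3 B4), fun z => ?_⟩
  have m1 : max B1 B2 ≤ max (max B1 B2) (max B3 B4) := le_max_left _ _
  have m2 : max B3 B4 ≤ max (max B1 B2) (max B3 B4) := le_max_right _ _
  have m3 := le_max_left B1 B2
  have m4 := le_max_right B1 B2
  have m5 := le_max_left B3 B4
  have m6 := le_max_right B3 B4
  simp only [Pi.neg_apply, intervalIntegral.integral_neg, integral_neg] at h2 h4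
  rw [abs_le]
  rcases le_total 0 z with hz | hz
  · rw [abs_of_nonneg hz]
    have := h1 z hz
    have := h2 z hz
    constructor <;> linarith
  · rw [abs_of_nonpos hz]
    have e : ∫ x in (0 : ℝ)..(-z), k (τ (-x) ω) = -∫ x in (0 : ℝ)..z, k (τ x ω) := by
      rw [intervalIntegral.integral_comp_neg (fun x => k (τ x ω)), intervalIntegral.integral_symm]
      simp
    have h5 := h3 (-z) (by linarith)
    have h6 := h4 (-z) (by linarith)
    rw [e] at h5 h6
    constructor <;> linarith

end ErgodicFlow

namespace TameField

variable {b : ℝ → ℝ → ℝ}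

theorem exists_gronwall (hb : TameField b) (X : ℝ) : ∃ L : ℝ, ∀ f g : ℝ → ℝ,
    (∀ x, HasDerivAt f (b (f x) x) x) → (∀ x, HasDerivAt g (b (g x) x) x) →
    ∀ x, |x| ≤ X → |f x - g x| ≤ |f 0 - g 0| * Real.exp (L * |x|) := by
  obtain ⟨L, hL⟩ := hb.lip X
  refine ⟨L.toNNReal, fun f g hf hg x hx => ?_⟩
  have hLip : ∀ t, |t| ≤ X → ∀ p q, |b p t - b q t| ≤ (L.toNNReal : ℝ) * |p - q| := fun t ht p q =>
    (hL t ht p q).trans (mul_le_mul_of_nonneg_right (Real.le_coe_toNNReal L) (abs_nonneg _))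
  rcases le_total 0 x with h0 | h0
  · rw [abs_of_nonneg h0] at hx ⊢
    have := dist_le_of_trajectories_ODE_of_mem (v := fun t p => b p t) (s := fun _ => univ)
      (K := L.toNNReal) (f := f) (g := g) (a := 0) (b := x) (δ := |f 0 - g 0|)
      (fun t ht => LipschitzOnWith.of_dist_le_mul fun p _ q _ =>
        hLip t (by rw [abs_of_nonneg ht.1]; linarith [ht.2]) p q)
      (fun t _ => (hf t).continuousAt.continuousWithinAt)
      (fun t _ => (hf t).hasDerivWithinAt) (fun _ _ => trivial)
      (fun t _ => (hg t).continuousAt.continuousWithinAt)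
      (fun t _ => (hg t).hasDerivWithinAt) (fun _ _ => trivial) le_rfl x ⟨h0, le_rfl⟩
    simpa [Real.dist_eq] using this
  · rw [abs_of_nonpos h0] at hx ⊢
    have hf' : ∀ t, HasDerivAt (fun t => f (-t)) (-b (f (-t)) (-t)) t := fun t => by
      simpa [Function.comp_def] using (hf (-t)).comp t (hasDerivAt_neg t)
    have hg' : ∀ t, HasDerivAt (fun t => g (-t)) (-b (g (-t)) (-t)) t := fun t => by
      simpa [Function.comp_def] using (hg (-t)).comp t (hasDerivAt_neg t)
    have := dist_le_of_trajectories_ODE_of_mem (v := fun t p => -b p (-t)) (s := fun _ => univ)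
      (K := L.toNNReal) (f := fun t => f (-t)) (g := fun t => g (-t)) (a := 0) (b := -x)
      (δ := |f 0 - g 0|)
      (fun t ht => LipschitzOnWith.of_dist_le_mul fun p _ q _ => by
        rw [Real.dist_eq, Real.dist_eq, ← abs_neg]
        convert hLip (-t) (by rw [abs_neg, abs_of_nonneg ht.1]; linarith [ht.2]) p q using 2
        ring)
      (fun t _ => (hf' t).continuousAt.continuousWithinAt)
      (fun t _ => (hf' t).hasDerivWithinAt) (fun _ _ => trivial)
      (fun t _ => (hg' t).continuousAt.continuousWithinAt)
      (fun t _ => (hg' t).hasDerivWithinAt) (fun _ _ => trivial) (by simp [Real.dist_eq])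
      (-x) ⟨by linarith, le_rfl⟩
    simpa [Real.dist_eq] using this

theorem hasDerivAt_of_tendsto (hb : TameField b) {ι : Type*} {l : Filter ι} [l.NeBot]
    {u : ι → ℝ → ℝ} {v : ℝ → ℝ} (hu : ∀ i x, HasDerivAt (u i) (b (u i x) x) x)
    (hv : ∀ x, Tendsto (fun i => u i x) l (nhds (v x))) (x : ℝ) :
    HasDerivAt v (b (v x) x) x := by
  obtain ⟨w, hw0, hw⟩ := hb.exists_solution (v 0)
  have : v = w := by
    funext y
    obtain ⟨L, hL⟩ := hb.exists_gronwall |y|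
    refine tendsto_nhds_unique (hv y) ?_
    rw [tendsto_iff_dist_tendsto_zero]
    refine squeeze_zero (fun _ => dist_nonneg) (fun i => hL _ _ (hu i) hw y le_rfl) ?_
    have h0 := (tendsto_iff_dist_tendsto_zero.1 (hv 0)).mul_const (Real.exp (L * |y|))
    rw [zero_mul] at h0
    rw [hw0]
    exact h0
  rw [this]
  exact hw x

theorem tendsto_atTop_of_antitoneOn {ψ : ℝ → ℝ} (hψ : AntitoneOn ψ (Ici 0)) {ℓ : ℝ}
    (h : Tendsto (fun n : ℕ => ψ n) atTop (nhds ℓ)) : Tendsto ψ atTop (nhds ℓ) := by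
  have h1 : Tendsto (fun s : ℝ => ψ (⌊s⌋₊ : ℝ)) atTop (nhds ℓ) :=
    h.comp tendsto_nat_floor_atTop
  have h2 : Tendsto (fun s : ℝ => ψ (⌈s⌉₊ : ℝ)) atTop (nhds ℓ) :=
    h.comp tendsto_nat_ceil_atTop
  refine tendsto_of_tendsto_of_tendsto_of_le_of_le' h2 h1 ?_ ?_
  · filter_upwards [eventually_ge_atTop 0] with s hs
    exact hψ hs (Nat.cast_nonneg (α := ℝ) _) (Nat.le_ceil s)
  · filter_upwards [eventually_ge_atTop 0] with s hs
    exact hψ (Nat.cast_nonneg (α := ℝ) _) hs (Nat.floor_le hs)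

/-- A monotone family of bounded solutions, indexed by their starting time, converges to a
solution as the starting time goes to `-∞` (`σ = 1`) or to `+∞` (`σ = -1`). -/
theorem hasDerivAt_iInf (hb : TameField b) {u : ℝ → ℝ → ℝ} {σ R : ℝ} (hσ : σ * σ = 1)
    (hu : ∀ y x, HasDerivAt (u y) (b (u y x) x) x)
    (hR : ∀ x s, 0 ≤ s → -R ≤ u (x - σ * s) x)
    (hanti : ∀ x, AntitoneOn (fun s => u (x - σ * s) x) (Ici 0)) (x : ℝ) :
    HasDerivAt (fun x => ⨅ n : ℕ, u (x - σ * n) x) (b (⨅ n : ℕ, u (x - σ * n) x) x) x := by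
  refine hb.hasDerivAt_of_tendsto (u := fun s => u (-(σ * s))) (l := atTop)
    (fun s => hu _) (v := fun x => ⨅ n : ℕ, u (x - σ * n) x) (fun x => ?_) x
  have h1 : Tendsto (fun n : ℕ => u (x - σ * n) x) atTop (nhds (⨅ n : ℕ, u (x - σ * n) x)) := by
    refine tendsto_atTop_ciInf (fun n m hnm => ?_) ⟨-R, ?_⟩
    · exact hanti x (Nat.cast_nonneg (α := ℝ) n) (Nat.cast_nonneg (α := ℝ) m) (by exact_mod_cast hnm)
    · rintro _ ⟨n, rfl⟩
      exact hR x n n.cast_nonneg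
  have h2 := (tendsto_atTop_of_antitoneOn (hanti x) h1).comp
    (tendsto_atTop_add_const_right atTop (σ * x) tendsto_id)
  refine h2.congr fun s => ?_
  simp only [Function.comp_apply, id_eq]
  congr 1
  linear_combination -x * hσ

end TameField

/-- A measurable vector field generating a tame field along each orbit of the flow `τ`. -/
structure StationaryField {Ω : Type*} [MeasurableSpace Ω] (τ : ℝ → Ω → Ω) (β : ℝ → Ω → ℝ) :
    Prop where
  meas : Measurable fun q : ℝ × Ω => β q.1 q.2
  tame : ∀ ω, TameField fun p x => β p (τ x ω)

/-- `F` is a supersolution of the field `β` along the orbit of `ω`. -/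
def IsSuperOrbit {Ω : Type*} (τ : ℝ → Ω → Ω) (β : ℝ → Ω → ℝ) (F : Ω → ℝ) (ω : Ω) : Prop :=
  ∃ D : ℝ → ℝ, (∀ x, HasDerivAt (fun x => F (τ x ω)) (D x) x) ∧
    ∀ x, β (F (τ x ω)) (τ x ω) ≤ D x

/-- Truncation of a real number at levels `-R` and `R`. -/
noncomputable def trunc (R p : ℝ) : ℝ := max (-R) (min R p)

theorem trunc_of_abs_le {R p : ℝ} (h : |p| ≤ R) : trunc R p = p := by
  rw [abs_le] at h
  rw [trunc, min_eq_right h.2, max_eq_right h.1]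

theorem abs_trunc_le {R : ℝ} (hR : 0 ≤ R) (p : ℝ) : |trunc R p| ≤ R :=
  abs_le.2 ⟨le_max_left _ _, max_le (by linarith) (min_le_left _ _)⟩

theorem trunc_mono (R : ℝ) : Monotone (trunc R) := fun _ _ h =>
  max_le_max le_rfl (min_le_min le_rfl h)

namespace StationaryField

variable {Ω : Type*} [MeasurableSpace Ω] {P : Measure Ω} {τ : ℝ → Ω → Ω} {β : ℝ → Ω → ℝ}

/-- The solution, along the orbit of `ω`, taking the value `p` at `0`. -/
noncomputable def base (hβ : StationaryField τ β) (ω : Ω) (p : ℝ) : ℝ → ℝ :=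
  Classical.choose ((hβ.tame ω).exists_solution p)

/-- The solution, along the orbit of `ω`, taking the value `p` at `y`. -/
noncomputable def sol (hβ : StationaryField τ β) (ω : Ω) (y p x : ℝ) : ℝ :=
  hβ.base (τ y ω) p (x - y)

theorem sol_self (hβ : StationaryField τ β) (ω : Ω) (y p : ℝ) : hβ.sol ω y p y = p := by
  rw [sol, sub_self]
  exact (Classical.choose_spec ((hβ.tame (τ y ω)).exists_solution p)).1

theorem hasDerivAt_sol (hτ : ErgodicFlow P τ) (hβ : StationaryField τ β) (ω : Ω) (y p x : ℝ) :
    HasDerivAt (hβ.sol ω y p) (β (hβ.sol ω y p x) (τ x ω)) x := by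
  have h := (Classical.choose_spec ((hβ.tame (τ y ω)).exists_solution p)).2 (x - y)
  rw [← hτ.add, sub_add_cancel] at h
  exact h.comp_sub_const x y

theorem sol_shift (hτ : ErgodicFlow P τ) (hβ : StationaryField τ β) (ω : Ω) (y z p x : ℝ) :
    hβ.sol (τ z ω) y p x = hβ.sol ω (y + z) p (x + z) := by
  rw [sol, sol, ← hτ.add, add_sub_add_right_eq_sub]

theorem measurable_sol (hτ : ErgodicFlow P τ) (hβ : StationaryField τ β) {F : Ω → ℝ}
    (hF : Measurable F) (y x : ℝ) : Measurable fun ω => hβ.sol ω y (F (τ y ω)) x := by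
  have hb : Measurable fun q : Ω × ℝ × ℝ => β q.2.1 (τ q.2.2 q.1) :=
    hβ.meas.comp ((measurable_fst.comp measurable_snd).prodMk
      (hτ.meas.comp ((measurable_snd.comp measurable_snd).prodMk measurable_fst)))
  have h := measurable_solution (b := fun ω p x => β p (τ x ω)) hb hβ.tame hF
    (f := fun ω => hβ.base ω (F ω))
    (fun ω => (Classical.choose_spec ((hβ.tame ω).exists_solution (F ω))).1)
    (fun ω => (Classical.choose_spec ((hβ.tame ω).exists_solution (F ω))).2)
  have h2 : Measurable fun ω => (τ y ω, x - y) := (hτ.mp y).measurable.prodMk measurable_const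
  exact h.comp h2

/-- The truncated value at `0` of the solution agreeing with `F` at `-s`. -/
noncomputable def push (hβ : StationaryField τ β) (R : ℝ) (F : Ω → ℝ) (s : ℝ) (ω : Ω) : ℝ :=
  trunc R (hβ.sol ω (-s) (F (τ (-s) ω)) 0)

theorem measurable_push (hτ : ErgodicFlow P τ) (hβ : StationaryField τ β) (R : ℝ) {F : Ω → ℝ}
    (hF : Measurable F) (s : ℝ) : Measurable (hβ.push R F s) :=
  measurable_const.max (measurable_const.min (hβ.measurable_sol hτ hF (-s) 0))

theorem push_orbit (hτ : ErgodicFlow P τ) (hβ : StationaryField τ β) (R : ℝ) (F : Ω → ℝ)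
    (s x : ℝ) (ω : Ω) :
    hβ.push R F s (τ x ω) = trunc R (hβ.sol ω (x - s) (F (τ (x - s) ω)) x) := by
  rw [push, hβ.sol_shift hτ, ← hτ.add, zero_add, neg_add_eq_sub]

section comparison

variable (hτ : ErgodicFlow P τ) (hβ : StationaryField τ β) {F : Ω → ℝ} {ω : Ω} {x y y' : ℝ}

include hτ

theorem sol_le_const_right {p : ℝ} {q : ℝ} (hq : ∀ ω, β q ω ≤ 0) (h : hβ.sol ω y' p y ≤ q)
    (hyx : y ≤ x) : hβ.sol ω y' p x ≤ q :=
  (hβ.tame ω).le_right (g := fun _ => q) (hβ.hasDerivAt_sol hτ ω y' p) (fun _ => le_rfl)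
    (fun x => hasDerivAt_const x q) (fun _ => hq _) h hyx

theorem const_le_sol_left {p : ℝ} {q : ℝ} (hq : ∀ ω, β q ω ≤ 0) (h : q ≤ hβ.sol ω y' p y)
    (hxy : x ≤ y) : q ≤ hβ.sol ω y' p x :=
  (hβ.tame ω).le_left (g := fun _ => q) (hβ.hasDerivAt_sol hτ ω y' p) (fun _ => le_rfl)
    (fun x => hasDerivAt_const x q) (fun _ => hq _) h hxy

theorem sol_le_of_isSuperOrbit (hF : IsSuperOrbit τ β F ω) (hyx : y ≤ x) :
    hβ.sol ω y (F (τ y ω)) x ≤ F (τ x ω) := by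
  obtain ⟨D, hD, hD'⟩ := hF
  exact (hβ.tame ω).le_right (hβ.hasDerivAt_sol hτ ω y _) (fun _ => le_rfl) hD hD'
    (by rw [hβ.sol_self]) hyx

theorem le_sol_of_isSuperOrbit (hF : IsSuperOrbit τ β F ω) (hxy : x ≤ y) :
    F (τ x ω) ≤ hβ.sol ω y (F (τ y ω)) x := by
  obtain ⟨D, hD, hD'⟩ := hF
  exact (hβ.tame ω).le_left (hβ.hasDerivAt_sol hτ ω y _) (fun _ => le_rfl) hD hD'
    (by rw [hβ.sol_self]) hxy

theorem sol_le_sol_of_isSuperOrbit (hF : IsSuperOrbit τ β F ω) (hy : y' ≤ y) (hyx : y ≤ x) :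
    hβ.sol ω y' (F (τ y' ω)) x ≤ hβ.sol ω y (F (τ y ω)) x :=
  (hβ.tame ω).le_right (hβ.hasDerivAt_sol hτ ω y' _) (fun _ => le_rfl)
    (hβ.hasDerivAt_sol hτ ω y _) (fun _ => le_rfl)
    (by rw [hβ.sol_self]; exact hβ.sol_le_of_isSuperOrbit hτ hF hy) hyx

variable {E : ℝ → ℝ} (hE : ∀ x, HasDerivAt (fun x => F (τ x ω)) (E x) x)
  (hE' : ∀ x, E x ≤ β (F (τ x ω)) (τ x ω))

include hE hE'

theorem sol_le_of_sub (hxy : x ≤ y) : hβ.sol ω y (F (τ y ω)) x ≤ F (τ x ω) :=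
  (hβ.tame ω).le_left hE hE' (hβ.hasDerivAt_sol hτ ω y _) (fun _ => le_rfl)
    (by rw [hβ.sol_self]) hxy

theorem le_sol_of_sub (hyx : y ≤ x) : F (τ x ω) ≤ hβ.sol ω y (F (τ y ω)) x :=
  (hβ.tame ω).le_right hE hE' (hβ.hasDerivAt_sol hτ ω y _) (fun _ => le_rfl)
    (by rw [hβ.sol_self]) hyx

theorem sol_le_sol_of_sub (hy : y ≤ y') (hxy : x ≤ y) :
    hβ.sol ω y' (F (τ y' ω)) x ≤ hβ.sol ω y (F (τ y ω)) x :=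
  (hβ.tame ω).le_left (hβ.hasDerivAt_sol hτ ω y _) (fun _ => le_rfl)
    (hβ.hasDerivAt_sol hτ ω y' _) (fun _ => le_rfl)
    (by rw [hβ.sol_self]; exact hβ.sol_le_of_sub hτ hE hE' hy) hxy

end comparison

end StationaryField

/-- The integrals of `φ` over intervals based at `0` grow like `E` times their length. -/
def HasAverage (φ : ℝ → ℝ) (E : ℝ) : Prop :=
  ∀ δ > (0 : ℝ), ∃ B, ∀ z : ℝ, |(∫ x in (0 : ℝ)..z, φ x) - E * z| ≤ δ * |z| + B

theorem HasAverage.comp_neg {φ : ℝ → ℝ} {E : ℝ} (h : HasAverage φ E) :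
    HasAverage (fun x => φ (-x)) E := by
  intro δ hδ
  obtain ⟨B, hB⟩ := h δ hδ
  refine ⟨B, fun z => ?_⟩
  have := hB (-z)
  rw [intervalIntegral.integral_comp_neg, neg_zero, intervalIntegral.integral_symm, ← abs_neg]
  rw [abs_neg z] at this
  convert this using 2
  ring

theorem HasAverage.window {φ : ℝ → ℝ} {E : ℝ} (h : HasAverage φ E)
    (hφ : ∀ x y, IntervalIntegrable φ volume x y) {M r η : ℝ} (hM : 0 < M) (hr : 0 < r)
    (hη : 0 < η) : ∃ N₀, ∀ N ≥ N₀, ∀ y z, |y| ≤ M * N → |z| ≤ r * N →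
      |(∫ x in y..(y + z), φ x) - E * z| ≤ η * N := by
  obtain ⟨B, hB⟩ := h (η / (2 * (2 * M + r))) (by positivity)
  refine ⟨4 * B / η, fun N hN y z hy hz => ?_⟩
  have h1 := abs_le.1 (hB y)
  have h2 := abs_le.1 (hB (y + z))
  have h3 := intervalIntegral.integral_add_adjacent_intervals (hφ 0 y) (hφ y (y + z))
  have h4 : η / (2 * (2 * M + r)) * |y| + η / (2 * (2 * M + r)) * |y + z| ≤ η / 2 * N := by
    have : |y| + |y + z| ≤ (2 * M + r) * N := by linarith [abs_add_le y z]
    calc _ = η / (2 * (2 * M + r)) * (|y| + |y + z|) := by ring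
      _ ≤ η / (2 * (2 * M + r)) * ((2 * M + r) * N) := by gcongr
      _ = η / 2 * N := by field_simp
  have h5 : 2 * B ≤ η / 2 * N := by
    have := (div_le_iff₀ hη).1 hN
    linarith
  rw [abs_le]
  constructor <;> linarith

theorem integral_le_add_of_le {f g : ℝ → ℝ} (hf : ∀ x y, IntervalIntegrable f volume x y)
    (hg : ∀ x y, IntervalIntegrable g volume x y) {C s y z : ℝ} (hC : 0 ≤ C) (hs : 0 ≤ s)
    (h1 : ∀ x, y ≤ x → f x ≤ g x + C) (h2 : ∀ x, y + s ≤ x → f x ≤ g x) (hz : 0 ≤ z) :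
    ∫ x in y..(y + z), f x ≤ (∫ x in y..(y + z), g x) + C * s := by
  have key : ∀ w, 0 ≤ w → ∫ x in y..(y + w), f x ≤ (∫ x in y..(y + w), g x) + C * w := by
    intro w hw
    have := intervalIntegral.integral_mono_on (by linarith) (hf y (y + w))
      ((hg y (y + w)).add (intervalIntegrable_const (c := C))) (fun x hx => h1 x hx.1)
    rw [intervalIntegral.integral_add (hg _ _) intervalIntegrable_const] at this
    simp at this
    linarith
  rcases le_total z s with hzs | hzs
  · have := key z hz
    have := mul_le_mul_of_nonneg_left hzs hC
    linarith
  · have e1 := intervalIntegral.integral_add_adjacent_intervals (hf y (y + s)) (hf (y + s) (y + z))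
    have e2 := intervalIntegral.integral_add_adjacent_intervals (hg y (y + s)) (hg (y + s) (y + z))
    have := key s hs
    have := intervalIntegral.integral_mono_on (by linarith) (hf (y + s) (y + z))
      (hg (y + s) (y + z)) (fun x hx => h2 x hx.1)
    linarith

theorem integral_sub_le_of_compare {u : ℝ → ℝ → ℝ} {ψ : ℝ → ℝ} {E θ C : ℝ}
    (hu : ∀ y, Continuous (u y)) (hψ : HasAverage ψ E)
    (hψi : ∀ x y, IntervalIntegrable ψ volume x y) (hE : θ ≤ E)
    (hψu : ∀ y x, x ≤ y → ψ x ≤ u y x) (hC : 0 ≤ C)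
    (hφ : ∀ κ > (0 : ℝ), ∃ s : ℝ, 0 ≤ s ∧ ∃ (φ : ℝ → ℝ) (E' : ℝ), HasAverage φ E' ∧
      (∀ x y, IntervalIntegrable φ volume x y) ∧ E' ≤ θ + κ ∧
      (∀ y x, y ≤ x → u y x ≤ φ x + C) ∧ ∀ y x, y + s ≤ x → u y x ≤ φ x)
    {M r η : ℝ} (hM : 0 < M) (hr : 0 < r) (hη : 0 < η) :
    ∃ N₀, ∀ N ≥ N₀, ∀ y, |y| ≤ M * N → ∀ z, |z| ≤ r * N →
      ∫ x in y..(y + z), (u y x - θ) ≤ η * N := by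
  obtain ⟨s, hs, φ, E', hφ, hφi, hE', h1, h2⟩ := hφ (η / (3 * r)) (by positivity)
  obtain ⟨N₁, hN₁⟩ := hφ.window hφi hM hr (η := η / 3) (by positivity)
  obtain ⟨N₂, hN₂⟩ := hψ.window hψi hM hr hη
  refine ⟨max (max N₁ N₂) (3 * (C * s) / η), fun N hN y hy z hz => ?_⟩
  have hN1 := (le_max_left _ _).trans ((le_max_left _ _).trans hN)
  have hN2 := (le_max_right _ _).trans ((le_max_left _ _).trans hN)
  have hN3 := (div_le_iff₀ hη).1 ((le_max_right _ _).trans hN)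
  have hui : ∀ a b, IntervalIntegrable (u y) volume a b := fun a b => (hu y).intervalIntegrable a b
  rw [intervalIntegral.integral_sub (hui _ _) intervalIntegrable_const]
  simp only [intervalIntegral.integral_const, add_sub_cancel_left, smul_eq_mul]
  rcases le_total 0 z with h0 | h0
  · have h3 := integral_le_add_of_le hui hφi hC hs (h1 y) (h2 y) h0
    have h4 := (abs_le.1 (hN₁ N hN1 y z hy hz)).2
    rw [abs_of_nonneg h0] at hz
    have h5 : E' * z ≤ (θ + η / (3 * r)) * z := mul_le_mul_of_nonneg_right hE' h0
    have h6 : η / (3 * r) * z ≤ η / (3 * r) * (r * N) := by gcongr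
    have h7 : η / (3 * r) * (r * N) = η / 3 * N := by field_simp
    linarith
  · have h3 := intervalIntegral.integral_mono_on (by linarith) (hψi (y + z) y) (hui (y + z) y)
      (fun x hx => hψu y x hx.2)
    rw [intervalIntegral.integral_symm, intervalIntegral.integral_symm y (y + z)] at h3
    have h4 := (abs_le.1 (hN₂ N hN2 y z hy hz)).2
    have h5 : E * z ≤ θ * z := mul_le_mul_of_nonpos_right hE h0
    linarith

theorem ErgodicFlow.ae_hasAverage {Ω : Type*} [MeasurableSpace Ω] {P : Measure Ω}
    {τ : ℝ → Ω → Ω} (h : ErgodicFlow P τ) {k : Ω → ℝ} {C : ℝ} (hk : Measurable k)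
    (hC : ∀ ω, |k ω| ≤ C) : ∀ᵐ ω ∂P, HasAverage (fun x => k (τ x ω)) (∫ ω, k ω ∂P) :=
  h.abs_integral_orbit_sub_le hk hC

namespace StationaryField

variable {Ω : Type*} [MeasurableSpace Ω] {P : Measure Ω} {τ : ℝ → Ω → Ω} {β β' : ℝ → Ω → ℝ}
  {R : ℝ} {F : Ω → ℝ} {ω : Ω}

/-- The infimum of the truncated values at `0` of the solutions agreeing with `F` at `-σ * n`. -/
noncomputable def pushInf (hβ : StationaryField τ β) (R : ℝ) (F : Ω → ℝ) (σ : ℝ) (ω : Ω) : ℝ :=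
  ⨅ n : ℕ, hβ.push R F (σ * n) ω

theorem abs_push_le (hβ : StationaryField τ β) (hR : 0 ≤ R) (F : Ω → ℝ) (s : ℝ) (ω : Ω) :
    |hβ.push R F s ω| ≤ R := abs_trunc_le hR _

theorem bddBelow_push (hβ : StationaryField τ β) (F : Ω → ℝ) (σ : ℝ) (ω : Ω) :
    BddBelow (range fun n : ℕ => hβ.push R F (σ * n) ω) :=
  ⟨-R, by rintro _ ⟨n, rfl⟩; exact le_max_left _ _⟩

theorem abs_pushInf_le (hβ : StationaryField τ β) (hR : 0 ≤ R) (F : Ω → ℝ) (σ : ℝ) (ω : Ω) :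
    |hβ.pushInf R F σ ω| ≤ R :=
  abs_le.2 ⟨le_ciInf fun _ => le_max_left _ _,
    (ciInf_le (hβ.bddBelow_push F σ ω) 0).trans (abs_le.1 (hβ.abs_push_le hR F _ ω)).2⟩

theorem measurable_pushInf (hτ : ErgodicFlow P τ) (hβ : StationaryField τ β) (hF : Measurable F)
    (σ : ℝ) : Measurable (hβ.pushInf R F σ) :=
  Measurable.iInf fun _ => hβ.measurable_push hτ R hF _

theorem exists_integral_push_le (hτ : ErgodicFlow P τ) (hβ : StationaryField τ β) (hR : 0 ≤ R)
    (hF : Measurable F) {σ : ℝ} (hanti : ∀ᵐ ω ∂P, Antitone fun n : ℕ => hβ.push R F (σ * n) ω)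
    {κ : ℝ} (hκ : 0 < κ) :
    ∃ n : ℕ, ∫ ω, hβ.push R F (σ * n) ω ∂P ≤ ∫ ω, hβ.pushInf R F σ ω ∂P + κ := by
  have := hτ.prob
  have h : Tendsto (fun n : ℕ => ∫ ω, hβ.push R F (σ * n) ω ∂P) atTop
      (nhds (∫ ω, hβ.pushInf R F σ ω ∂P)) := by
    refine tendsto_integral_of_dominated_convergence (fun _ => R)
      (fun n => (hβ.measurable_push hτ R hF _).aestronglyMeasurable) (integrable_const R)
      (fun n => ae_of_all _ fun ω => hβ.abs_push_le hR F _ ω) ?_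
    filter_upwards [hanti] with ω hω
    exact tendsto_atTop_ciInf hω (hβ.bddBelow_push F σ ω)
  exact ((h.eventually (gt_mem_nhds (by linarith : ∫ ω, hβ.pushInf R F σ ω ∂P <
    ∫ ω, hβ.pushInf R F σ ω ∂P + κ))).exists).imp fun n hn => hn.le

theorem antitoneOn_of_isSuperOrbit (hτ : ErgodicFlow P τ) (hβ : StationaryField τ β)
    (hF : IsSuperOrbit τ β F ω) (x : ℝ) :
    AntitoneOn (fun s => hβ.sol ω (x - s) (F (τ (x - s) ω)) x) (Ici 0) := by
  intro s hs t _ hst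
  rw [mem_Ici] at hs
  exact hβ.sol_le_sol_of_isSuperOrbit hτ hF (by linarith) (by linarith)

/-- Corrector-like solutions with a prescribed upper bound on the slope: the case in which the
forward limit of a supersolution has small mean. -/
theorem integral_sol_sub_le (hτ : ErgodicFlow P τ) (hβ : StationaryField τ β) (hR : 0 ≤ R)
    (hneg : ∀ ω, β R ω ≤ 0) (hFm : Measurable F) (hFb : ∀ ω, |F ω| ≤ R)
    (hF : ∀ᵐ ω ∂P, IsSuperOrbit τ β F ω) {θ : ℝ} (hθ : θ ≤ ∫ ω, F ω ∂P)
    (hg : ∫ ω, hβ.pushInf R F 1 ω ∂P ≤ θ) :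
    ∀ᵐ ω ∂P, ∀ M r η : ℝ, 0 < M → 0 < r → 0 < η → ∃ N₀, ∀ N ≥ N₀, ∀ y, |y| ≤ M * N →
      ∀ z, |z| ≤ r * N →
        ∫ x in y..(y + z), (hβ.sol ω y (F (τ y ω)) x - θ) ≤ η * N := by
  have hanti : ∀ᵐ ω ∂P, Antitone fun n : ℕ => hβ.push R F (1 * n) ω := by
    filter_upwards [hF] with ω hω n m hnm
    have h := hβ.antitoneOn_of_isSuperOrbit hτ hω 0 (Nat.cast_nonneg (α := ℝ) n)
      (Nat.cast_nonneg (α := ℝ) m) (by exact_mod_cast hnm)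
    simp only [zero_sub] at h
    simpa [push] using trunc_mono R h
  have hav : ∀ᵐ ω ∂P, ∀ n : ℕ, HasAverage (fun x => hβ.push R F (1 * n) (τ x ω))
      (∫ ω, hβ.push R F (1 * n) ω ∂P) :=
    ae_all_iff.2 fun n => hτ.ae_hasAverage (hβ.measurable_push hτ R hFm _) (hβ.abs_push_le hR F _)
  filter_upwards [hF, hav, hτ.ae_hasAverage hFm hFb] with ω hω hav hav2 M r η hM hr hη
  refine integral_sub_le_of_compare (C := 2 * R)
    (fun y => continuous_iff_continuousAt.2 fun x => (hβ.hasDerivAt_sol hτ ω y _ x).continuousAt)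
    hav2 (hτ.intervalIntegrable hFm hFb ω) hθ (fun y x hxy => hβ.le_sol_of_isSuperOrbit hτ hω hxy)
    (by linarith) (fun κ hκ => ?_) hM hr hη
  obtain ⟨n, hn⟩ := hβ.exists_integral_push_le hτ hR hFm hanti hκ
  have hle : ∀ y x, y ≤ x → hβ.sol ω y (F (τ y ω)) x ≤ R := fun y x hyx =>
    hβ.sol_le_const_right hτ hneg (by rw [hβ.sol_self]; exact (abs_le.1 (hFb _)).2) hyx
  refine ⟨n, n.cast_nonneg, _, _, hav n,
    hτ.intervalIntegrable (hβ.measurable_push hτ R hFm _) (hβ.abs_push_le hR F _) ω,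
    by linarith, fun y x hyx => ?_, fun y x hyx => ?_⟩
  · have := (abs_le.1 (hβ.abs_push_le hR F (1 * n) (τ x ω))).1
    linarith [hle y x hyx]
  · have hn0 : (0 : ℝ) ≤ n := n.cast_nonneg
    rw [hβ.push_orbit hτ, one_mul]
    refine (hβ.sol_le_sol_of_isSuperOrbit hτ hω (by linarith : y ≤ x - n) (by linarith)).trans ?_
    rw [trunc, min_eq_right (hle _ _ (by linarith))]
    exact le_max_right _ _

/-- If the forward limit of a supersolution does not have the least possible mean, then almost
surely the pushed-forward supersolution stays above the truncation level. -/
theorem ae_neg_le_sol (hτ : ErgodicFlow P τ) (hβ : StationaryField τ β) (hR : 0 ≤ R)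
    (hneg : ∀ p ω, R ≤ |p| → β p ω ≤ 0) (hFm : Measurable F)
    (hF : ∀ᵐ ω ∂P, IsSuperOrbit τ β F ω) (hg : -R < ∫ ω, hβ.pushInf R F 1 ω ∂P) :
    ∀ᵐ ω ∂P, ∀ x s : ℝ, 0 ≤ s → -R ≤ hβ.sol ω (x - s) (F (τ (x - s) ω)) x := by
  have hprob := hτ.prob
  set N : Set Ω := {ω | ∃ n : ℕ, hβ.sol ω (-n) (F (τ (-n) ω)) 0 < -R} with hN
  have hNm : MeasurableSet N := by
    have : N = ⋃ n : ℕ, {ω | hβ.sol ω (-n) (F (τ (-n) ω)) 0 < -R} := by ext; simp [hN]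
    rw [this]
    exact MeasurableSet.iUnion fun n =>
      measurableSet_lt (hβ.measurable_sol hτ hFm _ _) measurable_const
  have hmem : ∀ ω x, τ x ω ∈ N ↔ ∃ n : ℕ, hβ.sol ω (x - n) (F (τ (x - n) ω)) x < -R := by
    intro ω x
    simp only [hN, mem_ofPred_eq, hβ.sol_shift hτ, ← hτ.add, zero_add, neg_add_eq_sub]
  have hfwd : ∀ ω, IsSuperOrbit τ β F ω → ∀ x x', x ≤ x' → τ x ω ∈ N → τ x' ω ∈ N := by
    intro ω hω x x' hxx hx
    obtain ⟨n, hn⟩ := (hmem ω x).1 hx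
    obtain ⟨m, hm⟩ := exists_nat_ge (n + (x' - x))
    have hn0 : (0 : ℝ) ≤ n := n.cast_nonneg
    refine (hmem ω x').2 ⟨m, ?_⟩
    refine (hβ.sol_le_sol_of_isSuperOrbit hτ hω (by linarith : x' - m ≤ x - n)
      (by linarith)).trans_lt (lt_of_le_of_lt ?_ hn)
    refine hβ.sol_le_const_right hτ (fun ω => hneg _ ω ?_) le_rfl hxx
    rw [abs_of_neg (by linarith)]
    linarith
  have hN0 : P N = 0 := by
    by_contra hpos
    have hind : Measurable (N.indicator fun _ => (1 : ℝ)) := measurable_const.indicator hNm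
    have hindb : ∀ ω, |N.indicator (fun _ => (1 : ℝ)) ω| ≤ 1 := fun ω => by
      by_cases h : ω ∈ N <;> simp [h]
    obtain ⟨ω, hωN, hω, hav⟩ : ∃ ω, ω ∈ N ∧ IsSuperOrbit τ β F ω ∧
        HasAverage (fun x => N.indicator (fun _ => (1 : ℝ)) (τ x ω))
          (∫ ω, N.indicator (fun _ => (1 : ℝ)) ω ∂P) := by
      by_contra! hc
      refine hpos (measure_eq_zero_iff_ae_notMem.2 ?_)
      filter_upwards [hF, hτ.ae_hasAverage hind hindb] with ω h1 h2 h3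
      exact hc ω h3 h1 h2
    rw [integral_indicator_const _ hNm, smul_eq_mul, mul_one] at hav
    have hone : ∀ z, 0 ≤ z → ∫ x in (0 : ℝ)..z, N.indicator (fun _ => (1 : ℝ)) (τ x ω) = z := by
      intro z hz
      have : ∫ x in (0 : ℝ)..z, N.indicator (fun _ => (1 : ℝ)) (τ x ω) =
          ∫ x in (0 : ℝ)..z, (1 : ℝ) := by
        refine intervalIntegral.integral_congr fun x hx => ?_
        rw [uIcc_of_le hz] at hx
        exact indicator_of_mem (hfwd ω hω 0 x hx.1 (by rwa [hτ.zero])) _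
      rw [this]; simp
    have h1 : 1 ≤ P.real N := by
      by_contra! hlt
      obtain ⟨B, hB⟩ := hav ((1 - P.real N) / 2) (by linarith)
      have hd : 0 < (1 - P.real N) / 2 := by linarith
      have := hB ((|B| + 1) / ((1 - P.real N) / 2))
      have hz0 : 0 ≤ (|B| + 1) / ((1 - P.real N) / 2) := by positivity
      rw [hone _ hz0, abs_of_nonneg hz0] at this
      have h2 := (abs_le.1 this).2
      have h3 : (1 - P.real N) / 2 * ((|B| + 1) / ((1 - P.real N) / 2)) = |B| + 1 := by
        field_simp
      have := le_abs_self B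
      linarith
    have hNae : ∀ᵐ ω ∂P, ω ∈ N := by
      have h2 : P N = 1 := by
        refine le_antisymm prob_le_one ?_
        rw [← ENNReal.ofReal_one, ← ofReal_measureReal (μ := P) (s := N)]
        exact ENNReal.ofReal_le_ofReal h1
      rw [← prob_compl_eq_zero_iff hNm] at h2
      exact measure_eq_zero_iff_ae_notMem.1 h2 |>.mono fun ω hω => by simpa using hω
    have : ∫ ω, hβ.pushInf R F 1 ω ∂P = ∫ _, -R ∂P := by
      refine integral_congr_ae (hNae.mono fun ω ⟨n, hn⟩ => ?_)
      refine le_antisymm ((ciInf_le (hβ.bddBelow_push F 1 ω) n).trans ?_)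
        (abs_le.1 (hβ.abs_pushInf_le hR F 1 ω)).1
      rw [push, trunc, one_mul, min_eq_right (by linarith), max_eq_left hn.le]
    simp at this
    linarith
  have hall : ∀ᵐ ω ∂P, ∀ n : ℕ, τ n ω ∉ N := by
    refine ae_all_iff.2 fun n => ?_
    exact (hτ.mp n).quasiMeasurePreserving.ae (measure_eq_zero_iff_ae_notMem.1 hN0)
  filter_upwards [hall, hF] with ω h1 hω x s hs
  obtain ⟨m, hm⟩ := exists_nat_ge x
  have hxN : τ x ω ∉ N := fun h => h1 m (hfwd ω hω x m hm h)
  rw [hmem] at hxN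
  push Not at hxN
  refine (hxN ⌈s⌉₊).trans (hβ.antitoneOn_of_isSuperOrbit hτ hω x hs
    (Nat.cast_nonneg (α := ℝ) _) (Nat.le_ceil s))

end StationaryField

namespace StationaryField

variable {Ω : Type*} [MeasurableSpace Ω] {P : Measure Ω} {τ : ℝ → Ω → Ω} {β β' : ℝ → Ω → ℝ}
  {R : ℝ} {F G : Ω → ℝ} {ω : Ω}

theorem pushInf_orbit_eq (hτ : ErgodicFlow P τ) (hβ : StationaryField τ β) {σ : ℝ}
    (hb : ∀ x s : ℝ, 0 ≤ s → |hβ.sol ω (x - σ * s) (F (τ (x - σ * s) ω)) x| ≤ R) (x : ℝ) :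
    hβ.pushInf R F σ (τ x ω) = ⨅ n : ℕ, hβ.sol ω (x - σ * n) (F (τ (x - σ * n) ω)) x := by
  rw [pushInf]
  congr 1
  funext n
  rw [hβ.push_orbit hτ, trunc_of_abs_le (hb x n n.cast_nonneg)]

theorem hasDerivAt_pushInf (hτ : ErgodicFlow P τ) (hβ : StationaryField τ β) {σ : ℝ}
    (hσ : σ * σ = 1)
    (hb : ∀ x s : ℝ, 0 ≤ s → |hβ.sol ω (x - σ * s) (F (τ (x - σ * s) ω)) x| ≤ R)
    (hanti : ∀ x, AntitoneOn (fun s => hβ.sol ω (x - σ * s) (F (τ (x - σ * s) ω)) x) (Ici 0))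
    (x : ℝ) :
    HasDerivAt (fun x => hβ.pushInf R F σ (τ x ω))
      (β (hβ.pushInf R F σ (τ x ω)) (τ x ω)) x := by
  simp only [hβ.pushInf_orbit_eq hτ hb]
  exact (hβ.tame ω).hasDerivAt_iInf (u := fun y => hβ.sol ω y (F (τ y ω))) hσ
    (fun y x => hβ.hasDerivAt_sol hτ ω y _ x) (fun x s hs => (abs_le.1 (hb x s hs)).1) hanti x

theorem pushInf_le (hτ : ErgodicFlow P τ) (hβ : StationaryField τ β) {σ : ℝ}
    (hb : ∀ x s : ℝ, 0 ≤ s → |hβ.sol ω (x - σ * s) (F (τ (x - σ * s) ω)) x| ≤ R) (x : ℝ) :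
    hβ.pushInf R F σ (τ x ω) ≤ F (τ x ω) := by
  refine (ciInf_le (hβ.bddBelow_push F σ (τ x ω)) 0).trans ?_
  have h0 := hb x 0 le_rfl
  rw [hβ.push_orbit hτ]
  simp only [Nat.cast_zero, mul_zero, sub_zero, hβ.sol_self] at h0 ⊢
  rw [trunc_of_abs_le h0]

section backward

variable (hτ : ErgodicFlow P τ) (hβ' : StationaryField τ β') (hle : ∀ p ω, β p ω ≤ β' p ω)
  (hneg : ∀ p ω, R ≤ |p| → β' p ω ≤ 0) (hR : 0 ≤ R) (hGb : ∀ ω, |G ω| ≤ R)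
  (hG : ∀ x, HasDerivAt (fun x => G (τ x ω)) (β (G (τ x ω)) (τ x ω)) x)

include hτ hle hneg hR hGb hG

theorem abs_sol_le_of_orbit (y x : ℝ) : |hβ'.sol ω y (G (τ y ω)) x| ≤ R := by
  have hnR : ∀ ω, β' (-R) ω ≤ 0 := fun ω => hneg _ _ (by rw [abs_neg, abs_of_nonneg hR])
  have hpR : ∀ ω, β' R ω ≤ 0 := fun ω => hneg _ _ (by rw [abs_of_nonneg hR])
  have hb := fun ω => abs_le.1 (hGb ω)
  rcases le_total y x with h | h
  · exact abs_le.2 ⟨(hb _).1.trans (hβ'.le_sol_of_sub hτ hG (fun x => hle _ _) h),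
      hβ'.sol_le_const_right hτ hpR (by rw [hβ'.sol_self]; exact (hb _).2) h⟩
  · exact abs_le.2 ⟨hβ'.const_le_sol_left hτ hnR (by rw [hβ'.sol_self]; exact (hb _).1) h,
      (hβ'.sol_le_of_sub hτ hG (fun x => hle _ _) h).trans (hb _).2⟩

omit hneg hR hGb in
theorem antitoneOn_of_orbit (x : ℝ) :
    AntitoneOn (fun s => hβ'.sol ω (x - -1 * s) (G (τ (x - -1 * s) ω)) x) (Ici 0) := by
  intro s hs t _ hst
  rw [mem_Ici] at hs
  exact hβ'.sol_le_sol_of_sub hτ hG (fun x => hle _ _) (by linarith) (by linarith)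

end backward

/-- Corrector-like solutions with a prescribed lower bound on the slope: the case in which the
backward limit, for the larger field, of a stationary solution has small mean. -/
theorem neg_le_integral_sol_sub (hτ : ErgodicFlow P τ) (hβ' : StationaryField τ β')
    (hle : ∀ p ω, β p ω ≤ β' p ω) (hneg : ∀ p ω, R ≤ |p| → β' p ω ≤ 0) (hR : 0 ≤ R)
    (hGm : Measurable G) (hGb : ∀ ω, |G ω| ≤ R)
    (hG : ∀ᵐ ω ∂P, ∀ x, HasDerivAt (fun x => G (τ x ω)) (β (G (τ x ω)) (τ x ω)) x)
    {θ : ℝ} (hθ : θ ≤ ∫ ω, G ω ∂P) (hq : ∫ ω, hβ'.pushInf R G (-1) ω ∂P ≤ θ) :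
    ∀ᵐ ω ∂P, ∀ M r η : ℝ, 0 < M → 0 < r → 0 < η → ∃ N₀, ∀ N ≥ N₀, ∀ y, |y| ≤ M * N →
      (∀ x, |hβ'.sol ω y (G (τ y ω)) x| ≤ R) ∧ ∀ z, |z| ≤ r * N →
        -(η * N) ≤ ∫ x in y..(y + z), (hβ'.sol ω y (G (τ y ω)) x - θ) := by
  have hanti : ∀ᵐ ω ∂P, Antitone fun n : ℕ => hβ'.push R G (-1 * n) ω := by
    filter_upwards [hG] with ω hω n m hnm
    have h := hβ'.antitoneOn_of_orbit hτ hle hω 0 (Nat.cast_nonneg (α := ℝ) n)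
      (Nat.cast_nonneg (α := ℝ) m) (by exact_mod_cast hnm)
    simp only [zero_sub] at h
    simpa [push] using trunc_mono R h
  have hav : ∀ᵐ ω ∂P, ∀ n : ℕ, HasAverage (fun x => hβ'.push R G (-1 * n) (τ x ω))
      (∫ ω, hβ'.push R G (-1 * n) ω ∂P) :=
    ae_all_iff.2 fun n => hτ.ae_hasAverage (hβ'.measurable_push hτ R hGm _) (hβ'.abs_push_le hR G _)
  filter_upwards [hG, hav, hτ.ae_hasAverage hGm hGb] with ω hω hav hav2 M r η hM hr hη
  have hb := hβ'.abs_sol_le_of_orbit hτ hle hneg hR hGb hω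
  refine Exists.elim (integral_sub_le_of_compare
    (u := fun y x => hβ'.sol ω (-y) (G (τ (-y) ω)) (-x)) (θ := θ) (C := 2 * R) (M := M) (r := r)
    (η := η)
    (fun y => (continuous_iff_continuousAt.2
      fun x => (hβ'.hasDerivAt_sol hτ ω (-y) _ x).continuousAt).comp continuous_neg)
    hav2.comp_neg (hτ.neg.intervalIntegrable hGm hGb ω)
    hθ (fun y x hxy => hβ'.le_sol_of_sub hτ hω (fun x => hle _ _) (by linarith))
    (by linarith) (fun κ hκ => ?_) hM hr hη) fun N₀ hN₀ => ?_
  rotate_left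
  · refine ⟨N₀, fun N hN y hy => ⟨hb y, fun z hz => ?_⟩⟩
    have h := hN₀ N hN (-y) (by rwa [abs_neg]) (-z) (by rwa [abs_neg])
    rw [intervalIntegral.integral_comp_neg (fun x => hβ'.sol ω (- -y) (G (τ (- -y) ω)) x - θ),
      intervalIntegral.integral_symm] at h
    simp only [neg_neg, neg_add_rev] at h
    rw [add_comm z y] at h
    linarith
  · obtain ⟨n, hn⟩ := hβ'.exists_integral_push_le hτ hR hGm hanti hκ
    have hn0 : (0 : ℝ) ≤ n := n.cast_nonneg
    refine ⟨n, hn0, _, _, (hav n).comp_neg,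
      hτ.neg.intervalIntegrable (hβ'.measurable_push hτ R hGm (-1 * n)) (hβ'.abs_push_le hR G _) ω,
      by linarith, fun y x hyx => ?_,
      fun y x hyx => ?_⟩
    · have := (abs_le.1 (hβ'.abs_push_le hR G (-1 * n) (τ (-x) ω))).1
      linarith [(abs_le.1 (hb (-y) (-x))).2]
    · rw [hβ'.push_orbit hτ, trunc_of_abs_le (hb _ _)]
      exact hβ'.sol_le_sol_of_sub hτ hω (fun x => hle _ _) (by linarith) (by linarith)

theorem integrable_of_abs_le [IsFiniteMeasure P] (hFm : Measurable F) (hFb : ∀ ω, |F ω| ≤ R) :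
    Integrable F P :=
  (integrable_const R).mono' hFm.aestronglyMeasurable (ae_of_all _ hFb)

/-- For a pair of ordered fields with a uniform gap, either the lower field has solutions with
slope asymptotically at most `θ`, or the upper field has bounded solutions with slope
asymptotically at least `θ`. -/
theorem dichotomy (hτ : ErgodicFlow P τ) (hβ : StationaryField τ β) (hβ' : StationaryField τ β')
    (hR : 0 ≤ R) (hle : ∀ p ω, β p ω ≤ β' p ω) (hneg : ∀ p ω, R ≤ |p| → β' p ω ≤ 0)
    {d K : ℝ} (hd : 0 < d) (hK : 0 < K)
    (hgap : ∀ p q ω, q ≤ p → 0 ≤ d - K * (p - q) → d - K * (p - q) ≤ β' p ω - β q ω)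
    {θ : ℝ} (hθ : |θ| ≤ R) :
    (∀ᵐ ω ∂P, ∀ M r η : ℝ, 0 < M → 0 < r → 0 < η → ∃ N₀, ∀ N ≥ N₀, ∀ y, |y| ≤ M * N →
      ∃ f : ℝ → ℝ, (∀ x, HasDerivAt f (β' (f x) (τ x ω)) x) ∧ (∀ x, |f x| ≤ R) ∧
        ∀ z, |z| ≤ r * N → -(η * N) ≤ ∫ x in y..(y + z), (f x - θ)) ∨
    (∀ᵐ ω ∂P, ∀ M r η : ℝ, 0 < M → 0 < r → 0 < η → ∃ N₀, ∀ N ≥ N₀, ∀ y, |y| ≤ M * N →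
      ∃ f : ℝ → ℝ, (∀ x, HasDerivAt f (β (f x) (τ x ω)) x) ∧
        ∀ z, |z| ≤ r * N → ∫ x in y..(y + z), (f x - θ) ≤ η * N) := by
  have hprob := hτ.prob
  set S : Set ℝ := {e | ∃ F : Ω → ℝ, Measurable F ∧ (∀ ω, |F ω| ≤ R) ∧
    (∀ᵐ ω ∂P, IsSuperOrbit τ β' F ω) ∧ ∫ ω, F ω ∂P = e ∧ θ ≤ e} with hS
  have hSne : S.Nonempty := by
    refine ⟨R, fun _ => R, measurable_const, fun _ => (abs_of_nonneg hR).le, ae_of_all _ fun ω => ?_,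
      by simp, (abs_le.1 hθ).2⟩
    exact ⟨fun _ => 0, fun x => hasDerivAt_const x R, fun x => hneg _ _ (abs_of_nonneg hR).ge⟩
  have hSbdd : BddBelow S := ⟨θ, fun e ⟨_, _, _, _, _, h⟩ => h⟩
  obtain ⟨_, ⟨F, hFm, hFb, hF', rfl, hFθ⟩, hFlt⟩ :=
    exists_lt_of_csInf_lt hSne (show sInf S < sInf S + d / (4 * K) by
      have : 0 < d / (4 * K) := by positivity
      linarith)
  have hneg' : ∀ p ω, R ≤ |p| → β p ω ≤ 0 := fun p ω h => (hle p ω).trans (hneg p ω h)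
  have hF : ∀ᵐ ω ∂P, IsSuperOrbit τ β F ω :=
    hF'.mono fun ω ⟨D, hD, hD'⟩ => ⟨D, hD, fun x => (hle _ _).trans (hD' x)⟩
  rcases le_or_gt (∫ ω, hβ.pushInf R F 1 ω ∂P) θ with hg | hg
  · right
    filter_upwards [hβ.integral_sol_sub_le hτ hR (fun ω => hneg' _ _ (abs_of_nonneg hR).ge) hFm hFb
      hF hFθ hg] with ω hω M r η hM hr hη
    obtain ⟨N₀, h⟩ := hω M r η hM hr hη
    exact ⟨N₀, fun N hN y hy => ⟨_, fun x => hβ.hasDerivAt_sol hτ ω y _ x, h N hN y hy⟩⟩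
  left
  set G := hβ.pushInf R F 1 with hGdef
  have hGm : Measurable G := hβ.measurable_pushInf hτ hFm 1
  have hGb : ∀ ω, |G ω| ≤ R := hβ.abs_pushInf_le hR F 1
  have hsolb : ∀ᵐ ω ∂P, ∀ x s : ℝ, 0 ≤ s →
      |hβ.sol ω (x - 1 * s) (F (τ (x - 1 * s) ω)) x| ≤ R := by
    filter_upwards [hβ.ae_neg_le_sol hτ hR hneg' hFm hF ((abs_le.1 hθ).1.trans_lt hg)]
      with ω hω x s hs
    rw [one_mul]
    exact abs_le.2 ⟨hω x s hs, hβ.sol_le_const_right hτ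
      (fun ω => hneg' _ _ (abs_of_nonneg hR).ge)
      (by rw [hβ.sol_self]; exact (abs_le.1 (hFb _)).2) (by linarith)⟩
  have hG : ∀ᵐ ω ∂P, ∀ x, HasDerivAt (fun x => G (τ x ω)) (β (G (τ x ω)) (τ x ω)) x := by
    filter_upwards [hsolb, hF] with ω h1 h2
    exact hβ.hasDerivAt_pushInf hτ (one_mul 1) h1
      (by simpa using hβ.antitoneOn_of_isSuperOrbit hτ h2)
  have hGF : ∀ᵐ ω ∂P, ∀ x, G (τ x ω) ≤ F (τ x ω) :=
    hsolb.mono fun ω h => hβ.pushInf_le hτ h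
  rcases le_or_gt (∫ ω, hβ'.pushInf R G (-1) ω ∂P) θ with hq | hq
  · filter_upwards [hβ'.neg_le_integral_sol_sub hτ hle hneg hR hGm hGb hG hg.le hq]
      with ω hω M r η hM hr hη
    obtain ⟨N₀, h⟩ := hω M r η hM hr hη
    exact ⟨N₀, fun N hN y hy => ⟨_, fun x => hβ'.hasDerivAt_sol hτ ω y _ x, h N hN y hy⟩⟩
  exfalso
  have hbb : ∀ᵐ ω ∂P, ∀ x s : ℝ, 0 ≤ s →
      |hβ'.sol ω (x - -1 * s) (G (τ (x - -1 * s) ω)) x| ≤ R :=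
    hG.mono fun ω h x s _ => hβ'.abs_sol_le_of_orbit hτ hle hneg hR hGb h _ _
  have hmem : ∫ ω, hβ'.pushInf R G (-1) ω ∂P ∈ S := by
    refine ⟨_, hβ'.measurable_pushInf hτ hGm _, hβ'.abs_pushInf_le hR G _, ?_, rfl, hq.le⟩
    filter_upwards [hbb, hG] with ω h1 h2
    exact ⟨_, hβ'.hasDerivAt_pushInf hτ (by norm_num) h1 (hβ'.antitoneOn_of_orbit hτ hle h2),
      fun x => le_rfl⟩
  have h1 := csInf_le hSbdd hmem
  have hGi := integrable_of_abs_le (P := P) hGm hGb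
  have hFi := integrable_of_abs_le (P := P) hFm hFb
  have h2 : ∫ ω, hβ'.pushInf R G (-1) ω ∂P ≤ ∫ ω, G ω ∂P := by
    refine integral_mono_ae (integrable_of_abs_le (hβ'.measurable_pushInf hτ hGm _)
      (hβ'.abs_pushInf_le hR G _)) hGi ?_
    filter_upwards [hbb] with ω h
    simpa [hτ.zero] using hβ'.pushInf_le hτ h 0
  have h3 : ∫ _, d / (2 * K) ∂P ≤ ∫ ω, (F ω - G ω) ∂P := by
    refine integral_mono_ae (integrable_const _) (hFi.sub hGi) ?_
    filter_upwards [hF', hG, hGF] with ω ⟨D, hD, hD'⟩ h4 h5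
    have := lower_bound_of_deriv_ge (D := fun x => F (τ x ω) - G (τ x ω)) hd hK
      (fun x => sub_nonneg.2 (h5 x)) (fun x => (hD x).sub (h4 x)) (fun x hx => by
        have := hgap _ _ (τ x ω) (h5 x) hx
        have := hD' x
        linarith) 0
    simpa [hτ.zero] using this
  rw [integral_sub hFi hGi] at h3
  simp only [integral_const, probReal_univ, smul_eq_mul, one_mul] at h3
  have h4 : d / (2 * K) = d / (4 * K) + d / (4 * K) := by field_simp; norm_num
  have h5 : 0 < d / (4 * K) := by positivity
  linarith

end StationaryField

/-- Existence, around every point of a window of size proportional to `N`, of functions `f` for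
which `f` is a subsolution of the cell problem with right-hand side `c`, and whose primitive lies
almost above the line of slope `θ`. The inequality is required to be stable, with constant `K`,
under perturbations of the gradient of size at most `ρ`. -/
def HasUpperCorrectors (a : ℝ → ℝ) (H : ℝ → ℝ → ℝ) (θ c K ρ : ℝ) : Prop :=
  ∀ M r η : ℝ, 0 < M → 0 < r → 0 < η → ∃ N₀, ∀ N ≥ N₀, ∀ y, |y| ≤ M * N →
    ∃ f f' : ℝ → ℝ, (∀ x, HasDerivAt f (f' x) x) ∧ Continuous f' ∧
      (∀ x p, |p - f x| ≤ ρ → a x * f' x + H p x ≤ c + K * |p - f x|) ∧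
      ∀ z, |z| ≤ r * N → -(η * N) ≤ ∫ x in y..(y + z), (f x - θ)

/-- The counterpart of `HasUpperCorrectors` under the reflection `u ↦ -u`. -/
def HasLowerCorrectors (a : ℝ → ℝ) (H : ℝ → ℝ → ℝ) (θ c K ρ : ℝ) : Prop :=
  HasUpperCorrectors a (fun p x => -H (-p) x) (-θ) (-c) K ρ

section deterministic

variable {a : ℝ → ℝ} {H : ℝ → ℝ → ℝ} {θ c K ρ : ℝ}

theorem HasUpperCorrectors.mono (h : HasUpperCorrectors a H θ c K ρ) {c' ρ' : ℝ} (hc : c ≤ c')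
    (hρ : ρ' ≤ ρ) : HasUpperCorrectors a H θ c' K ρ' := by
  intro M r η hM hr hη
  obtain ⟨N₀, hN₀⟩ := h M r η hM hr hη
  refine ⟨N₀, fun N hN y hy => ?_⟩
  obtain ⟨f, f', h1, h2, h3, h4⟩ := hN₀ N hN y hy
  exact ⟨f, f', h1, h2, fun x p hp => (h3 x p (hp.trans hρ)).trans (by linarith), h4⟩

theorem HasUpperCorrectors.shift (h : HasUpperCorrectors a H θ c K ρ) (hK : 0 ≤ K) (s : ℝ) :
    HasUpperCorrectors a H (θ + s) (c + K * |s|) K (ρ - |s|) := by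
  intro M r η hM hr hη
  obtain ⟨N₀, hN₀⟩ := h M r η hM hr hη
  refine ⟨N₀, fun N hN y hy => ?_⟩
  obtain ⟨f, f', h1, h2, h3, h4⟩ := hN₀ N hN y hy
  refine ⟨fun x => f x + s, f', fun x => (h1 x).add_const s, h2, fun x p hp => ?_, fun z hz => ?_⟩
  · have h5 : |p - f x| ≤ |p - (f x + s)| + |s| := by
      have := abs_add_le (p - (f x + s)) s
      rwa [show p - (f x + s) + s = p - f x by ring] at this
    have := mul_le_mul_of_nonneg_left h5 hK
    linarith [h3 x p (by linarith)]
  · simpa only [add_sub_add_right_eq_sub] using h4 z hz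

theorem hasUpperCorrectors_of_le (hK : 0 ≤ K) (h : ∀ x p, |p - θ| ≤ ρ → H p x ≤ c) :
    HasUpperCorrectors a H θ c K ρ := by
  intro M r η _ _ hη
  refine ⟨0, fun N hN y _ => ⟨fun _ => θ, fun _ => 0, fun x => hasDerivAt_const x θ,
    continuous_const, fun x p hp => ?_, fun z _ => ?_⟩⟩
  · have := mul_nonneg hK (abs_nonneg (p - θ))
    linarith [h x p hp]
  · simp only [sub_self, intervalIntegral.integral_zero]
    have := mul_nonneg hη.le hN
    linarith

theorem HasLowerCorrectors.mono (h : HasLowerCorrectors a H θ c K ρ) {c' ρ' : ℝ} (hc : c' ≤ c)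
    (hρ : ρ' ≤ ρ) : HasLowerCorrectors a H θ c' K ρ' :=
  HasUpperCorrectors.mono h (neg_le_neg hc) hρ

theorem HasLowerCorrectors.shift (h : HasLowerCorrectors a H θ c K ρ) (hK : 0 ≤ K) (s : ℝ) :
    HasLowerCorrectors a H (θ + s) (c - K * |s|) K (ρ - |s|) := by
  have := HasUpperCorrectors.shift h hK (-s)
  rw [abs_neg] at this
  rw [HasLowerCorrectors]
  convert this using 1 <;> ring

theorem hasLowerCorrectors_of_le (hK : 0 ≤ K) (h : ∀ x p, |p - θ| ≤ ρ → c ≤ H p x) :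
    HasLowerCorrectors a H θ c K ρ :=
  hasUpperCorrectors_of_le hK fun x p hp => neg_le_neg (h x (-p) (by
    rwa [show -p - θ = -(p - -θ) by ring, abs_neg]))

theorem nonneg_of_isLocalMin {W w : ℝ → ℝ} {z w' : ℝ} (hW : ∀ x, HasDerivAt W (w x) x)
    (hw : HasDerivAt w w' z) (hmin : IsLocalMin W z) : 0 ≤ w' := by
  by_contra! hlt
  have hd : deriv W = w := funext fun x => (hW x).deriv
  have hmax : IsLocalMax W z := isLocalMax_of_deriv_deriv_neg (by rwa [hd, hw.deriv])
    (by rw [hd, hmin.hasDerivAt_eq_zero (hW z)]) (hW z).continuousAt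
  have hconst : W =ᶠ[nhds z] fun _ => W z := by
    filter_upwards [hmin, hmax] with x h1 h2 using le_antisymm h2 h1
  have h2 : deriv (deriv W) z = 0 := by
    rw [hconst.deriv.deriv_eq]
    simp
  rw [hd, hw.deriv] at h2
  exact hlt.ne h2

theorem HasLowerCorrectors.le (ha0 : ∀ x, 0 ≤ a x) (ha1 : ∀ x, a x ≤ 1) {c₁ c₂ K₁ K₂ ρ₁ ρ₂ : ℝ}
    (h₁ : HasLowerCorrectors a H θ c₁ K₁ ρ₁) (h₂ : HasUpperCorrectors a H θ c₂ K₂ ρ₂)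
    (hK₁ : 0 ≤ K₁) (hρ₁ : 0 < ρ₁) (hρ₂ : 0 < ρ₂) : c₁ ≤ c₂ := by
  by_contra! hlt
  set η := min (ρ₁ / 6) ((c₁ - c₂) / (12 * (K₁ + 1))) with hηdef
  have hη : 0 < η := lt_min (by linarith) (div_pos (by linarith) (by linarith))
  have hη1 : 6 * η ≤ ρ₁ := by linarith [min_le_left (ρ₁ / 6) ((c₁ - c₂) / (12 * (K₁ + 1)))]
  have hη2 : 12 * η * (K₁ + 1) ≤ c₁ - c₂ := by
    have := min_le_right (ρ₁ / 6) ((c₁ - c₂) / (12 * (K₁ + 1)))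
    rw [← hηdef, le_div_iff₀ (by linarith)] at this
    linarith
  obtain ⟨N₁, hN₁⟩ := h₁ 1 1 η one_pos one_pos hη
  obtain ⟨N₂, hN₂⟩ := h₂ 1 1 η one_pos one_pos hη
  set N := max 1 (max N₁ N₂) with hN
  have hN1 : 1 ≤ N := le_max_left _ _
  have hN0 : 0 < N := by linarith
  obtain ⟨F, F', hF, -, hF2, hF3⟩ := hN₁ N ((le_max_left _ _).trans (le_max_right _ _)) 0
    (by simpa using hN0.le)
  obtain ⟨f, f', hf, -, hf2, hf3⟩ := hN₂ N ((le_max_right _ _).trans (le_max_right _ _)) 0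
    (by simpa using hN0.le)
  have hFc : Continuous F := continuous_iff_continuousAt.2 fun x => (hF x).continuousAt
  have hfc : Continuous f := continuous_iff_continuousAt.2 fun x => (hf x).continuousAt
  set W : ℝ → ℝ := fun z => (∫ x in (0 : ℝ)..z, (f x - θ)) + (∫ x in (0 : ℝ)..z, (F x - -θ)) +
    3 * η / N * z ^ 2 with hW
  set w : ℝ → ℝ := fun z => (f z - θ) + (F z - -θ) + 3 * η / N * (2 * z) with hw
  have hWd : ∀ z, HasDerivAt W (w z) z := by
    intro z
    refine (((hfc.sub continuous_const).integral_hasStrictDerivAt 0 z).hasDerivAt.add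
      ((hFc.sub continuous_const).integral_hasStrictDerivAt 0 z).hasDerivAt).add ?_
    simpa using (hasDerivAt_pow 2 z).const_mul (3 * η / N)
  have hwd : ∀ z, HasDerivAt w (f' z + F' z + 3 * η / N * 2) z := fun z =>
    (((hf z).sub_const _).add ((hF z).sub_const _)).add
      (((hasDerivAt_id z).const_mul 2).const_mul (3 * η / N) |>.congr_deriv (by ring))
  have hWc : Continuous W := continuous_iff_continuousAt.2 fun x => (hWd x).continuousAt
  have hW0 : W 0 = 0 := by simp [hW]
  have hend : ∀ z, |z| = N → 0 < W z := by
    intro z hz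
    have h1 := hF3 z (by rw [hz, one_mul])
    have h2 := hf3 z (by rw [hz, one_mul])
    rw [zero_add] at h1 h2
    have h3 : 3 * η / N * z ^ 2 = 3 * (η * N) := by
      rw [← sq_abs, hz]; field_simp
    have := mul_pos hη hN0
    simp only [hW]
    linarith
  obtain ⟨z, hz, hzmin⟩ := (isCompact_Icc (a := -N) (b := N)).exists_isMinOn
    ⟨0, by constructor <;> linarith⟩ hWc.continuousOn
  have hz0 : W z ≤ 0 := hW0 ▸ hzmin (show (0 : ℝ) ∈ Icc (-N) N by constructor <;> linarith)
  have hzlt : |z| < N := (abs_le.2 hz).lt_of_ne fun h => (hend z h).not_ge hz0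
  have hloc : IsLocalMin W z := hzmin.isLocalMin (Icc_mem_nhds (abs_lt.1 hzlt).1 (abs_lt.1 hzlt).2)
  have hw0 : w z = 0 := hloc.hasDerivAt_eq_zero (hWd z)
  have hw2 := nonneg_of_isLocalMin hWd (hwd z) hloc
  have hsum : |f z + F z| ≤ 6 * η := by
    have : f z + F z = -(6 * η * (z / N)) := by
      have : w z = f z + F z + 6 * η * (z / N) := by simp only [hw]; ring
      linarith
    rw [this, abs_neg, abs_mul, abs_div, abs_of_pos hN0, abs_of_pos (by linarith : 0 < 6 * η)]
    exact mul_le_of_le_one_right (by linarith) ((div_le_one hN0).2 hzlt.le)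
  have h1 := hf2 z (f z) (by simpa using hρ₂.le)
  have h2 := hF2 z (-f z) (by rw [← neg_add', abs_neg]; exact hsum.trans hη1)
  rw [sub_self, abs_zero, mul_zero] at h1
  beta_reduce at h2
  rw [neg_neg, ← neg_add', abs_neg] at h2
  have h3 := mul_le_mul_of_nonneg_left hsum hK₁
  have h4 : -(6 * η) ≤ a z * (f' z + F' z) := by
    have h5 : 3 * η / N * 2 ≤ 6 * η := by
      rw [div_mul_eq_mul_div, div_le_iff₀ hN0]
      nlinarith
    have h6 := mul_nonneg (ha0 z) hw2
    have h7 : a z * (3 * η / N * 2) ≤ 1 * (6 * η) :=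
      mul_le_mul (ha1 z) h5 (by positivity) zero_le_one
    linarith
  nlinarith

end deterministic

section setting

variable {Ω : Type} [MeasurableSpace Ω] {P : Measure Ω} {τ : ℝ → Ω → Ω}
  {a : ℝ → Ω → ℝ} {H : ℝ → ℝ → Ω → ℝ} {G_L G_U : ℝ → ℝ}

theorem ergodicFlow (hset : HJSetting P τ a H G_L G_U) : ErgodicFlow P τ :=
  ⟨hset.prob, hset.meas_tau, hset.mp_tau, hset.tau_zero, hset.tau_add, hset.ergodic⟩

theorem le_of_abs_le_abs {G : ℝ → ℝ} (heven : ∀ p, G (-p) = G p) (hmono : MonotoneOn G (Ici 0))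
    {p q : ℝ} (h : |p| ≤ |q|) : G p ≤ G q := by
  have habs : ∀ p, G |p| = G p := fun p => by
    rcases abs_choice p with h | h <;> rw [h]
    exact heven p
  rw [← habs p, ← habs q]
  exact hmono (abs_nonneg p) (abs_nonneg q) h

theorem GL_le (hset : HJSetting P τ a H G_L G_U) (p x : ℝ) (ω : Ω) : G_L p ≤ H p x ω := by
  rw [hset.H_stat]
  exact hset.H_lower p _

theorem le_GU (hset : HJSetting P τ a H G_L G_U) (p x : ℝ) (ω : Ω) : H p x ω ≤ G_U p := by
  rw [hset.H_stat]
  exact hset.H_upper p _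

theorem continuous_a (hset : HJSetting P τ a H G_L G_U) (ω : Ω) : Continuous fun x => a x ω := by
  obtain ⟨κ, hκ, h⟩ := hset.a_sqrt_lip
  have hl : LipschitzWith κ.toNNReal fun x => √(a x ω) := by
    refine LipschitzWith.of_dist_le_mul fun x y => ?_
    have h1 := h (x - y) (τ y ω)
    rw [hset.a_stat (x - y), ← hset.tau_add, sub_add_cancel, ← hset.a_stat, ← hset.a_stat] at h1
    rwa [Real.dist_eq, Real.dist_eq, Real.coe_toNNReal _ hκ.le]
  have : (fun x => a x ω) = fun x => √(a x ω) ^ 2 :=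
    funext fun x => (Real.sq_sqrt (hset.a_pos x ω).le).symm
  rw [this]
  exact hl.continuous.pow 2

theorem continuous_H (hset : HJSetting P τ a H G_L G_U) (ω : Ω) :
    Continuous fun q : ℝ × ℝ => H q.1 q.2 ω := by
  rw [continuous_iff_continuousAt]
  rintro ⟨p, x⟩
  obtain ⟨K, hK, hlip⟩ := hset.H_lip (|p| + 1) (by positivity)
  obtain ⟨m, -, -, hm, hmod⟩ := hset.H_mod (|p| + 1) (by positivity)
  rw [Metric.continuousAt_iff]
  intro ε hε
  obtain ⟨δ, hδ, hδm⟩ := (Metric.tendsto_nhdsWithin_nhds.1 hm) (ε / 2) (by positivity)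
  refine ⟨min (min 1 δ) (ε / (2 * K)), by positivity, ?_⟩
  rintro ⟨q, y⟩ hq
  rw [Prod.dist_eq, max_lt_iff, lt_min_iff, lt_min_iff, lt_min_iff, lt_min_iff] at hq
  obtain ⟨⟨⟨hq1, -⟩, hq2⟩, ⟨-, hy⟩, -⟩ := hq
  simp only [Real.dist_eq] at hq1 hq2 hy ⊢
  have hqb : |q| ≤ |p| + 1 := by
    have := abs_sub_abs_le_abs_sub q p
    linarith
  have h1 : |H q y ω - H q x ω| < ε / 2 := by
    rcases eq_or_ne y x with rfl | hne
    · simpa using hε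
    have h2 := hmod q (y - x) (τ x ω) hqb
    rw [hset.H_stat q (y - x), ← hset.tau_add, sub_add_cancel, ← hset.H_stat, ← hset.H_stat] at h2
    have h3 := hδm (x := |y - x|) (abs_pos.2 (sub_ne_zero.2 hne)) (by simpa using hy)
    rw [Real.dist_eq, sub_zero] at h3
    exact h2.trans_lt ((le_abs_self _).trans_lt h3)
  have h4 : |H q x ω - H p x ω| < ε / 2 := by
    rw [hset.H_stat q, hset.H_stat p]
    refine (hlip q p (τ x ω) hqb (by linarith)).trans_lt ?_
    rw [lt_div_iff₀ (by positivity)] at hq2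
    linarith
  have := abs_sub_le (H q y ω) (H q x ω) (H p x ω)
  linarith

theorem abs_trunc_sub_trunc_le (R p q : ℝ) : |trunc R p - trunc R q| ≤ |p - q| := by
  unfold trunc
  refine (abs_max_sub_max_le_max _ _ _ _).trans (max_le (by simp) ?_)
  exact (abs_min_sub_min_le_max _ _ _ _).trans (max_le (by simp) le_rfl)

theorem continuous_trunc (R : ℝ) : Continuous (trunc R) :=
  continuous_const.max (continuous_const.min continuous_id)

theorem measurable_H_orbit (hset : HJSetting P τ a H G_L G_U) {g : ℝ → ℝ} (hg : Continuous g) :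
    Measurable fun q : ℝ × Ω => H (g q.1) 0 q.2 :=
  hset.meas_H.comp ((hg.measurable.comp measurable_fst).prodMk
    (measurable_const.prodMk measurable_snd))

/-- The field of the cell problem with right-hand side `c`, for the Hamiltonian truncated at height
`Λ` and for gradients in `[-R, R]`. -/
theorem stationaryField (hset : HJSetting P τ a H G_L G_U) {R : ℝ} (hR : 0 < R) (Λ c : ℝ) :
    StationaryField τ fun p ω => (c - min (H (trunc R p) 0 ω) Λ) / a 0 ω := by
  refine ⟨(measurable_const.sub ((measurable_H_orbit hset (continuous_trunc R)).min
    measurable_const)).div (hset.meas_a.comp (measurable_const.prodMk measurable_snd)),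
    fun ω => ?_⟩
  have ha : ∀ x, a 0 (τ x ω) = a x ω := fun x => (hset.a_stat x ω).symm
  have hH : ∀ p x, H p 0 (τ x ω) = H p x ω := fun p x => (hset.H_stat p x ω).symm
  simp only [ha, hH]
  have hcont : Continuous fun q : ℝ × ℝ => (c - min (H (trunc R q.1) q.2 ω) Λ) / a q.2 ω := by
    refine Continuous.div ?_ ((continuous_a hset ω).comp continuous_snd)
      fun q => (hset.a_pos _ _).ne'
    exact continuous_const.sub (((continuous_H hset ω).comp
      (((continuous_trunc R).comp continuous_fst).prodMk continuous_snd)).min continuous_const)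
  have hinv : Continuous fun x => 1 / a x ω :=
    continuous_const.div (continuous_a hset ω) fun x => (hset.a_pos _ _).ne'
  refine ⟨hcont, fun X => ?_, fun X => ?_⟩
  · obtain ⟨A, hA⟩ := (isCompact_Icc (a := -X) (b := X)).exists_bound_of_continuousOn
      hinv.continuousOn
    obtain ⟨K, hK, hlip⟩ := hset.H_lip R hR
    refine ⟨K * A, fun x hx p q => ?_⟩
    have hax := hset.a_pos x ω
    have h1 : |min (H (trunc R q) x ω) Λ - min (H (trunc R p) x ω) Λ| ≤ K * |p - q| := by
      refine (abs_min_sub_min_le_max _ _ _ _).trans (max_le ?_ (by simp; positivity))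
      rw [hset.H_stat, hset.H_stat (trunc R p)]
      refine (hlip _ _ _ (abs_trunc_le hR.le _) (abs_trunc_le hR.le _)).trans ?_
      rw [abs_sub_comm p q]
      exact mul_le_mul_of_nonneg_left (abs_trunc_sub_trunc_le _ _ _) hK.le
    have h2 := hA x (abs_le.1 hx)
    rw [← sub_div, sub_sub_sub_cancel_left, abs_div, abs_of_pos hax, div_eq_mul_one_div]
    rw [Real.norm_eq_abs, abs_of_pos (by positivity)] at h2
    calc _ ≤ K * |p - q| * A := mul_le_mul h1 h2 (by positivity) (by positivity)
      _ = _ := by ring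
  · obtain ⟨A, hA⟩ := ((isCompact_Icc (a := -R) (b := R)).prod
      (isCompact_Icc (a := -X) (b := X))).exists_bound_of_continuousOn hcont.continuousOn
    refine ⟨A, fun x hx p => ?_⟩
    have := hA (trunc R p, x) ⟨abs_le.1 (abs_trunc_le hR.le p), abs_le.1 hx⟩
    rwa [Real.norm_eq_abs, trunc_of_abs_le (abs_trunc_le hR.le p)] at this

/-- For every slope and every pair of levels, almost surely either the higher level has upper
correctors or the lower level has lower correctors. -/
theorem exists_correctors (hset : HJSetting P τ a H G_L G_U) (C T : ℝ) {ρ : ℝ} (hρ : 0 < ρ) :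
    ∃ K > 0, ∀ θ c c', |θ| ≤ T → c < c' → c' ≤ C →
      (∀ᵐ ω ∂P, HasUpperCorrectors (fun x => a x ω) (fun p x => H p x ω) θ c' K ρ) ∨
      (∀ᵐ ω ∂P, HasLowerCorrectors (fun x => a x ω) (fun p x => H p x ω) θ c K ρ) := by
  obtain ⟨R, hRC, hRT⟩ := ((hset.GL_coercive.eventually_ge_atTop C).and
    (eventually_ge_atTop (max T 0))).exists
  have hR0 : 0 ≤ R := (le_max_right _ _).trans hRT
  set Λ := G_U (R + ρ) with hΛ
  obtain ⟨S, hSΛ, hSR⟩ := ((hset.GL_coercive.eventually_ge_atTop Λ).and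
    (eventually_ge_atTop (R + ρ))).exists
  have hS0 : 0 < S := by linarith
  obtain ⟨K, hK, hlip⟩ := hset.H_lip S hS0
  have hGL : ∀ {p q}, |p| ≤ |q| → G_L p ≤ G_L q := le_of_abs_le_abs hset.GL_even hset.GL_mono
  have hGU : ∀ {p q}, |p| ≤ |q| → G_U p ≤ G_U q := le_of_abs_le_abs hset.GU_even hset.GU_mono
  set h : ℝ → Ω → ℝ := fun p ω => min (H (trunc S p) 0 ω) Λ with hdef
  have hhH : ∀ p ω, h p ω ≤ H p 0 ω := by
    intro p ω
    rcases le_total |p| S with hp | hp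
    · simp only [hdef, trunc_of_abs_le hp]
      exact min_le_left _ _
    · refine (min_le_right _ _).trans (hSΛ.trans ((hGL ?_).trans (hset.H_lower p ω)))
      rwa [abs_of_pos hS0]
  have hhH' : ∀ p ω, |p| ≤ R + ρ → h p ω = H p 0 ω := by
    intro p ω hp
    simp only [hdef, trunc_of_abs_le (hp.trans hSR)]
    refine min_eq_left ((hset.H_upper p ω).trans (hGU ?_))
    rwa [abs_of_nonneg (by linarith : 0 ≤ R + ρ)]
  have hhC : ∀ p ω, R ≤ |p| → C ≤ h p ω := by
    intro p ω hp
    have hΛC : C ≤ Λ := by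
      refine hRC.trans ((hGL ?_).trans ((hset.H_lower (R + ρ) ω).trans (hset.H_upper _ ω)))
      rw [abs_of_nonneg hR0, abs_of_nonneg] <;> linarith
    refine le_min ?_ hΛC
    rcases le_total |p| S with hpS | hpS
    · rw [trunc_of_abs_le hpS]
      refine hRC.trans ((hGL ?_).trans (hset.H_lower p ω))
      rwa [abs_of_nonneg hR0]
    · refine hRC.trans ((hGL ?_).trans (hset.H_lower _ ω))
      rw [abs_of_nonneg hR0]
      have : |trunc S p| = S := by
        rcases le_abs.1 hpS with h | h
        · rw [trunc, min_eq_left h, max_eq_right (by linarith), abs_of_pos hS0]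
        · rw [trunc, min_eq_right (by linarith), max_eq_left (by linarith), abs_neg,
            abs_of_pos hS0]
      linarith
  have hhlip : ∀ p q ω, |h p ω - h q ω| ≤ K * |p - q| := by
    intro p q ω
    refine (abs_min_sub_min_le_max _ _ _ _).trans (max_le ?_ (by simp; positivity))
    exact (hlip _ _ _ (abs_trunc_le hS0.le _) (abs_trunc_le hS0.le _)).trans
      (mul_le_mul_of_nonneg_left (abs_trunc_sub_trunc_le _ _ _) hK.le)
  refine ⟨K, hK, fun θ c c' hθ hcc hc' => ?_⟩
  have hder : ∀ {f : ℝ → ℝ} {e : ℝ} {ω : Ω},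
      (∀ x, HasDerivAt f ((e - h (f x) (τ x ω)) / a 0 (τ x ω)) x) →
      Continuous (fun x => (e - h (f x) (τ x ω)) / a 0 (τ x ω)) := by
    intro f e ω hf
    have hfc : Continuous f := continuous_iff_continuousAt.2 fun x => (hf x).continuousAt
    exact ((stationaryField hset hS0 Λ e).tame ω).cont.comp (hfc.prodMk continuous_id)
  refine ((stationaryField hset hS0 Λ c).dichotomy (ergodicFlow hset)
    (stationaryField hset hS0 Λ c') hR0 (fun p ω => ?_) (fun p ω hp => ?_)
    (sub_pos.2 hcc) hK (fun p q ω hqp hd => ?_)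
    (hθ.trans ((le_max_left _ _).trans hRT))).imp (fun hU => ?_) (fun hL => ?_)
  · exact div_le_div_of_nonneg_right (by linarith) (hset.a_pos 0 ω).le
  · exact div_nonpos_of_nonpos_of_nonneg (by linarith [hhC p ω hp]) (hset.a_pos 0 ω).le
  · rw [← sub_div, le_div_iff₀ (hset.a_pos 0 ω)]
    have h1 := (abs_le.1 (hhlip p q ω)).2
    rw [abs_of_nonneg (sub_nonneg.2 hqp)] at h1
    have h2 := mul_le_of_le_one_right hd (hset.a_le_one 0 ω)
    simp only [hdef] at h1
    linarith
  · filter_upwards [hU] with ω hω M r η hM hr hη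
    obtain ⟨N₀, hN₀⟩ := hω M r η hM hr hη
    refine ⟨N₀, fun N hN y hy => ?_⟩
    obtain ⟨f, h1, h2, h3⟩ := hN₀ N hN y hy
    refine ⟨f, _, h1, hder h1, fun x p hp => ?_, h3⟩
    beta_reduce
    rw [hset.a_stat x ω, mul_div_cancel₀ _ (hset.a_pos 0 _).ne', hset.H_stat p x]
    have hpR : |p| ≤ R + ρ := by
      have := abs_sub_abs_le_abs_sub p (f x)
      linarith [h2 x]
    have h4 := (abs_le.1 (hhlip p (f x) (τ x ω))).2
    rw [hhH' p _ hpR] at h4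
    simp only [hdef] at h4
    linarith
  · filter_upwards [hL] with ω hω M r η hM hr hη
    obtain ⟨N₀, hN₀⟩ := hω M r η hM hr hη
    refine ⟨N₀, fun N hN y hy => ?_⟩
    obtain ⟨f, h1, h3⟩ := hN₀ N hN y hy
    refine ⟨fun x => -f x, _, fun x => (h1 x).neg, (hder h1).neg, fun x p hp => ?_, fun z hz => ?_⟩
    · beta_reduce
      rw [hset.a_stat x ω, mul_neg, mul_div_cancel₀ _ (hset.a_pos 0 _).ne', hset.H_stat (-p) x]
      have h4 := (abs_le.1 (hhlip (-p) (f x) (τ x ω))).1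
      have h5 := hhH (-p) (τ x ω)
      rw [show -p - f x = -(p - -f x) by ring, abs_neg] at h4
      simp only [hdef] at h4 h5
      linarith
    · have := h3 z hz
      rw [show (fun x => -f x - -θ) = fun x => -(f x - θ) by ext; ring,
        intervalIntegral.integral_neg]
      linarith

end setting

section effective

variable {Ω : Type} [MeasurableSpace Ω] {P : Measure Ω} {τ : ℝ → Ω → Ω}
  {a : ℝ → Ω → ℝ} {H : ℝ → ℝ → Ω → ℝ} {G_L G_U : ℝ → ℝ}

theorem GL_zero_le (hset : HJSetting P τ a H G_L G_U) (p x : ℝ) (ω : Ω) : G_L 0 ≤ H p x ω :=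
  (le_of_abs_le_abs hset.GL_even hset.GL_mono (by simp)).trans (GL_le hset p x ω)

theorem le_GU_of_abs_le (hset : HJSetting P τ a H G_L G_U) {R p : ℝ} (hp : |p| ≤ R) (x : ℝ)
    (ω : Ω) : H p x ω ≤ G_U R :=
  (le_GU hset p x ω).trans
    (le_of_abs_le_abs hset.GU_even hset.GU_mono (hp.trans (le_abs_self R)))

/-- The levels at which upper correctors of slope `θ` exist almost surely. -/
def upperLevels (P : Measure Ω) (a : ℝ → Ω → ℝ) (H : ℝ → ℝ → Ω → ℝ) (θ : ℝ) : Set ℝ :=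
  {c | ∀ᵐ ω ∂P, ∃ K ρ : ℝ, 0 < ρ ∧
    HasUpperCorrectors (fun x => a x ω) (fun p x => H p x ω) θ c K ρ}

/-- The effective Hamiltonian. -/
noncomputable def effectiveH (P : Measure Ω) (a : ℝ → Ω → ℝ) (H : ℝ → ℝ → Ω → ℝ) (θ : ℝ) : ℝ :=
  sInf (upperLevels P a H θ)

theorem GU_mem_upperLevels (hset : HJSetting P τ a H G_L G_U) {θ T : ℝ} (hθ : |θ| ≤ T) :
    G_U (T + 1) ∈ upperLevels P a H θ :=
  ae_of_all _ fun ω => ⟨0, 1, one_pos, hasUpperCorrectors_of_le le_rfl fun x p hp =>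
    le_GU_of_abs_le hset (by have := abs_sub_abs_le_abs_sub p θ; linarith) x ω⟩

theorem le_of_mem_upperLevels (hset : HJSetting P τ a H G_L G_U) {θ c e K ρ : ℝ} (hK : 0 ≤ K)
    (hρ : 0 < ρ) (he : e ∈ upperLevels P a H θ)
    (hc : ∀ᵐ ω ∂P, HasLowerCorrectors (fun x => a x ω) (fun p x => H p x ω) θ c K ρ) : c ≤ e := by
  have := hset.prob
  rw [upperLevels, mem_ofPred_eq] at he
  obtain ⟨ω, ⟨K', ρ', hρ', h1⟩, h2⟩ := (he.and hc).exists
  exact h2.le (fun x => (hset.a_pos x ω).le) (fun x => hset.a_le_one x ω) h1 hK hρ hρ'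

theorem bddBelow_upperLevels (hset : HJSetting P τ a H G_L G_U) (θ : ℝ) :
    BddBelow (upperLevels P a H θ) :=
  ⟨G_L 0, fun _ he => le_of_mem_upperLevels hset le_rfl one_pos he (ae_of_all _ fun ω =>
    hasLowerCorrectors_of_le le_rfl fun x p _ => GL_zero_le hset p x ω)⟩

theorem GL_le_effectiveH (hset : HJSetting P τ a H G_L G_U) {θ : ℝ} (hθ : 1 ≤ |θ|) :
    G_L (|θ| - 1) ≤ effectiveH P a H θ :=
  le_csInf ⟨_, GU_mem_upperLevels hset le_rfl⟩ fun _ he =>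
    le_of_mem_upperLevels hset le_rfl one_pos he (ae_of_all _ fun ω =>
      hasLowerCorrectors_of_le le_rfl fun x p hp =>
        (le_of_abs_le_abs hset.GL_even hset.GL_mono (by
          rw [abs_of_nonneg (sub_nonneg.2 hθ)]
          have := abs_sub_abs_le_abs_sub θ p
          rw [abs_sub_comm] at this
          linarith)).trans (GL_le hset p x ω))

theorem tendsto_effectiveH (hset : HJSetting P τ a H G_L G_U) :
    Tendsto (effectiveH P a H) (cocompact ℝ) atTop := by
  have h1 : Tendsto (fun θ : ℝ => |θ|) (cocompact ℝ) atTop := tendsto_norm_cocompact_atTop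
  refine tendsto_atTop_mono' _ ?_
    (hset.GL_coercive.comp (tendsto_atTop_add_const_right _ (-1) h1))
  filter_upwards [h1.eventually_ge_atTop 1] with θ hθ using GL_le_effectiveH hset hθ

theorem exists_correctors_effectiveH (hset : HJSetting P τ a H G_L G_U) (T : ℝ) {ρ : ℝ}
    (hρ : 0 < ρ) : ∃ K > 0, ∀ θ, |θ| ≤ T →
      (∀ c > effectiveH P a H θ, ∀ᵐ ω ∂P,
        HasUpperCorrectors (fun x => a x ω) (fun p x => H p x ω) θ c K ρ) ∧
      ∀ c < effectiveH P a H θ, ∀ᵐ ω ∂P,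
        HasLowerCorrectors (fun x => a x ω) (fun p x => H p x ω) θ c K ρ := by
  obtain ⟨K, hK, h⟩ := exists_correctors hset (G_U (T + 1) + 1) T hρ
  refine ⟨K, hK, fun θ hθ => ?_⟩
  have hbdd := bddBelow_upperLevels hset θ
  have hmem := GU_mem_upperLevels hset hθ
  have hle : effectiveH P a H θ ≤ G_U (T + 1) := csInf_le hbdd hmem
  refine ⟨fun c hc => ?_, fun c hc => ?_⟩
  · obtain ⟨c₁, h1, h2⟩ := exists_between (lt_min hc (by linarith : _ < G_U (T + 1) + 1))
    rcases h θ c₁ _ hθ h2 (min_le_right _ _) with hU | hL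
    · exact hU.mono fun ω hω => hω.mono (min_le_left _ _) le_rfl
    · obtain ⟨e, he, hec⟩ := exists_lt_of_csInf_lt ⟨_, hmem⟩ h1
      exact absurd (le_of_mem_upperLevels hset hK.le hρ he hL) hec.not_ge
  · obtain ⟨c', h1, h2⟩ := exists_between hc
    rcases h θ c c' hθ h1 (by linarith) with hU | hL
    · exact absurd (csInf_le hbdd (hU.mono fun ω hω => ⟨K, ρ, hρ, hω⟩)) h2.not_ge
    · exact hL

theorem lipschitzOnWith_effectiveH (hset : HJSetting P τ a H G_L G_U) {R : ℝ} (hR : 0 < R) :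
    ∃ K : NNReal, LipschitzOnWith K (effectiveH P a H) (Icc (-R) R) := by
  obtain ⟨K, hK, h⟩ := exists_correctors_effectiveH hset R (show 0 < 2 * R + 1 by linarith)
  refine ⟨⟨K, hK.le⟩, LipschitzOnWith.of_le_add_mul _ fun θ hθ θ' hθ' => ?_⟩
  change _ ≤ _ + K * |θ - θ'|
  refine le_of_forall_pos_le_add fun δ hδ => ?_
  refine csInf_le (bddBelow_upperLevels hset θ) ?_
  filter_upwards [(h θ' (abs_le.2 hθ')).1 (effectiveH P a H θ' + δ) (by linarith)] with ω hω
  have h1 := hω.shift hK.le (θ - θ')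
  refine ⟨K, _, ?_, (add_sub_cancel θ' θ ▸ h1).mono (by linarith) le_rfl⟩
  have : |θ - θ'| ≤ 2 * R := abs_le.2 ⟨by linarith [hθ.1, hθ'.2], by linarith [hθ.2, hθ'.1]⟩
  linarith

theorem continuous_effectiveH (hset : HJSetting P τ a H G_L G_U) :
    Continuous (effectiveH P a H) := by
  refine continuous_iff_continuousAt.2 fun θ => ?_
  obtain ⟨K, hK⟩ := lipschitzOnWith_effectiveH hset (show 0 < |θ| + 1 by positivity)
  refine hK.continuousOn.continuousAt (Icc_mem_nhds ?_ ?_)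
  · linarith [neg_abs_le θ]
  · linarith [le_abs_self θ]

/-- Almost surely, correctors exist for all slopes at all levels different from the effective
one. -/
theorem ae_forall_correctors (hset : HJSetting P τ a H G_L G_U) :
    ∀ᵐ ω ∂P, ∀ θ δ : ℝ, 0 < δ → ∃ K ρ : ℝ, 0 ≤ K ∧ 0 < ρ ∧
      HasUpperCorrectors (fun x => a x ω) (fun p x => H p x ω) θ (effectiveH P a H θ + δ) K ρ ∧
      HasLowerCorrectors (fun x => a x ω) (fun p x => H p x ω) θ (effectiveH P a H θ - δ) K ρ := by
  choose K hK h using fun n : ℕ => exists_correctors_effectiveH hset n one_pos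
  have hall : ∀ᵐ ω ∂P, ∀ (n k : ℕ) (θ : ℚ), |(θ : ℝ)| ≤ n →
      HasUpperCorrectors (fun x => a x ω) (fun p x => H p x ω) θ
        (effectiveH P a H θ + 1 / (k + 1)) (K n) 1 ∧
      HasLowerCorrectors (fun x => a x ω) (fun p x => H p x ω) θ
        (effectiveH P a H θ - 1 / (k + 1)) (K n) 1 := by
    refine ae_all_iff.2 fun n => ae_all_iff.2 fun k => ae_all_iff.2 fun θ => ?_
    by_cases hθ : |(θ : ℝ)| ≤ n
    · have hk : (0 : ℝ) < 1 / (k + 1) := Nat.one_div_pos_of_nat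
      filter_upwards [(h n θ hθ).1 _ (lt_add_of_pos_right _ hk),
        (h n θ hθ).2 _ (sub_lt_self _ hk)] with ω h1 h2 _ using ⟨h1, h2⟩
    · exact ae_of_all _ fun ω h => absurd h hθ
  filter_upwards [hall] with ω hω θ δ hδ
  obtain ⟨n, hn⟩ := exists_nat_ge (|θ| + 1)
  obtain ⟨k, hk⟩ := exists_nat_one_div_lt (show 0 < δ / 3 by positivity)
  obtain ⟨r, hr, hr'⟩ := Metric.continuousAt_iff.1
    ((continuous_effectiveH hset).continuousAt (x := θ)) (δ / 3) (by positivity)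
  have hKn := hK n
  set s := min (1 / 2) (min r (δ / (3 * K n))) with hs
  have hs0 : 0 < s := by positivity
  obtain ⟨q, hq1, hq2⟩ := exists_rat_btwn (sub_lt_self θ hs0)
  have hqs : |θ - q| < s := abs_lt.2 ⟨by linarith, by linarith⟩
  rw [hs, lt_min_iff, lt_min_iff] at hqs
  obtain ⟨hqs1, hqs2, hqs3⟩ := hqs
  rw [lt_div_iff₀ (by positivity)] at hqs3
  have hH := hr' (x := q) (by rwa [dist_comm, Real.dist_eq])
  rw [Real.dist_eq, abs_lt] at hH
  have hqn : |(q : ℝ)| ≤ n := by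
    have := abs_sub_abs_le_abs_sub (q : ℝ) θ
    rw [abs_sub_comm] at this
    linarith
  obtain ⟨h1, h2⟩ := hω n k q hqn
  have h3 := h1.shift hKn.le (θ - q)
  have h4 := h2.shift hKn.le (θ - q)
  rw [add_sub_cancel] at h3 h4
  exact ⟨K n, 1 / 2, hKn.le, by norm_num, h3.mono (by linarith) (by linarith),
    h4.mono (by linarith) (by linarith)⟩

end effective

theorem supersolution_neg {α : ℝ → ℝ} {h : ℝ → ℝ → ℝ} {v : ℝ → ℝ → ℝ}
    (hv : IsViscositySubsolution α h v) :
    IsViscositySupersolution α (fun p x => -h (-p) x) (fun t x => -v t x) := by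
  intro t₀ x₀ ht φ hφ hmin
  have h1 := hv t₀ x₀ ht (fun q => -φ q) hφ.neg (by
    have := hmin.neg
    simpa [neg_sub, sub_neg_eq_add, add_comm] using this)
  have h2 : (deriv fun x => -φ (t₀, x)) = fun x => -deriv (fun x => φ (t₀, x)) x :=
    funext fun x => deriv.fun_neg
  rw [h2, deriv.fun_neg, deriv.fun_neg] at h1
  linarith

theorem subsolution_neg {α : ℝ → ℝ} {h : ℝ → ℝ → ℝ} {v : ℝ → ℝ → ℝ}
    (hv : IsViscositySupersolution α h v) :
    IsViscositySubsolution α (fun p x => -h (-p) x) (fun t x => -v t x) := by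
  intro t₀ x₀ ht φ hφ hmax
  have h1 := hv t₀ x₀ ht (fun q => -φ q) hφ.neg (by
    have := hmax.neg
    simpa [neg_sub, sub_neg_eq_add, add_comm] using this)
  have h2 : (deriv fun x => -φ (t₀, x)) = fun x => -deriv (fun x => φ (t₀, x)) x :=
    funext fun x => deriv.fun_neg
  rw [h2, deriv.fun_neg, deriv.fun_neg] at h1
  linarith

theorem supersolution_of_neg {α : ℝ → ℝ} {h : ℝ → ℝ → ℝ} {v : ℝ → ℝ → ℝ}
    (hv : IsViscositySubsolution α (fun p x => -h (-p) x) (fun t x => -v t x)) :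
    IsViscositySupersolution α h v := by
  simpa using supersolution_neg hv

/-- The subsolution test for test functions with separated variables. -/
theorem deriv_le_of_isLocalMax {α : ℝ → ℝ} {h : ℝ → ℝ → ℝ} {v : ℝ → ℝ → ℝ}
    (hv : IsViscositySubsolution α h v) {A B : ℝ → ℝ} (hA : ContDiff ℝ 2 A) (hB : ContDiff ℝ 2 B)
    {t₀ x₀ : ℝ} (ht : 0 < t₀)
    (hmax : IsLocalMax (fun q : ℝ × ℝ => v q.1 q.2 - (A q.1 + B q.2)) (t₀, x₀)) :
    deriv A t₀ ≤ α x₀ * deriv (deriv B) x₀ + h (deriv B x₀) x₀ := by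
  have := hv t₀ x₀ ht (fun q => A q.1 + B q.2)
    ((hA.comp contDiff_fst).add (hB.comp contDiff_snd)).contDiffOn hmax
  have h2 : (deriv fun x => A t₀ + B x) = deriv B := funext fun x => deriv_const_add _
  simpa only [h2, deriv_add_const] using this

/-- A smooth approximation of the absolute value. -/
noncomputable def smoothAbs (s x : ℝ) : ℝ := √(s ^ 2 + x ^ 2)

section smoothAbs

variable {s : ℝ}

theorem smoothAbs_pos (hs : 0 < s) (x : ℝ) : 0 < smoothAbs s x := Real.sqrt_pos.2 (by positivity)

theorem sq_smoothAbs (s x : ℝ) : smoothAbs s x ^ 2 = s ^ 2 + x ^ 2 := Real.sq_sqrt (by positivity)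

theorem abs_le_smoothAbs (s x : ℝ) : |x| ≤ smoothAbs s x :=
  Real.abs_le_sqrt (by linarith [sq_nonneg s])

theorem smoothAbs_zero (hs : 0 < s) : smoothAbs s 0 = s := by
  rw [smoothAbs, zero_pow two_ne_zero, add_zero, Real.sqrt_sq hs.le]

theorem contDiff_smoothAbs (hs : 0 < s) : ContDiff ℝ 2 (smoothAbs s) :=
  (contDiff_const.add (contDiff_id.pow 2)).sqrt fun x => by
    have : 0 < s ^ 2 + id x ^ 2 := by positivity
    exact this.ne'

theorem hasDerivAt_smoothAbs (hs : 0 < s) (x : ℝ) :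
    HasDerivAt (smoothAbs s) (x / smoothAbs s x) x := by
  have h := ((hasDerivAt_pow 2 x).const_add (s ^ 2)).sqrt
    (by have : 0 < s ^ 2 + x ^ 2 := by positivity
        exact this.ne')
  refine h.congr_deriv ?_
  simp only [smoothAbs]
  field_simp
  norm_num

theorem deriv_smoothAbs (hs : 0 < s) : deriv (smoothAbs s) = fun x => x / smoothAbs s x :=
  funext fun x => (hasDerivAt_smoothAbs hs x).deriv

theorem abs_deriv_smoothAbs_le (hs : 0 < s) (x : ℝ) : |deriv (smoothAbs s) x| ≤ 1 := by
  rw [deriv_smoothAbs hs, abs_div, abs_of_pos (smoothAbs_pos hs x),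
    div_le_one (smoothAbs_pos hs x)]
  exact abs_le_smoothAbs s x

theorem deriv_deriv_smoothAbs_le (hs : 0 < s) (x : ℝ) :
    deriv (deriv (smoothAbs s)) x ≤ 1 / s := by
  have hp := smoothAbs_pos hs x
  have hsq := sq_smoothAbs s x
  rw [deriv_smoothAbs hs, ((hasDerivAt_id' x).fun_div (hasDerivAt_smoothAbs hs x) hp.ne').deriv]
  have hle : s ≤ smoothAbs s x := Real.le_sqrt_of_sq_le (by linarith [sq_nonneg x])
  have : (1 * smoothAbs s x - x * (x / smoothAbs s x)) / smoothAbs s x ^ 2 =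
      s ^ 2 / (smoothAbs s x) ^ 3 := by
    field_simp
    linarith
  rw [this, div_le_div_iff₀ (by positivity) hs]
  calc s ^ 2 * s = s ^ 3 := by ring
    _ ≤ smoothAbs s x ^ 3 := by gcongr
    _ = _ := by ring

end smoothAbs

theorem exists_isMaxOn_of_le_sub_norm {E : Type*} [NormedAddCommGroup E] [ProperSpace E]
    {F : E → ℝ} {s : Set E} (hs : IsClosed s) (hne : s.Nonempty) (hF : UpperSemicontinuousOn F s)
    {K c : ℝ} (hc : 0 < c) (h : ∀ q ∈ s, F q ≤ K - c * ‖q‖) : ∃ q ∈ s, IsMaxOn F s q := by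
  obtain ⟨q₀, hq₀⟩ := hne
  set R := max ‖q₀‖ ((K - F q₀) / c) with hR
  have hcomp : IsCompact (s ∩ Metric.closedBall 0 R) :=
    (isCompact_closedBall (0 : E) R).inter_left hs
  have hmem : q₀ ∈ s ∩ Metric.closedBall 0 R :=
    ⟨hq₀, by rw [mem_closedBall_zero_iff]; exact le_max_left _ _⟩
  obtain ⟨q, hq, hmax⟩ := UpperSemicontinuousOn.exists_isMaxOn ⟨q₀, hmem⟩ hcomp
    (hF.mono inter_subset_left)
  refine ⟨q, hq.1, fun p hp => ?_⟩
  by_cases hpR : ‖p‖ ≤ R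
  · exact hmax ⟨hp, by rwa [mem_closedBall_zero_iff]⟩
  · have h1 : (K - F q₀) / c < ‖p‖ := (le_max_right _ _).trans_lt (not_le.1 hpR)
    rw [div_lt_iff₀ hc] at h1
    have := hmax hmem
    simp only [mem_ofPred_eq] at this ⊢
    linarith [h p hp]

theorem abs_sub_le_of_convex {f : ℝ → ℝ} {s : Set ℝ} (hs : Convex ℝ s) {δ η : ℝ} (hδ : 0 < δ)
    (hη : 0 ≤ η) (h : ∀ x ∈ s, ∀ y ∈ s, |x - y| ≤ δ → |f x - f y| ≤ η) {x y : ℝ} (hx : x ∈ s)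
    (hy : y ∈ s) : |f x - f y| ≤ η + η / δ * |x - y| := by
  have key : ∀ (n : ℕ), ∀ x ∈ s, ∀ y ∈ s, |x - y| ≤ (n + 1) * δ → |f x - f y| ≤ (n + 1) * η := by
    intro n
    induction n with
    | zero => simpa using h
    | succ n ih =>
      intro x hx y hy hxy
      push_cast at hxy ⊢
      have hn : (0 : ℝ) < n + 2 := by positivity
      set w : ℝ := 1 / (n + 2) with hw
      have hw0 : 0 < w := by positivity
      have hwn : w * (n + 2) = 1 := by rw [hw]; field_simp
      have hz : x + w * (y - x) ∈ s := by
        have := hs hx hy (a := 1 - w) (b := w) (by nlinarith) hw0.le (by ring)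
        simp only [smul_eq_mul] at this
        rwa [show x + w * (y - x) = (1 - w) * x + w * y by ring]
      have h1 := h x hx _ hz (by
        rw [show x - (x + w * (y - x)) = w * (x - y) by ring, abs_mul, abs_of_pos hw0]
        nlinarith [abs_nonneg (x - y)])
      have h2 := ih _ hz y hy (by
        have hxz : x + w * (y - x) - y = w * (n + 1) * (x - y) := by
          linear_combination (y - x) * hwn
        rw [hxz, abs_mul, abs_of_pos (by positivity)]
        have := mul_le_mul_of_nonneg_left hxy (by positivity : (0 : ℝ) ≤ w * (n + 1))
        refine this.trans (le_of_eq ?_)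
        linear_combination (n + 1) * δ * hwn)
      have := abs_sub_le (f x) (f (x + w * (y - x))) (f y)
      linarith
  have hdiv : 0 ≤ |x - y| / δ := by positivity
  have h1 := key ⌊|x - y| / δ⌋₊ x hx y hy ((div_le_iff₀ hδ).1 (Nat.lt_floor_add_one _).le)
  have h2 := mul_le_mul_of_nonneg_right (Nat.floor_le hdiv) hη
  calc _ ≤ _ := h1
    _ = ⌊|x - y| / δ⌋₊ * η + η := by ring
    _ ≤ |x - y| / δ * η + η := by linarith
    _ = _ := by ring

theorem exists_abs_sub_le_of_uniformContinuous {g : ℝ → ℝ} (hg : UniformContinuous g) {η : ℝ}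
    (hη : 0 < η) : ∃ C, 0 ≤ C ∧ ∀ x y, |g x - g y| ≤ η + C * |x - y| := by
  obtain ⟨δ, hδ, h⟩ := Metric.uniformContinuous_iff.1 hg η hη
  refine ⟨η / (δ / 2), by positivity, fun x y => abs_sub_le_of_convex convex_univ (half_pos hδ) hη.le
    (fun x _ y _ hxy => ?_) (mem_univ x) (mem_univ y)⟩
  exact (h (a := x) (b := y) (by rw [Real.dist_eq]; linarith)).le

theorem exists_time_growth {v : ℝ → ℝ → ℝ}
    (hv : UniformContinuousOn (fun q : ℝ × ℝ => v q.1 q.2) {q : ℝ × ℝ | 0 ≤ q.1}) {η : ℝ}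
    (hη : 0 < η) : ∃ C, 0 ≤ C ∧ ∀ t, 0 ≤ t → ∀ x, |v t x - v 0 x| ≤ η + C * t := by
  obtain ⟨δ, hδ, h⟩ := Metric.uniformContinuousOn_iff.1 hv η hη
  refine ⟨η / (δ / 2), by positivity, fun t ht x => ?_⟩
  have := abs_sub_le_of_convex (f := fun t => v t x) (convex_Ici 0) (half_pos hδ) hη.le
    (fun t ht s hs hts => (h (t, x) ht (s, x) hs (by
      rw [Prod.dist_eq, dist_self, Real.dist_eq, max_lt_iff]
      exact ⟨by linarith, hδ⟩)).le) ht (y := 0) (mem_Ici.2 le_rfl)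
  rwa [sub_zero, abs_of_nonneg ht] at this

/-- A subsolution with at most linear growth in time cannot grow faster than a smooth barrier
built on its modulus of continuity at the initial time. -/
theorem le_add_of_isViscositySubsolution {α : ℝ → ℝ} {h : ℝ → ℝ → ℝ} {u : ℝ → ℝ → ℝ}
    {C η B h₀ : ℝ} (hα0 : ∀ x, 0 ≤ α x) (hα1 : ∀ x, α x ≤ 1)
    (hh : ∀ p x, |p| ≤ C + 1 → h p x ≤ B) (hC : 0 ≤ C) (hB : 0 ≤ B) (hη : 0 < η)
    (hu : IsViscositySubsolution α h u)
    (hc : ContinuousOn (fun q : ℝ × ℝ => u q.1 q.2) {q : ℝ × ℝ | 0 ≤ q.1})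
    (hgrow : ∃ A, 0 ≤ A ∧ ∀ t, 0 ≤ t → ∀ x, |u t x - u 0 x| ≤ A * (1 + t)) (h0 : 0 ≤ h₀)
    (hini : ∀ x y, u h₀ x - u h₀ y ≤ η + C * |x - y|) {t : ℝ} (ht : h₀ ≤ t) (x₀ : ℝ) :
    u t x₀ ≤ u h₀ x₀ + 2 * η + ((C + 1) ^ 2 / η + B + 1) * (t - h₀) := by
  obtain ⟨A, hA, hgrow⟩ := hgrow
  refine le_of_forall_pos_le_add fun e he => ?_
  set γ := e / ((t - h₀) ^ 2 + 1) with hγdef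
  have hγ : 0 < γ := by positivity
  have hγe : γ * (t - h₀) ^ 2 ≤ e := by
    rw [hγdef, div_mul_eq_mul_div, div_le_iff₀ (by positivity)]
    nlinarith
  set D := (C + 1) ^ 2 / η + B + 1 with hD
  have hD0 : 0 ≤ D := by positivity
  set s := η / (C + 1) with hs
  have hs0 : 0 < s := by positivity
  have hsC : (C + 1) * s = η := by rw [hs]; field_simp
  set f : ℝ → ℝ := fun r => (u h₀ x₀ + η - D * h₀) + D * r + γ * (r - h₀) ^ 2 with hf
  set g : ℝ → ℝ := fun x => (C + 1) * smoothAbs s (x - x₀) with hg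
  have hfd : ∀ r, HasDerivAt f (D + 2 * γ * (r - h₀)) r := by
    intro r
    have h1 := ((((hasDerivAt_id r).const_mul D).const_add (u h₀ x₀ + η - D * h₀)).add
      ((((hasDerivAt_id r).sub_const h₀).pow 2).const_mul γ))
    refine h1.congr_deriv ?_
    simp
    ring
  have hg1 : deriv g = fun x => (C + 1) * deriv (smoothAbs s) (x - x₀) := by
    funext x
    rw [hg, deriv_const_mul_field, deriv_comp_sub_const]
  have hg2 : ∀ x, deriv (deriv g) x = (C + 1) * deriv (deriv (smoothAbs s)) (x - x₀) := by
    intro x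
    rw [hg1, deriv_const_mul_field, deriv_comp_sub_const (f := deriv (smoothAbs s))]
  have hfc : ContDiff ℝ 2 f :=
    (contDiff_const.add (contDiff_const.mul contDiff_id)).add
      (contDiff_const.mul ((contDiff_id.sub contDiff_const).pow 2))
  have hgc : ContDiff ℝ 2 g :=
    contDiff_const.mul ((contDiff_smoothAbs hs0).comp (contDiff_id.sub contDiff_const))
  set S : Set (ℝ × ℝ) := {q | h₀ ≤ q.1} with hS
  have hSc : IsClosed S := isClosed_le continuous_const continuous_fst
  have hSsub : S ⊆ {q : ℝ × ℝ | 0 ≤ q.1} := fun q hq => h0.trans hq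
  have hFc : ContinuousOn (fun q : ℝ × ℝ => u q.1 q.2 - (f q.1 + g q.2)) S :=
    (hc.mono hSsub).sub ((hfc.continuous.comp continuous_fst).add
      (hgc.continuous.comp continuous_snd)).continuousOn
  obtain ⟨⟨t₁, x₁⟩, hq, hmax⟩ := exists_isMaxOn_of_le_sub_norm hSc ⟨(h₀, x₀), (le_refl h₀ : h₀ ≤ h₀)⟩
    hFc.upperSemicontinuousOn
    (K := 2 * (A * (1 + h₀)) + (A + 1) ^ 2 / (4 * γ) + h₀ + |x₀|) one_pos (by
      rintro ⟨r, x⟩ hr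
      replace hr : h₀ ≤ r := hr
      have h1 := (abs_le.1 (hgrow r (h0.trans hr) x)).2
      have h2 := (abs_le.1 (hgrow h₀ h0 x)).1
      have h3 := hini x x₀
      have h4 := mul_le_mul_of_nonneg_left (abs_le_smoothAbs s (x - x₀))
        (by linarith : 0 ≤ C + 1)
      have h5 : ‖(r, x)‖ ≤ r + |x| := by
        rw [Prod.norm_def]
        refine max_le ?_ ?_
        · rw [Real.norm_eq_abs, abs_of_nonneg (h0.trans hr)]
          linarith [abs_nonneg x]
        · rw [Real.norm_eq_abs]
          linarith
      have h6 : |x| ≤ |x - x₀| + |x₀| := by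
        have := abs_add_le (x - x₀) x₀
        rwa [sub_add_cancel] at this
      have h7 : (A + 1) * (r - h₀) - γ * (r - h₀) ^ 2 ≤ (A + 1) ^ 2 / (4 * γ) := by
        rw [le_div_iff₀ (by positivity)]
        nlinarith [sq_nonneg (2 * γ * (r - h₀) - (A + 1))]
      have h8 := mul_nonneg hD0 (sub_nonneg.2 hr)
      simp only [hf, hg]
      linarith)
  have hle : u t₁ x₁ - (f t₁ + g x₁) ≤ 0 := by
    rcases (show h₀ ≤ t₁ from hq).eq_or_lt with rfl | hlt
    · have h3 := hini x₁ x₀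
      have h4 := mul_le_mul_of_nonneg_left (abs_le_smoothAbs s (x₁ - x₀))
        (by linarith : 0 ≤ C + 1)
      simp only [hf, hg, sub_self]
      linarith [abs_nonneg (x₁ - x₀)]
    · exfalso
      have h1 := deriv_le_of_isLocalMax hu hfc hgc (h0.trans_lt hlt)
        (hmax.isLocalMax (mem_of_superset ((isOpen_lt continuous_const continuous_fst).mem_nhds hlt)
          fun q (hq : h₀ < q.1) => hq.le))
      rw [(hfd t₁).deriv, hg2, hg1] at h1
      have hC1 : 0 ≤ C + 1 := by linarith
      have h2 : h ((C + 1) * deriv (smoothAbs s) (x₁ - x₀)) x₁ ≤ B := by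
        refine hh _ _ ?_
        rw [abs_mul, abs_of_nonneg hC1]
        exact mul_le_of_le_one_right hC1 (abs_deriv_smoothAbs_le hs0 _)
      have h3 : α x₁ * ((C + 1) * deriv (deriv (smoothAbs s)) (x₁ - x₀)) ≤ (C + 1) ^ 2 / η := by
        have h4 : (C + 1) * deriv (deriv (smoothAbs s)) (x₁ - x₀) ≤ (C + 1) ^ 2 / η := by
          refine (mul_le_mul_of_nonneg_left (deriv_deriv_smoothAbs_le hs0 _) hC1).trans
            (le_of_eq ?_)
          rw [hs]
          field_simp
        refine (mul_le_mul_of_nonneg_left h4 (hα0 x₁)).trans ?_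
        exact mul_le_of_le_one_left (by positivity) (hα1 x₁)
      have h4 := mul_nonneg hγ.le (sub_nonneg.2 hlt.le)
      rw [hD] at h1
      linarith
  have h1 : u t x₀ - (f t + g x₀) ≤ u t₁ x₁ - (f t₁ + g x₁) := hmax (show (t, x₀) ∈ S from ht)
  simp only [hf, hg, sub_self, smoothAbs_zero hs0] at h1 hle
  linarith

theorem sub_le_of_isViscositySupersolution {α : ℝ → ℝ} {h : ℝ → ℝ → ℝ} {u : ℝ → ℝ → ℝ}
    {C η B h₀ : ℝ} (hα0 : ∀ x, 0 ≤ α x) (hα1 : ∀ x, α x ≤ 1)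
    (hh : ∀ p x, |p| ≤ C + 1 → -B ≤ h p x) (hC : 0 ≤ C) (hB : 0 ≤ B) (hη : 0 < η)
    (hu : IsViscositySupersolution α h u)
    (hc : ContinuousOn (fun q : ℝ × ℝ => u q.1 q.2) {q : ℝ × ℝ | 0 ≤ q.1})
    (hgrow : ∃ A, 0 ≤ A ∧ ∀ t, 0 ≤ t → ∀ x, |u t x - u 0 x| ≤ A * (1 + t)) (h0 : 0 ≤ h₀)
    (hini : ∀ x y, u h₀ x - u h₀ y ≤ η + C * |x - y|) {t : ℝ} (ht : h₀ ≤ t) (x₀ : ℝ) :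
    u h₀ x₀ - (2 * η + ((C + 1) ^ 2 / η + B + 1) * (t - h₀)) ≤ u t x₀ := by
  have := le_add_of_isViscositySubsolution hα0 hα1 (B := B) (fun p x hp => by
    have := hh (-p) x (by rwa [abs_neg])
    linarith) hC hB hη (subsolution_neg hu) hc.neg
    (by
      obtain ⟨A, hA, h1⟩ := hgrow
      refine ⟨A, hA, fun t ht x => ?_⟩
      rw [← neg_sub', abs_neg]
      exact h1 t ht x) h0
    (fun x y => by
      have := hini y x
      rw [abs_sub_comm] at this
      linarith) ht x₀
  linarith

/-- `U` is the upper half-relaxed limit on `D` of the family `u` along `l`. -/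
def IsUpperRelaxedLimit {ι X : Type*} [TopologicalSpace X] (l : Filter ι) (D : Set X)
    (u : ι → X → ℝ) (U : X → ℝ) : Prop :=
  ∀ q ∈ D, ∀ c, (U q < c → ∀ᶠ p in l ×ˢ nhdsWithin q D, u p.1 p.2 < c) ∧
    (c < U q → ∃ᶠ p in l ×ˢ nhdsWithin q D, c < u p.1 p.2)

section relaxed

variable {ι X : Type*} [TopologicalSpace X] {l : Filter ι} {D : Set X} {u : ι → X → ℝ} {U : X → ℝ}

theorem exists_isUpperRelaxedLimit [l.NeBot]
    (hb : ∀ q ∈ D, ∃ c, ∀ᶠ p in l ×ˢ nhdsWithin q D, |u p.1 p.2| ≤ c) :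
    ∃ U, IsUpperRelaxedLimit l D u U := by
  refine ⟨fun q => limsup (fun p : ι × X => u p.1 p.2) (l ×ˢ nhdsWithin q D), fun q hq c => ?_⟩
  obtain ⟨b, hb⟩ := hb q hq
  have : (nhdsWithin q D).NeBot := mem_closure_iff_nhdsWithin_neBot.1 (subset_closure hq)
  have h1 : (l ×ˢ nhdsWithin q D).IsBoundedUnder (· ≤ ·) fun p : ι × X => u p.1 p.2 :=
    isBoundedUnder_of_eventually_le (hb.mono fun p hp => (abs_le.1 hp).2)
  have h2 : (l ×ˢ nhdsWithin q D).IsBoundedUnder (· ≥ ·) fun p : ι × X => u p.1 p.2 :=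
    isBoundedUnder_of_eventually_ge (hb.mono fun p hp => (abs_le.1 hp).1)
  exact ⟨fun h => eventually_lt_of_limsup_lt h h1,
    fun h => frequently_lt_of_lt_limsup h2.isCoboundedUnder_le h⟩

namespace IsUpperRelaxedLimit

theorem upperSemicontinuousOn (hU : IsUpperRelaxedLimit l D u U) : UpperSemicontinuousOn U D := by
  intro q hq c hc
  obtain ⟨c', h1, h2⟩ := exists_between hc
  obtain ⟨s, hs, t, ht, hst⟩ := Filter.mem_prod_iff.1 ((hU q hq c').1 h1)
  filter_upwards [eventually_eventually_nhdsWithin.2 ht, self_mem_nhdsWithin] with q' hq' hqD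
  refine lt_of_le_of_lt (le_of_not_gt fun h => ?_) h2
  obtain ⟨p, hp1, hp2⟩ := (((hU q' hqD c').2 h).and_eventually
    (Filter.prod_mem_prod hs hq')).exists
  exact (hst hp2 : _ < _).not_gt hp1

theorem neg_le [l.NeBot] (hU : IsUpperRelaxedLimit l D u U) {V : X → ℝ}
    (hV : IsUpperRelaxedLimit l D (fun i q => -u i q) V) {q : X} (hq : q ∈ D) : -V q ≤ U q := by
  by_contra! h
  have : (nhdsWithin q D).NeBot := mem_closure_iff_nhdsWithin_neBot.1 (subset_closure hq)
  obtain ⟨c, h1, h2⟩ := exists_between h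
  obtain ⟨p, h3, h4⟩ := (((hU q hq c).1 h1).and ((hV q hq (-c)).1 (by linarith))).exists
  linarith

theorem le_of_eventually (hU : IsUpperRelaxedLimit l D u U) {G : X → ℝ} {q : X} (hq : q ∈ D)
    (hG : ContinuousWithinAt G D q) (h : ∀ᶠ i in l, ∀ x ∈ D, u i x ≤ G x) : U q ≤ G q := by
  by_contra! hlt
  obtain ⟨c, h1, h2⟩ := exists_between hlt
  obtain ⟨p, h3, h4, h5, h6⟩ := (((hU q hq c).2 h2).and_eventually
    (h.prod_mk ((hG.eventually_lt_const h1).and self_mem_nhdsWithin))).exists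
  linarith [h4 p.2 h6]

end IsUpperRelaxedLimit

end relaxed

theorem IsCompact.eventually_forall_of_prod_nhdsWithin {ι X : Type*} [TopologicalSpace X]
    {l : Filter ι} {D k : Set X} (hk : IsCompact k) (hkD : k ⊆ D) {R : ι → X → Prop}
    (h : ∀ q ∈ k, ∀ᶠ p in l ×ˢ nhdsWithin q D, R p.1 p.2) : ∀ᶠ i in l, ∀ q ∈ k, R i q := by
  refine hk.induction_on (p := fun s => ∀ᶠ i in l, ∀ q ∈ s, R i q) (by simp)
    (fun s t hst ht => ht.mono fun i hi q hq => hi q (hst hq))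
    (fun s t hs ht => (hs.and ht).mono fun i hi q hq => hq.elim (hi.1 q) (hi.2 q))
    fun q hq => ?_
  obtain ⟨s, hs, t, ht, hst⟩ := Filter.mem_prod_iff.1 (h q hq)
  exact ⟨t, nhdsWithin_mono q hkD ht,
    mem_of_superset hs fun i hi x hx => hst (mk_mem_prod hi hx)⟩

theorem contDiff_two_of_hasDerivAt {V w w' : ℝ → ℝ} (hV : ∀ x, HasDerivAt V (w x) x)
    (hw : ∀ x, HasDerivAt w (w' x) x) (hw' : Continuous w') : ContDiff ℝ 2 V := by
  have h1 : deriv V = w := funext fun x => (hV x).deriv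
  have h2 : deriv w = w' := funext fun x => (hw x).deriv
  rw [show (2 : WithTop ℕ∞) = 1 + 1 from (one_add_one_eq_two).symm, contDiff_succ_iff_deriv]
  refine ⟨fun x => (hV x).differentiableAt, fun h => by simp at h, ?_⟩
  rw [h1, contDiff_one_iff_deriv, h2]
  exact ⟨fun x => (hw x).differentiableAt, hw'⟩

theorem exists_partial_derivs {φ : ℝ × ℝ → ℝ} (hφ : ContDiffOn ℝ 2 φ {q : ℝ × ℝ | 0 < q.1}) :
    ∃ φt φx φxx : ℝ × ℝ → ℝ, ∀ q : ℝ × ℝ, 0 < q.1 →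
      HasDerivAt (fun t => φ (t, q.2)) (φt q) q.1 ∧ HasDerivAt (fun x => φ (q.1, x)) (φx q) q.2 ∧
      HasDerivAt (fun x => φx (q.1, x)) (φxx q) q.2 ∧
      ContinuousAt φt q ∧ ContinuousAt φx q ∧ ContinuousAt φxx q := by
  have hO : IsOpen {q : ℝ × ℝ | 0 < q.1} := isOpen_lt continuous_const continuous_fst
  have hfst : ∀ q : ℝ × ℝ, HasDerivAt (fun t : ℝ => (t, q.2)) (1, 0) q.1 := fun q =>
    (hasDerivAt_id q.1).prodMk (hasDerivAt_const q.1 q.2)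
  have hsnd : ∀ q : ℝ × ℝ, HasDerivAt (fun x : ℝ => (q.1, x)) (0, 1) q.2 := fun q =>
    (hasDerivAt_const q.2 q.1).prodMk (hasDerivAt_id q.2)
  refine ⟨fun q => fderiv ℝ φ q (1, 0), fun q => fderiv ℝ φ q (0, 1),
    fun q => fderiv ℝ (fun q => fderiv ℝ φ q (0, 1)) q (0, 1), fun q hq => ?_⟩
  have h0 : ContDiffAt ℝ 2 φ q := hφ.contDiffAt (hO.mem_nhds hq)
  have h1 : ContDiffAt ℝ 1 (fderiv ℝ φ) q :=
    h0.fderiv_right (by rw [one_add_one_eq_two])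
  have h2 : ContDiffAt ℝ 1 (fun q => fderiv ℝ φ q (0, 1)) q := h1.clm_apply contDiffAt_const
  have h3 : ContDiffAt ℝ 0 (fderiv ℝ fun q => fderiv ℝ φ q (0, 1)) q :=
    h2.fderiv_right (by norm_num)
  refine ⟨(h0.differentiableAt two_ne_zero).hasFDerivAt.comp_hasDerivAt q.1 (hfst q),
    (h0.differentiableAt two_ne_zero).hasFDerivAt.comp_hasDerivAt q.2 (hsnd q),
    (h2.differentiableAt one_ne_zero).hasFDerivAt.comp_hasDerivAt (f := fun x => (q.1, x)) q.2
      (hsnd q),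
    (h1.clm_apply contDiffAt_const).continuousAt, h2.continuousAt,
    (h3.clm_apply contDiffAt_const).continuousAt⟩

/-- The subsolution test rewritten in terms of given partial derivatives. -/
theorem le_of_isLocalMax_add {α : ℝ → ℝ} {h : ℝ → ℝ → ℝ} {v : ℝ → ℝ → ℝ}
    (hv : IsViscositySubsolution α h v) {φ φx : ℝ × ℝ → ℝ}
    (hφ : ContDiffOn ℝ 2 φ {q : ℝ × ℝ | 0 < q.1}) {V w w' : ℝ → ℝ}
    (hV : ∀ x, HasDerivAt V (w x) x) (hw : ∀ x, HasDerivAt w (w' x) x) (hw' : Continuous w')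
    {t x b c : ℝ} (ht : 0 < t) (h1 : HasDerivAt (fun t => φ (t, x)) b t)
    (h2 : ∀ x, HasDerivAt (fun x => φ (t, x)) (φx (t, x)) x)
    (h3 : HasDerivAt (fun x => φx (t, x)) c x)
    (hmax : IsLocalMax (fun q : ℝ × ℝ => v q.1 q.2 - (φ q + V q.2)) (t, x)) :
    b ≤ α x * (c + w' x) + h (φx (t, x) + w x) x := by
  have key := hv t x ht (fun q => φ q + V q.2) (hφ.add
    ((contDiff_two_of_hasDerivAt hV hw hw').comp contDiff_snd).contDiffOn) hmax
  have h4 : (deriv fun x => φ (t, x) + V x) = fun x => φx (t, x) + w x :=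
    funext fun x => ((h2 x).add (hV x)).deriv
  have h5 : deriv (fun x => φx (t, x) + w x) x = c + w' x := (h3.add (hw x)).deriv
  have h6 : deriv (fun t => φ (t, x) + V x) t = b := (h1.add_const _).deriv
  simp only [h4, h5, h6] at key
  exact key

/-- The perturbed test function argument at a strict maximum point. -/
theorem le_of_strict_max {ι : Type*} {l : Filter ι} {a : ℝ → ℝ} {H : ℝ → ℝ → ℝ} {c K ρ : ℝ}
    {ε : ι → ℝ} {u : ι → ℝ × ℝ → ℝ} {U : ℝ × ℝ → ℝ} (ha0 : ∀ x, 0 ≤ a x) (ha1 : ∀ x, a x ≤ 1)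
    (hε : Tendsto ε l (nhdsWithin 0 (Ioi 0)))
    (hsub : ∀ᶠ i in l, IsViscositySubsolution (fun x => ε i * a (x / ε i))
      (fun p x => H p (x / ε i)) fun t x => u i (t, x))
    (hc : ∀ᶠ i in l, ContinuousOn (u i) {q : ℝ × ℝ | 0 ≤ q.1})
    (hU : IsUpperRelaxedLimit l {q : ℝ × ℝ | 0 ≤ q.1} u U)
    {φ φt φx φxx : ℝ × ℝ → ℝ} (hφ : ContDiffOn ℝ 2 φ {q : ℝ × ℝ | 0 < q.1})
    (hd : ∀ q : ℝ × ℝ, 0 < q.1 →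
      HasDerivAt (fun t => φ (t, q.2)) (φt q) q.1 ∧ HasDerivAt (fun x => φ (q.1, x)) (φx q) q.2 ∧
      HasDerivAt (fun x => φx (q.1, x)) (φxx q) q.2 ∧
      ContinuousAt φt q ∧ ContinuousAt φx q ∧ ContinuousAt φxx q)
    {q₀ : ℝ × ℝ} (hq₀ : 0 < q₀.1) (hK : 0 ≤ K) (hρ : 0 < ρ)
    (hcor : HasUpperCorrectors a H (φx q₀) c K ρ)
    (hmax : ∀ᶠ q in nhds q₀, U q - φ q ≤ U q₀ - φ q₀ - ‖q - q₀‖ ^ 2) : φt q₀ ≤ c := by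
  by_contra! hlt
  set δ := (φt q₀ - c) / 4 with hδ
  have hδ0 : 0 < δ := by simp only [hδ]; linarith
  set s := min ρ (δ / (K + 1)) with hs
  have hs0 : 0 < s := lt_min hρ (by positivity)
  have hsδ : s * (K + 1) ≤ δ := (le_div_iff₀ (by linarith)).1 (min_le_right _ _)
  obtain ⟨h1, h2, h3, h4, h5, h6⟩ := hd q₀ hq₀
  have hpos : ∀ᶠ q : ℝ × ℝ in nhds q₀, 0 < q.1 :=
    (isOpen_lt continuous_const continuous_fst).mem_nhds hq₀
  obtain ⟨r, hr, hball⟩ := Metric.nhds_basis_closedBall.eventually_iff.1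
    ((hmax.and hpos).and (((Metric.continuousAt_iff'.1 h4 s hs0)).and
      ((Metric.continuousAt_iff'.1 h5 s hs0).and (Metric.continuousAt_iff'.1 h6 1 one_pos))))
  set m := U q₀ - φ q₀ with hm
  set L := |φxx q₀| + 1 with hL
  have hL0 : 0 < L := by positivity
  have hfin : ∀ q ∈ Metric.closedBall q₀ r, (U q - φ q ≤ m - ‖q - q₀‖ ^ 2) ∧ 0 < q.1 ∧
      |φt q - φt q₀| ≤ s ∧ |φx q - φx q₀| ≤ s ∧ φxx q ≤ L := by
    intro q hq
    obtain ⟨⟨g1, g2⟩, g3, g4, g5⟩ := hball hq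
    rw [Real.dist_eq] at g3 g4 g5
    refine ⟨g1, g2, g3.le, g4.le, ?_⟩
    linarith [(abs_lt.1 g5).2, le_abs_self (φxx q₀)]
  have hcont : ∀ q ∈ Metric.closedBall q₀ r, ContinuousAt φ q := fun q hq =>
    (hφ.continuousOn.continuousAt
      ((isOpen_lt continuous_const continuous_fst).mem_nhds (hfin q hq).2.1))
  have hballD : Metric.closedBall q₀ r ⊆ {q : ℝ × ℝ | 0 ≤ q.1} := fun q hq => (hfin q hq).2.1.le
  have hsphere : ∀ᶠ i in l, ∀ q ∈ Metric.sphere q₀ r, u i q - φ q < m - 3 * r ^ 2 / 4 := by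
    refine IsCompact.eventually_forall_of_prod_nhdsWithin (isCompact_sphere q₀ r)
      (Metric.sphere_subset_closedBall.trans hballD) (R := fun i q => u i q - φ q < _)
      fun q hq => ?_
    have hqb := Metric.sphere_subset_closedBall hq
    have g1 := (hfin q hqb).1
    rw [← dist_eq_norm, Metric.mem_sphere.1 hq] at g1
    have hr2 : 0 < r ^ 2 := by positivity
    have g2 := (hU q (hballD hqb) (U q + r ^ 2 / 8)).1 (by linarith)
    have g3 : ∀ᶠ x in nhdsWithin q {q : ℝ × ℝ | 0 ≤ q.1}, φ q - r ^ 2 / 8 < φ x :=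
      ((hcont q hqb).mono_left nhdsWithin_le_nhds).eventually_const_lt (by linarith)
    filter_upwards [g2, g3.prod_inr l] with p g4 g5
    linarith
  have hfreq : ∃ᶠ p in l ×ˢ nhdsWithin q₀ {q : ℝ × ℝ | 0 ≤ q.1},
      p.2 ∈ Metric.closedBall q₀ r ∧ m - r ^ 2 / 4 < u p.1 p.2 - φ p.2 := by
    have hr2 : 0 < r ^ 2 := by positivity
    have g3 : ∀ᶠ x in nhdsWithin q₀ {q : ℝ × ℝ | 0 ≤ q.1},
        φ x < φ q₀ + r ^ 2 / 8 ∧ x ∈ Metric.closedBall q₀ r :=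
      (((hcont q₀ (Metric.mem_closedBall_self hr.le)).mono_left
        nhdsWithin_le_nhds).eventually_lt_const (by linarith)).and
        (nhdsWithin_le_nhds (Metric.closedBall_mem_nhds q₀ hr))
    refine (((hU q₀ hq₀.le (U q₀ - r ^ 2 / 8)).2 (by linarith)).and_eventually
      (g3.prod_inr l)).mono fun p hp => ⟨hp.2.2, ?_⟩
    linarith [hp.1, hp.2.1]
  obtain ⟨N₀, hN₀⟩ := hcor (|q₀.2| + r) (2 * r) (r ^ 2 / 8) (by positivity) (by positivity)
    (by positivity)
  have hεsmall : ∀ᶠ i in l, 0 < ε i ∧ ε i * (L + 1) < δ ∧ N₀ ≤ 1 / ε i := by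
    have g1 : ∀ᶠ e : ℝ in nhdsWithin 0 (Ioi 0), 0 < e := self_mem_nhdsWithin
    have g2 : ∀ᶠ e : ℝ in nhdsWithin 0 (Ioi 0), e < δ / (L + 1) :=
      nhdsWithin_le_nhds (Iio_mem_nhds (by positivity))
    have g3 : ∀ᶠ e : ℝ in nhdsWithin 0 (Ioi 0), e < 1 / (|N₀| + 1) :=
      nhdsWithin_le_nhds (Iio_mem_nhds (by positivity))
    filter_upwards [hε.eventually g1, hε.eventually g2, hε.eventually g3] with i i1 i2 i3
    refine ⟨i1, (lt_div_iff₀ (by positivity)).1 i2, ?_⟩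
    rw [lt_div_iff₀ (by positivity)] at i3
    rw [le_div_iff₀ i1]
    nlinarith [le_abs_self N₀]
  obtain ⟨⟨i, q'⟩, ⟨hq', hlow⟩, ⟨⟨hε0, hεL, hεN⟩, hsub, hc⟩, hsph⟩ := (hfreq.and_eventually
    ((((hεsmall.and (hsub.and hc)).and hsphere)).prod_inl _)).exists
  dsimp only at hq' hlow hε0 hεL hεN hsub hc hsph
  set e := ε i with he
  have hy : |q'.2 - q₀.2| ≤ r := by
    have := (norm_snd_le (q' - q₀)).trans (mem_closedBall_iff_norm.1 hq')
    simpa using this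
  obtain ⟨f, f', hf, hf', hfe, hfi⟩ := hN₀ (1 / e) hεN (q'.2 / e) (by
    rw [abs_div, abs_of_pos hε0, mul_one_div]
    have := abs_add_le (q'.2 - q₀.2) q₀.2
    rw [sub_add_cancel] at this
    gcongr
    linarith)
  have hfc : Continuous f := continuous_iff_continuousAt.2 fun x => (hf x).continuousAt
  set V : ℝ → ℝ := fun x => e * ∫ z in (q'.2 / e)..(x / e), (f z - φx q₀) with hV
  have hdiv : ∀ x : ℝ, HasDerivAt (fun x => x / e) (1 / e) x := fun x =>
    (hasDerivAt_id' x).div_const e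
  have hVd : ∀ x, HasDerivAt V (f (x / e) - φx q₀) x := fun x => by
    have hsubc : Continuous fun z => f z - φx q₀ := hfc.sub continuous_const
    refine (((hsubc.integral_hasStrictDerivAt (q'.2 / e) (x / e)).hasDerivAt.comp x
      (hdiv x)).const_mul e).congr_deriv ?_
    field_simp
  have hwd : ∀ x, HasDerivAt (fun x => f (x / e) - φx q₀) (f' (x / e) / e) x := fun x =>
    (((hf (x / e)).comp x (hdiv x)).sub_const _).congr_deriv (by ring)
  have hw' : Continuous fun x => f' (x / e) / e :=
    (hf'.comp (continuous_id.div_const e)).div_const e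
  have hVlow : ∀ x, |x - q'.2| ≤ 2 * r → -(r ^ 2 / 8) ≤ V x := by
    intro x hx
    have := hfi ((x - q'.2) / e) (by
      rw [abs_div, abs_of_pos hε0, mul_one_div]
      gcongr)
    rw [← add_div, add_sub_cancel] at this
    have := mul_le_mul_of_nonneg_left this hε0.le
    refine le_trans (le_of_eq ?_) this
    field_simp
  have hV0 : V q'.2 = 0 := by simp [hV]
  have hVc : Continuous V := continuous_iff_continuousAt.2 fun x => (hVd x).continuousAt
  obtain ⟨q₁, hq₁, hq₁max⟩ := (isCompact_closedBall q₀ r).exists_isMaxOn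
    ⟨q₀, Metric.mem_closedBall_self hr.le⟩ (f := fun q : ℝ × ℝ => u i q - (φ q + V q.2))
    ((hc.mono hballD).sub (ContinuousOn.add (fun q hq => (hcont q hq).continuousWithinAt)
      (hVc.comp continuous_snd).continuousOn))
  have hgt : m - r ^ 2 / 4 < u i q₁ - (φ q₁ + V q₁.2) := by
    have : u i q' - (φ q' + V q'.2) ≤ u i q₁ - (φ q₁ + V q₁.2) := hq₁max hq'
    rw [hV0] at this
    linarith
  have hx₁ : |q₁.2 - q₀.2| ≤ r := by
    have := (norm_snd_le (q₁ - q₀)).trans (mem_closedBall_iff_norm.1 hq₁)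
    simpa using this
  have hq₁r : dist q₁ q₀ < r := by
    refine (Metric.mem_closedBall.1 hq₁).lt_of_ne fun heq => ?_
    have g1 := hsph q₁ heq
    have g2 := hVlow q₁.2 (by
      have := abs_sub_le q₁.2 q₀.2 q'.2
      rw [abs_sub_comm q₀.2] at this
      linarith)
    have : 0 < r ^ 2 := by positivity
    linarith
  have hloc : IsLocalMax (fun q : ℝ × ℝ => u i (q.1, q.2) - (φ q + V q.2)) (q₁.1, q₁.2) :=
    hq₁max.isLocalMax (Metric.closedBall_mem_nhds_of_mem hq₁r)
  obtain ⟨-, p1, p2, p3, p4⟩ := hfin q₁ hq₁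
  have key := le_of_isLocalMax_add hsub hφ hVd hwd hw' p1 (hd q₁ p1).1
    (fun x => (hd (q₁.1, x) p1).2.1) (hd q₁ p1).2.2.1 hloc
  have k1 : |φx q₁ + (f (q₁.2 / e) - φx q₀) - f (q₁.2 / e)| ≤ s := by
    rwa [show φx q₁ + (f (q₁.2 / e) - φx q₀) - f (q₁.2 / e) = φx q₁ - φx q₀ by ring]
  have k2 := hfe (q₁.2 / e) _ (k1.trans (min_le_left _ _))
  have k3 := mul_le_mul_of_nonneg_left k1 hK
  have k4 : e * a (q₁.2 / e) * (φxx q₁ + f' (q₁.2 / e) / e) =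
      e * (a (q₁.2 / e) * φxx q₁) + a (q₁.2 / e) * f' (q₁.2 / e) := by field_simp
  have k5 : a (q₁.2 / e) * φxx q₁ ≤ L :=
    (mul_le_mul_of_nonneg_left p4 (ha0 _)).trans (mul_le_of_le_one_left hL0.le (ha1 _))
  have k6 := mul_le_mul_of_nonneg_left k5 hε0.le
  rw [k4] at key
  have k7 := (abs_le.1 p2).1
  have k8 : 4 * δ = φt q₀ - c := by rw [hδ]; ring
  nlinarith

theorem isViscositySubsolution_of_relaxed {ι : Type*} {l : Filter ι} {a : ℝ → ℝ} {H : ℝ → ℝ → ℝ}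
    {Hbar : ℝ → ℝ} {ε : ι → ℝ} {u : ι → ℝ × ℝ → ℝ} {U : ℝ × ℝ → ℝ} (ha0 : ∀ x, 0 ≤ a x)
    (ha1 : ∀ x, a x ≤ 1) (hε : Tendsto ε l (nhdsWithin 0 (Ioi 0)))
    (hcor : ∀ θ δ, 0 < δ → ∃ K ρ, 0 ≤ K ∧ 0 < ρ ∧ HasUpperCorrectors a H θ (Hbar θ + δ) K ρ)
    (hsub : ∀ᶠ i in l, IsViscositySubsolution (fun x => ε i * a (x / ε i))
      (fun p x => H p (x / ε i)) fun t x => u i (t, x))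
    (hc : ∀ᶠ i in l, ContinuousOn (u i) {q : ℝ × ℝ | 0 ≤ q.1})
    (hU : IsUpperRelaxedLimit l {q : ℝ × ℝ | 0 ≤ q.1} u U) :
    IsViscositySubsolution (fun _ => 0) (fun p _ => Hbar p) fun t x => U (t, x) := by
  intro t₀ x₀ ht φ hφ hmax
  rw [zero_mul, zero_add]
  set φ' : ℝ × ℝ → ℝ := fun q => φ q + ((q.1 - t₀) ^ 2 + (q.2 - x₀) ^ 2) with hφ'
  have hφ'c : ContDiffOn ℝ 2 φ' {q : ℝ × ℝ | 0 < q.1} := hφ.add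
    (((contDiff_fst.sub contDiff_const).pow 2).add
      ((contDiff_snd.sub contDiff_const).pow 2)).contDiffOn
  obtain ⟨φt, φx, φxx, hd⟩ := exists_partial_derivs hφ'c
  obtain ⟨h1, h2, -⟩ := hd (t₀, x₀) ht
  have hsq : ∀ z : ℝ, HasDerivAt (fun x => (x - z) ^ 2) 0 z := fun z => by
    simpa using ((hasDerivAt_id z).sub_const z).fun_pow 2
  have e1 : deriv (fun t => φ (t, x₀)) t₀ = φt (t₀, x₀) := by
    have := h1.sub (hsq t₀)
    rw [sub_zero] at this
    refine (this.congr_of_eventuallyEq (Eventually.of_forall fun t => ?_)).deriv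
    simp [hφ']
  have e2 : deriv (fun x => φ (t₀, x)) x₀ = φx (t₀, x₀) := by
    have := h2.sub (hsq x₀)
    rw [sub_zero] at this
    refine (this.congr_of_eventuallyEq (Eventually.of_forall fun t => ?_)).deriv
    simp [hφ']
  rw [e1, e2]
  refine le_of_forall_pos_le_add fun δ hδ => ?_
  obtain ⟨K, ρ, hK, hρ, hcor⟩ := hcor (φx (t₀, x₀)) δ hδ
  refine le_of_strict_max ha0 ha1 hε hsub hc hU hφ'c hd ht hK hρ hcor ?_
  filter_upwards [hmax] with q hq
  have h3 : ‖q - (t₀, x₀)‖ ^ 2 ≤ (q.1 - t₀) ^ 2 + (q.2 - x₀) ^ 2 := by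
    rw [Prod.norm_def, ← sq_abs (q.1 - t₀), ← sq_abs (q.2 - x₀)]
    rcases max_choice ‖(q - (t₀, x₀)).1‖ ‖(q - (t₀, x₀)).2‖ with h | h <;> rw [h] <;>
      simp [Real.norm_eq_abs] <;> positivity
  simp only [hφ', sub_self] at hq ⊢
  linarith

theorem mul_le_sq_div_add {d : ℝ} (hd : 0 < d) (c z : ℝ) : c * z ≤ z ^ 2 / (4 * d) + d * c ^ 2 := by
  rw [← sub_nonneg, show z ^ 2 / (4 * d) + d * c ^ 2 - c * z = (z - 2 * d * c) ^ 2 / (4 * d) by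
    field_simp; ring]
  positivity

set_option maxHeartbeats 1000000 in
/-- Comparison for the effective equation. The second function plays the role of the opposite of a
supersolution. -/
theorem add_nonpos_of_subsolutions {Hbar : ℝ → ℝ} (hH : Continuous Hbar) {U W : ℝ × ℝ → ℝ}
    {g : ℝ → ℝ} (hg : UniformContinuous g)
    (hU : UpperSemicontinuousOn U {q : ℝ × ℝ | 0 ≤ q.1})
    (hW : UpperSemicontinuousOn W {q : ℝ × ℝ | 0 ≤ q.1})
    (hUs : IsViscositySubsolution (fun _ => 0) (fun p _ => Hbar p) fun t x => U (t, x))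
    (hWs : IsViscositySubsolution (fun _ => 0) (fun p _ => -Hbar (-p)) fun t x => W (t, x))
    (hUg : ∀ η > 0, ∃ B, 0 ≤ B ∧ ∀ t, 0 ≤ t → ∀ x, U (t, x) ≤ g x + η + B * t)
    (hWg : ∀ η > 0, ∃ B, 0 ≤ B ∧ ∀ t, 0 ≤ t → ∀ x, W (t, x) ≤ -g x + η + B * t)
    {t₀ : ℝ} (ht₀ : 0 ≤ t₀) (x₀ : ℝ) : U (t₀, x₀) + W (t₀, x₀) ≤ 0 := by
  by_contra! hpos
  obtain ⟨m, hm⟩ : ∃ z, z = U (t₀, x₀) + W (t₀, x₀) := ⟨_, rfl⟩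
  rw [← hm] at hpos
  obtain ⟨η, hη⟩ : ∃ z, z = m / 32 := ⟨_, rfl⟩
  have hη0 : 0 < η := by rw [hη]; positivity
  obtain ⟨C, hC, hgC⟩ := exists_abs_sub_le_of_uniformContinuous hg hη0
  obtain ⟨B₁, hB₁, hUB⟩ := hUg η hη0
  obtain ⟨B₂, hB₂, hWB⟩ := hWg η hη0
  obtain ⟨B, hB⟩ : ∃ z, z = B₁ + B₂ := ⟨_, rfl⟩
  have hB0 : 0 ≤ B := by rw [hB]; positivity
  have hUW : ∀ t, 0 ≤ t → ∀ s, 0 ≤ s → ∀ x y,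
      U (t, x) + W (s, y) ≤ 3 * η + C * |x - y| + B * (t + s) := by
    intro t ht s hs x y
    have h1 := hUB t ht x
    have h2 := hWB s hs y
    have h3 := (abs_le.1 (hgC x y)).2
    nlinarith [mul_nonneg hB₁ hs, mul_nonneg hB₂ ht]
  obtain ⟨μ, hμ⟩ : ∃ z, z = m / (4 * (t₀ + t₀ ^ 2 + 1)) := ⟨_, rfl⟩
  have hμ0 : 0 < μ := by rw [hμ]; positivity
  have hμm : μ * (t₀ + t₀ ^ 2) ≤ m / 4 := by
    rw [hμ, div_mul_eq_mul_div, div_le_div_iff₀ (by positivity) (by norm_num)]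
    nlinarith
  obtain ⟨σ, hσ⟩ : ∃ z, z = η / (C + B + 1) := ⟨_, rfl⟩
  have hσ0 : 0 < σ := by rw [hσ]; positivity
  have hσC : σ * (C + B + 1) = η := by rw [hσ]; field_simp
  obtain ⟨M, hM⟩ : ∃ z, z = 3 * η + B ^ 2 / μ + C ^ 2 + B ^ 2 := ⟨_, rfl⟩
  have hM0 : 0 < M := by rw [hM]; positivity
  obtain ⟨δ, hδ⟩ : ∃ z : ℝ, z = min 1 (σ ^ 2 / (4 * M)) := ⟨_, rfl⟩
  have hδ0 : 0 < δ := hδ ▸ lt_min one_pos (by positivity)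
  have hδ1 : δ ≤ 1 := hδ ▸ min_le_left _ _
  have hδM : 4 * δ * M ≤ σ ^ 2 := by
    have := (le_div_iff₀ (by positivity)).1 (min_le_right 1 (σ ^ 2 / (4 * M)))
    rw [← hδ] at this
    linarith
  obtain ⟨κ, hκ0, hκ⟩ := Metric.uniformContinuousOn_iff.1
    ((isCompact_Icc (a := -(σ / δ + 1)) (b := σ / δ + 1)).uniformContinuousOn_of_continuous
      hH.continuousOn) μ hμ0
  obtain ⟨lam, hlam⟩ : ∃ z : ℝ, z = min (min 1 (κ / 2)) (m / (4 * smoothAbs 1 x₀)) := ⟨_, rfl⟩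
  have hs0 := smoothAbs_pos one_pos x₀
  have hlam0 : 0 < lam := hlam ▸ lt_min (lt_min one_pos (by positivity)) (by positivity)
  have hlam1 : lam ≤ 1 := hlam ▸ (min_le_left _ _).trans (min_le_left _ _)
  have hlamκ : lam < κ :=
    hlam ▸ ((min_le_left _ _).trans (min_le_right _ _)).trans_lt (half_lt_self hκ0)
  have hlamm : lam * smoothAbs 1 x₀ ≤ m / 4 := by
    have := (le_div_iff₀ (by positivity)).1
      (min_le_right (min 1 (κ / 2)) (m / (4 * smoothAbs 1 x₀)))
    rw [← hlam] at this
    linarith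
  set D : Set (ℝ × ℝ) := {q | 0 ≤ q.1} with hD
  have hDc : IsClosed D := isClosed_le continuous_const continuous_fst
  obtain ⟨pen, hpen⟩ : ∃ pen : (ℝ × ℝ) × (ℝ × ℝ) → ℝ, ∀ z, pen z = -((z.1.1 - z.2.1) ^ 2 / (2 * δ)) -
    (z.1.2 - z.2.2) ^ 2 / (2 * δ) - μ * (z.1.1 + z.1.1 ^ 2) - lam * smoothAbs 1 z.1.2 :=
    ⟨_, fun _ => rfl⟩
  have hpenc : Continuous pen := by
    have := (contDiff_smoothAbs one_pos).continuous
    rw [funext hpen]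
    fun_prop
  have husc : UpperSemicontinuousOn (fun z : (ℝ × ℝ) × (ℝ × ℝ) => U z.1 + W z.2 + pen z)
      (D ×ˢ D) := by
    refine UpperSemicontinuousOn.add (UpperSemicontinuousOn.add ?_ ?_)
      hpenc.continuousOn.upperSemicontinuousOn
    · exact hU.comp continuous_fst.continuousOn fun z hz => hz.1
    · exact hW.comp continuous_snd.continuousOn fun z hz => hz.2
  have hpen_le : ∀ t, 0 ≤ t → ∀ s, 0 ≤ s → ∀ x y, U (t, x) + W (s, y) -
      ((t - s) ^ 2 / (2 * δ) + (x - y) ^ 2 / (2 * δ)) - μ * t ^ 2 ≤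
      M - (t - s) ^ 2 / (4 * δ) - (x - y) ^ 2 / (4 * δ) := by
    intro t ht s hs x y
    have h1 := hUW t ht s hs x y
    have h2 := mul_le_sq_div_add hδ0 C |x - y|
    have h3 := mul_le_sq_div_add hδ0 B |t - s|
    have h4 : B * (2 * t) ≤ B ^ 2 / μ + μ * t ^ 2 := by
      rw [← sub_nonneg, show B ^ 2 / μ + μ * t ^ 2 - B * (2 * t) = (B - μ * t) ^ 2 / μ by
        field_simp; ring]
      positivity
    have h5 : B * (t + s) ≤ B * (2 * t) + B * |t - s| := by
      rw [← mul_add]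
      exact mul_le_mul_of_nonneg_left (by linarith [neg_abs_le (t - s)]) hB0
    have h6 : δ * C ^ 2 ≤ C ^ 2 := mul_le_of_le_one_left (sq_nonneg _) hδ1
    have h7 : δ * B ^ 2 ≤ B ^ 2 := mul_le_of_le_one_left (sq_nonneg _) hδ1
    have h8 : ∀ z : ℝ, z ^ 2 / (2 * δ) = z ^ 2 / (4 * δ) + z ^ 2 / (4 * δ) := fun z => by
      field_simp; ring
    rw [sq_abs] at h2 h3
    rw [h8, h8]
    linarith
  obtain ⟨⟨⟨t, x⟩, ⟨s, y⟩⟩, ⟨ht, hs⟩, hmax⟩ := exists_isMaxOn_of_le_sub_norm (hDc.prod hDc)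
    ⟨((t₀, x₀), (t₀, x₀)), Set.mk_mem_prod (show (t₀, x₀) ∈ D from ht₀) (show (t₀, x₀) ∈ D from ht₀)⟩ husc (K := M + 2) (lt_min hμ0 hlam0) (by
      rintro ⟨⟨t, x⟩, ⟨s, y⟩⟩ ⟨ht, hs⟩
      replace ht : 0 ≤ t := ht
      replace hs : 0 ≤ s := hs
      have h1 := hpen_le t ht s hs x y
      have h2 : ∀ z : ℝ, |z| - 1 ≤ z ^ 2 / (4 * δ) := by
        intro z
        rw [le_div_iff₀ (by positivity), ← sq_abs]
        rcases le_total |z| 1 with h | h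
        · exact (mul_nonpos_of_nonpos_of_nonneg (by linarith) (by positivity)).trans (sq_nonneg _)
        · nlinarith [sq_nonneg (|z| - 2), mul_nonneg (sub_nonneg.2 h) (sub_nonneg.2 hδ1)]
      have h3 := h2 (t - s)
      have h4 := h2 (x - y)
      have h5 := mul_le_mul_of_nonneg_left (abs_le_smoothAbs 1 x) hlam0.le
      obtain ⟨c, hc⟩ : ∃ z : ℝ, z = min μ lam := ⟨_, rfl⟩
      have hc0 : 0 ≤ c := hc ▸ (lt_min hμ0 hlam0).le
      have hcl : c ≤ lam := hc ▸ min_le_right _ _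
      have hcμ : c ≤ μ := hc ▸ min_le_left _ _
      rw [← hc]
      have hc1 : c ≤ 1 := hcl.trans hlam1
      have k1 : c * t ≤ μ * t := mul_le_mul_of_nonneg_right hcμ ht
      have k2 : c * |x| ≤ lam * |x| := mul_le_mul_of_nonneg_right hcl (abs_nonneg x)
      have k3 : c * |t - s| ≤ |t - s| := mul_le_of_le_one_left (abs_nonneg _) hc1
      have k4 : c * |x - y| ≤ |x - y| := mul_le_of_le_one_left (abs_nonneg _) hc1
      have k5 : ‖((t, x), (s, y))‖ ≤ t + |x| + |t - s| + |x - y| := by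
        have g1 := abs_nonneg x
        have g2 := abs_nonneg (t - s)
        have g3 := abs_nonneg (x - y)
        have g4 := abs_sub_abs_le_abs_sub y x
        rw [abs_sub_comm y] at g4
        simp only [Prod.norm_def, Real.norm_eq_abs, abs_of_nonneg ht, abs_of_nonneg hs]
        refine max_le (max_le ?_ ?_) (max_le ?_ ?_) <;> linarith [neg_abs_le (t - s)]
      have k6 := mul_le_mul_of_nonneg_left k5 hc0
      simp only [hpen]
      linarith)
  replace ht : 0 ≤ t := ht
  replace hs : 0 ≤ s := hs
  have hbig : m / 2 ≤ U (t, x) + W (s, y) + pen ((t, x), (s, y)) := by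
    have h1 : U (t₀, x₀) + W (t₀, x₀) + pen ((t₀, x₀), (t₀, x₀)) ≤
      U (t, x) + W (s, y) + pen ((t, x), (s, y)) := isMaxOn_iff.1 hmax ((t₀, x₀), (t₀, x₀)) ⟨ht₀, ht₀⟩
    refine le_trans ?_ h1
    simp only [hpen, sub_self]
    norm_num
    linarith
  have hμt : 0 ≤ μ * (t + t ^ 2) := by positivity
  have hlamx : 0 ≤ lam * smoothAbs 1 x := mul_nonneg hlam0.le (smoothAbs_pos one_pos x).le
  have hq1 : 0 ≤ (t - s) ^ 2 / (4 * δ) := by positivity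
  have hq2 : 0 ≤ (x - y) ^ 2 / (4 * δ) := by positivity
  have hclose : |t - s| ≤ σ ∧ |x - y| ≤ σ := by
    have h1 := hpen_le t ht s hs x y
    simp only [hpen] at hbig
    have h3 : 0 ≤ μ * t := by positivity
    constructor
    · refine abs_le_of_sq_le_sq (le_trans ?_ hδM) hσ0.le
      have : (t - s) ^ 2 / (4 * δ) ≤ M := by linarith
      rw [div_le_iff₀ (by positivity)] at this
      linarith
    · refine abs_le_of_sq_le_sq (le_trans ?_ hδM) hσ0.le
      have : (x - y) ^ 2 / (4 * δ) ≤ M := by linarith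
      rw [div_le_iff₀ (by positivity)] at this
      linarith
  have hpen0 : pen ((t, x), (s, y)) ≤ 0 := by
    have h1 : 0 ≤ (t - s) ^ 2 / (2 * δ) := by positivity
    have h2 : 0 ≤ (x - y) ^ 2 / (2 * δ) := by positivity
    simp only [hpen]
    linarith
  have hnot : ¬ t + s ≤ σ := fun h => by
    have h1 := hUW t ht s hs x y
    have h2 := mul_le_mul_of_nonneg_left h hB0
    have h3 := mul_le_mul_of_nonneg_left hclose.2 hC
    linarith
  have ht0 : 0 < t := ht.lt_of_ne fun h => hnot (by
    have := (abs_le.1 hclose.1).1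
    linarith)
  have hs0 : 0 < s := hs.lt_of_ne fun h => hnot (by
    have := (abs_le.1 hclose.1).2
    linarith)
  have hquad : ∀ b z : ℝ, HasDerivAt (fun z => (z - b) ^ 2 / (2 * δ)) ((z - b) / δ) z := by
    intro b z
    refine ((((hasDerivAt_id' z).sub_const b).fun_pow 2).div_const (2 * δ)).congr_deriv ?_
    norm_num
    field_simp
  have hquadc : ∀ b : ℝ, ContDiff ℝ 2 fun z : ℝ => (z - b) ^ 2 / (2 * δ) := fun b => by
    fun_prop
  have hnear : ∀ b z : ℝ, 0 < z → ∀ᶠ q : ℝ × ℝ in nhds (z, b), q ∈ D := fun b z hz =>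
    mem_of_superset ((isOpen_lt continuous_const continuous_fst).mem_nhds hz)
      fun q (hq : 0 < q.1) => hq.le
  have hA : ∀ z, HasDerivAt (fun z => (z - s) ^ 2 / (2 * δ) + μ * (z + z ^ 2))
      ((z - s) / δ + μ * (1 + 2 * z)) z := fun z =>
    (hquad s z).add (((hasDerivAt_id' z).add (hasDerivAt_pow 2 z)).const_mul μ |>.congr_deriv
      (by norm_num))
  have hBd : ∀ z, HasDerivAt (fun z => (z - y) ^ 2 / (2 * δ) + lam * smoothAbs 1 z)
      ((z - y) / δ + lam * deriv (smoothAbs 1) z) z := fun z =>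
    (hquad y z).add (((contDiff_smoothAbs one_pos).differentiable two_ne_zero
      z).hasDerivAt.const_mul lam)
  have e1 := deriv_le_of_isLocalMax hUs (A := fun z => (z - s) ^ 2 / (2 * δ) + μ * (z + z ^ 2))
    (B := fun z => (z - y) ^ 2 / (2 * δ) + lam * smoothAbs 1 z) ((hquadc s).add (by fun_prop))
    ((hquadc y).add (contDiff_const.mul (contDiff_smoothAbs one_pos))) ht0 (x₀ := x) (by
      filter_upwards [hnear x t ht0] with q hq
      have h1 : U q + W (s, y) + pen (q, (s, y)) ≤ U (t, x) + W (s, y) + pen ((t, x), (s, y)) :=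
        isMaxOn_iff.1 hmax (q, (s, y)) ⟨hq, hs⟩
      simp only [hpen] at h1
      linarith)
  have e2 := deriv_le_of_isLocalMax hWs (A := fun z => (z - t) ^ 2 / (2 * δ))
    (B := fun z => (z - x) ^ 2 / (2 * δ)) (hquadc t) (hquadc x) hs0 (x₀ := y) (by
      filter_upwards [hnear y s hs0] with q hq
      have h1 : U (t, x) + W q + pen ((t, x), q) ≤ U (t, x) + W (s, y) + pen ((t, x), (s, y)) :=
        isMaxOn_iff.1 hmax ((t, x), q) ⟨ht, hq⟩
      simp only [hpen] at h1
      simp only [sub_sq_comm _ t, sub_sq_comm _ x]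
      linarith)
  rw [(hA t).deriv, (hBd x).deriv, zero_mul, zero_add] at e1
  rw [(hquad t s).deriv, (hquad x y).deriv, zero_mul, zero_add, ← neg_div, neg_sub] at e2
  have hp : |(x - y) / δ| ≤ σ / δ := by
    rw [abs_div, abs_of_pos hδ0]
    exact div_le_div_of_nonneg_right hclose.2 hδ0.le
  have hl : |lam * deriv (smoothAbs 1) x| ≤ lam := by
    rw [abs_mul, abs_of_pos hlam0]
    exact mul_le_of_le_one_right hlam0.le (abs_deriv_smoothAbs_le one_pos x)
  have e3 := hκ ((x - y) / δ + lam * deriv (smoothAbs 1) x) (by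
      have h1 := abs_le.1 hp
      have h2 := abs_le.1 hl
      constructor <;> linarith) ((x - y) / δ) (by
      have h1 := abs_le.1 hp
      constructor <;> linarith) (by
      rw [Real.dist_eq, add_sub_cancel_left]
      linarith)
  rw [Real.dist_eq] at e3
  have e4 := (abs_lt.1 e3).2
  have e5 : (s - t) / δ = -((t - s) / δ) := by rw [← neg_div, neg_sub]
  have e6 : 0 ≤ μ * (2 * t) := by positivity
  rw [e5] at e2
  linarith

section scaling

variable {a : ℝ → ℝ} {H : ℝ → ℝ → ℝ} {v : ℝ → ℝ → ℝ} {ε : ℝ}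

theorem isViscositySubsolution_scale (hε : 0 < ε) (hv : IsViscositySubsolution a H v) :
    IsViscositySubsolution (fun x => ε * a (x / ε)) (fun p x => H p (x / ε))
      fun t x => ε * v (t / ε) (x / ε) := by
  intro t₀ x₀ ht φ hφ hmax
  have hmap : Continuous fun q : ℝ × ℝ => (ε * q.1, ε * q.2) := by fun_prop
  have h := hv (t₀ / ε) (x₀ / ε) (div_pos ht hε) (fun q => ε⁻¹ * φ (ε * q.1, ε * q.2))
    (contDiffOn_const.mul (hφ.comp (t := {q : ℝ × ℝ | 0 < q.1})
      (f := fun q : ℝ × ℝ => (ε * q.1, ε * q.2)) (by fun_prop)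
      fun q hq => mul_pos hε hq)) (by
    have h1 := hmap.tendsto (t₀ / ε, x₀ / ε)
    simp only [mul_div_cancel₀ _ hε.ne'] at h1
    filter_upwards [h1.eventually hmax] with q hq
    simp only [mul_div_cancel₀ _ hε.ne', mul_div_cancel_left₀ _ hε.ne'] at hq ⊢
    have h2 := mul_le_mul_of_nonneg_left hq (inv_nonneg.2 hε.le)
    rwa [mul_sub, mul_sub, inv_mul_cancel_left₀ hε.ne', inv_mul_cancel_left₀ hε.ne'] at h2)
  have hd : ∀ f : ℝ → ℝ, (deriv fun x => ε⁻¹ * f (ε * x)) = fun x => deriv f (ε * x) := by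
    intro f
    funext x
    rw [deriv_const_mul_field, deriv_comp_mul_left, smul_eq_mul, inv_mul_cancel_left₀ hε.ne']
  simp only [mul_div_cancel₀ _ hε.ne'] at h
  rw [hd fun t => φ (t, x₀), hd fun x => φ (t₀, x), deriv_comp_mul_left, smul_eq_mul] at h
  simp only [mul_div_cancel₀ _ hε.ne'] at h
  linarith

theorem isViscositySolution_scale (hε : 0 < ε) (hv : IsViscositySolution a H v) :
    IsViscositySolution (fun x => ε * a (x / ε)) (fun p x => H p (x / ε))
      fun t x => ε * v (t / ε) (x / ε) := by
  refine ⟨isViscositySubsolution_scale hε hv.1, supersolution_of_neg ?_⟩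
  simpa only [mul_neg] using isViscositySubsolution_scale hε (subsolution_neg hv.2)

end scaling

theorem isViscositySubsolution_translate {Hbar : ℝ → ℝ} {v : ℝ → ℝ → ℝ}
    (hv : IsViscositySubsolution (fun _ => 0) (fun p _ => Hbar p) v) (s e : ℝ) :
    IsViscositySubsolution (fun _ => 0) (fun p _ => Hbar p) fun t x => v t (x + s) - e := by
  intro t₀ x₀ ht φ hφ hmax
  have hmap : Continuous fun q : ℝ × ℝ => (q.1, q.2 - s) := by fun_prop
  have h := hv t₀ (x₀ + s) ht (fun q => φ (q.1, q.2 - s))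
    (hφ.comp (t := {q : ℝ × ℝ | 0 < q.1}) (f := fun q : ℝ × ℝ => (q.1, q.2 - s)) (by fun_prop)
      fun q hq => hq) (by
    have h1 := hmap.tendsto (t₀, x₀ + s)
    simp only [add_sub_cancel_right] at h1
    filter_upwards [h1.eventually hmax] with q hq
    simp only [sub_add_cancel, add_sub_cancel_right] at hq ⊢
    linarith)
  have hd : (deriv fun x => φ (t₀, x - s)) = fun x => deriv (fun x => φ (t₀, x)) (x - s) := by
    funext x
    rw [deriv_comp_sub_const (f := fun x => φ (t₀, x))]
  simpa [hd] using h

theorem abs_sub_le_of_isViscositySolution {α : ℝ → ℝ} {h : ℝ → ℝ → ℝ} {u : ℝ → ℝ → ℝ}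
    {C η B h₀ : ℝ} (hα0 : ∀ x, 0 ≤ α x) (hα1 : ∀ x, α x ≤ 1)
    (hh : ∀ p x, |p| ≤ C + 1 → |h p x| ≤ B) (hC : 0 ≤ C) (hB : 0 ≤ B) (hη : 0 < η)
    (hu : IsViscositySolution α h u)
    (hc : ContinuousOn (fun q : ℝ × ℝ => u q.1 q.2) {q : ℝ × ℝ | 0 ≤ q.1})
    (hgrow : ∃ A, 0 ≤ A ∧ ∀ t, 0 ≤ t → ∀ x, |u t x - u 0 x| ≤ A * (1 + t)) (h0 : 0 ≤ h₀)
    (hini : ∀ x y, |u h₀ x - u h₀ y| ≤ η + C * |x - y|) {t : ℝ} (ht : h₀ ≤ t) (x₀ : ℝ) :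
    |u t x₀ - u h₀ x₀| ≤ 2 * η + ((C + 1) ^ 2 / η + B + 1) * (t - h₀) := by
  have h1 := le_add_of_isViscositySubsolution hα0 hα1 (fun p x hp => (abs_le.1 (hh p x hp)).2)
    hC hB hη hu.1 hc hgrow h0 (fun x y => (abs_le.1 (hini x y)).2) ht x₀
  have h2 := sub_le_of_isViscositySupersolution hα0 hα1
    (fun p x hp => (abs_le.1 (hh p x hp)).1) hC hB hη hu.2 hc hgrow h0
    (fun x y => (abs_le.1 (hini x y)).2) ht x₀
  exact abs_le.2 ⟨by linarith, by linarith⟩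

/-- `v` is a uniformly continuous solution on `[0, ∞) × ℝ` with initial datum `g`. -/
def IsUCSolution (α : ℝ → ℝ) (h : ℝ → ℝ → ℝ) (g : ℝ → ℝ) (v : ℝ → ℝ → ℝ) : Prop :=
  IsViscositySolution α h v ∧
    UniformContinuousOn (fun q : ℝ × ℝ => v q.1 q.2) {q : ℝ × ℝ | 0 ≤ q.1} ∧ ∀ x, v 0 x = g x

theorem IsUCSolution.scale {a : ℝ → ℝ} {H : ℝ → ℝ → ℝ} {g : ℝ → ℝ} {v : ℝ → ℝ → ℝ} {ε : ℝ}
    (hε : 0 < ε) (hv : IsUCSolution a H (fun x => ε⁻¹ * g (ε * x)) v) :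
    IsUCSolution (fun x => ε * a (x / ε)) (fun p x => H p (x / ε)) g
      fun t x => ε * v (t / ε) (x / ε) := by
  refine ⟨isViscositySolution_scale hε hv.1, ?_, fun x => ?_⟩
  · have h1 : UniformContinuous fun q : ℝ × ℝ => (q.1 / ε, q.2 / ε) := by
      simp only [div_eq_inv_mul]
      exact (Real.uniformContinuous_const_mul.comp uniformContinuous_fst).prodMk
        (Real.uniformContinuous_const_mul.comp uniformContinuous_snd)
    exact (Real.uniformContinuous_const_mul (x := ε)).comp_uniformContinuousOn
      (hv.2.1.comp h1.uniformContinuousOn fun q hq => div_nonneg hq hε.le)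
  · beta_reduce
    rw [zero_div, hv.2.2]
    beta_reduce
    rw [mul_div_cancel₀ _ hε.ne', mul_inv_cancel_left₀ hε.ne']

theorem IsUCSolution.growth {α : ℝ → ℝ} {h : ℝ → ℝ → ℝ} {g : ℝ → ℝ} {v : ℝ → ℝ → ℝ}
    (hv : IsUCSolution α h g v) :
    ∃ A, 0 ≤ A ∧ ∀ t, 0 ≤ t → ∀ x, |v t x - v 0 x| ≤ A * (1 + t) := by
  obtain ⟨C, hC, h⟩ := exists_time_growth hv.2.1 one_pos
  refine ⟨1 + C, by positivity, fun t ht x => (h t ht x).trans ?_⟩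
  nlinarith

section effective

variable {Hbar : ℝ → ℝ} {g : ℝ → ℝ}

theorem IsUCSolution.le_of_effective (hH : Continuous Hbar) (hg : UniformContinuous g)
    {v w : ℝ → ℝ → ℝ} (hv : IsUCSolution (fun _ => 0) (fun p _ => Hbar p) g v)
    (hw : IsUCSolution (fun _ => 0) (fun p _ => Hbar p) g w) {t : ℝ} (ht : 0 ≤ t) (x : ℝ) :
    v t x ≤ w t x := by
  have h := add_nonpos_of_subsolutions hH hg (U := fun q => v q.1 q.2) (W := fun q => -w q.1 q.2)
    hv.2.1.continuousOn.upperSemicontinuousOn hw.2.1.continuousOn.neg.upperSemicontinuousOn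
    hv.1.1 (subsolution_neg hw.1.2) (fun η hη => ?_) (fun η hη => ?_) ht x
  · simp only at h
    linarith
  · obtain ⟨B, hB, h⟩ := exists_time_growth hv.2.1 hη
    refine ⟨B, hB, fun t ht x => ?_⟩
    have := (abs_le.1 (h t ht x)).2
    rw [hv.2.2] at this
    simp only
    linarith
  · obtain ⟨B, hB, h⟩ := exists_time_growth hw.2.1 hη
    refine ⟨B, hB, fun t ht x => ?_⟩
    have := (abs_le.1 (h t ht x)).1
    rw [hw.2.2] at this
    simp only
    linarith

theorem uniformContinuousOn_of_moduli {U : ℝ × ℝ → ℝ}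
    (hx : ∀ η > 0, ∃ C, 0 ≤ C ∧ ∀ t, 0 ≤ t → ∀ x y, |U (t, x) - U (t, y)| ≤ η + C * |x - y|)
    (ht : ∀ η > 0, ∃ B, 0 ≤ B ∧ ∀ s, 0 ≤ s → ∀ t, s ≤ t → ∀ x,
      |U (t, x) - U (s, x)| ≤ η + B * (t - s)) :
    UniformContinuousOn U {q : ℝ × ℝ | 0 ≤ q.1} := by
  refine Metric.uniformContinuousOn_iff.2 fun e he => ?_
  obtain ⟨C, hC, hx⟩ := hx (e / 4) (by positivity)
  obtain ⟨B, hB, ht⟩ := ht (e / 4) (by positivity)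
  have ht' : ∀ s, 0 ≤ s → ∀ t, 0 ≤ t → ∀ x, |U (t, x) - U (s, x)| ≤ e / 4 + B * |t - s| := by
    intro s hs t ht0 x
    rcases le_total s t with h | h
    · simpa only [abs_of_nonneg (sub_nonneg.2 h)] using ht s hs t h x
    · rw [abs_sub_comm, abs_sub_comm t, abs_of_nonneg (sub_nonneg.2 h)]
      exact ht t ht0 s h x
  refine ⟨e / (4 * (B + C + 1)), by positivity, ?_⟩
  rintro ⟨t, x⟩ h0t ⟨s, y⟩ h0s hd
  rw [Prod.dist_eq, max_lt_iff, Real.dist_eq, Real.dist_eq] at hd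
  obtain ⟨d, hd'⟩ : ∃ d, d = e / (4 * (B + C + 1)) := ⟨_, rfl⟩
  rw [← hd'] at hd
  have hde : (B + C + 1) * d = e / 4 := by rw [hd']; field_simp
  have h1 := ht' s h0s t h0t x
  have h2 := hx s h0s x y
  have h3 := mul_le_mul_of_nonneg_left hd.1.le hB
  have h4 := mul_le_mul_of_nonneg_left hd.2.le hC
  have h5 := abs_sub_le (U (t, x)) (U (s, x)) (U (s, y))
  have h6 : 0 < d := by rw [hd']; positivity
  rw [Real.dist_eq]
  linarith

/-- A continuous solution of the effective equation which stays close to its uniformly continuous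
initial datum for short times is uniformly continuous. -/
theorem isUCSolution_effective (hH : Continuous Hbar) (hg : UniformContinuous g)
    {U : ℝ × ℝ → ℝ} (hc : ContinuousOn U {q : ℝ × ℝ | 0 ≤ q.1})
    (hU : IsViscositySolution (fun _ => 0) (fun p _ => Hbar p) fun t x => U (t, x))
    (hb : ∀ η > 0, ∃ B, 0 ≤ B ∧ ∀ t, 0 ≤ t → ∀ x, |U (t, x) - g x| ≤ η + B * t) :
    IsUCSolution (fun _ => 0) (fun p _ => Hbar p) g fun t x => U (t, x) := by
  have h0 : ∀ x, U (0, x) = g x := by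
    intro x
    refine eq_of_abs_sub_eq_zero (le_antisymm (le_of_forall_pos_le_add fun η hη => ?_)
      (abs_nonneg _))
    obtain ⟨B, -, h⟩ := hb η hη
    simpa using h 0 le_rfl x
  have hcomp : ∀ s e, (∀ x, |g (x + s) - g x| ≤ e) → ∀ t, 0 ≤ t → ∀ x,
      U (t, x + s) ≤ U (t, x) + e := by
    intro s e hse t ht x
    have hmap : Continuous fun q : ℝ × ℝ => (q.1, q.2 + s) := by fun_prop
    have h := add_nonpos_of_subsolutions hH hg (U := fun q => U (q.1, q.2 + s) - e)
      (W := fun q => -U q)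
      ((hc.comp hmap.continuousOn fun q hq => hq).sub continuousOn_const).upperSemicontinuousOn
      hc.neg.upperSemicontinuousOn (isViscositySubsolution_translate hU.1 s e)
      (subsolution_neg hU.2) (fun η hη => ?_) (fun η hη => ?_) ht x
    · simp only at h
      linarith
    · obtain ⟨B, hB, h⟩ := hb η hη
      refine ⟨B, hB, fun t ht x => ?_⟩
      have h1 := (abs_le.1 (h t ht (x + s))).2
      have h2 := (abs_le.1 (hse x)).2
      simp only
      linarith
    · obtain ⟨B, hB, h⟩ := hb η hη
      refine ⟨B, hB, fun t ht x => ?_⟩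
      have h1 := (abs_le.1 (h t ht x)).1
      linarith
  have hmod : ∀ η > 0, ∃ C, 0 ≤ C ∧ ∀ t, 0 ≤ t → ∀ x y,
      |U (t, x) - U (t, y)| ≤ η + C * |x - y| := by
    intro η hη
    obtain ⟨C, hC, h⟩ := exists_abs_sub_le_of_uniformContinuous hg hη
    have key : ∀ t, 0 ≤ t → ∀ x y, U (t, x) ≤ U (t, y) + (η + C * |x - y|) := by
      intro t ht x y
      have := hcomp (x - y) (η + C * |x - y|)
        (fun z => by simpa only [add_sub_cancel_left] using h (z + (x - y)) z) t ht y
      rwa [add_sub_cancel] at this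
    refine ⟨C, hC, fun t ht x y => abs_le.2 ⟨?_, ?_⟩⟩
    · have := key t ht y x
      rw [abs_sub_comm] at this
      linarith
    · linarith [key t ht x y]
  refine ⟨hU, uniformContinuousOn_of_moduli hmod fun η hη => ?_, h0⟩
  obtain ⟨C, hC, hm⟩ := hmod (η / 2) (by positivity)
  obtain ⟨B, hB⟩ := (isCompact_Icc (a := -(C + 1)) (b := C + 1)).exists_bound_of_continuousOn
    hH.continuousOn
  obtain ⟨A, hA, hgrow⟩ := hb 1 one_pos
  refine ⟨(C + 1) ^ 2 / (η / 2) + |B| + 1, by positivity, fun s hs t hst x => ?_⟩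
  have h := abs_sub_le_of_isViscositySolution (B := |B|) (fun _ => le_rfl) (fun _ => zero_le_one)
    (fun p _ hp => (hB p (abs_le.1 hp)).trans (le_abs_self B)) hC (abs_nonneg B) (half_pos hη) hU
    hc ⟨1 + A, by positivity, fun t ht x => ?_⟩ hs (hm s hs) hst x
  · linarith
  · rw [h0]
    nlinarith [hgrow t ht x]

end effective

section homogenization

variable {a : ℝ → ℝ} {H : ℝ → ℝ → ℝ} {Hbar : ℝ → ℝ} {g : ℝ → ℝ}

/-- The family of all solutions of the rescaled problems with datum `g`, as the scale goes to `0`. -/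
def rescaledSolutions (a : ℝ → ℝ) (H : ℝ → ℝ → ℝ) (g : ℝ → ℝ) : Filter (ℝ × (ℝ → ℝ → ℝ)) :=
  comap Prod.fst (nhdsWithin 0 (Ioi 0)) ⊓
    𝓟 {i | IsUCSolution (fun x => i.1 * a (x / i.1)) (fun p x => H p (x / i.1)) g i.2}

theorem eventually_rescaledSolutions {S : ℝ × (ℝ → ℝ → ℝ) → Prop} :
    (∀ᶠ i in rescaledSolutions a H g, S i) ↔ ∀ᶠ ε in nhdsWithin 0 (Ioi 0), ∀ u,
      IsUCSolution (fun x => ε * a (x / ε)) (fun p x => H p (x / ε)) g u → S (ε, u) := by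
  rw [rescaledSolutions, eventually_inf_principal, eventually_comap]
  refine eventually_congr (Eventually.of_forall fun ε => ⟨fun h u => h (ε, u) rfl, ?_⟩)
  rintro h ⟨ε', u⟩ rfl
  exact h u

theorem rescaledSolutions_neBot (hg : UniformContinuous g)
    (hwp : ∀ g, UniformContinuous g → ∃ v, IsUCSolution a H g v) :
    (rescaledSolutions a H g).NeBot := by
  have h : ∀ ε : ℝ, ∃ v, 0 < ε →
      IsUCSolution (fun x => ε * a (x / ε)) (fun p x => H p (x / ε)) g v := by
    intro ε
    by_cases hε : 0 < ε
    · obtain ⟨v, hv⟩ := hwp (fun x => ε⁻¹ * g (ε * x))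
        (Real.uniformContinuous_const_mul.comp (hg.comp Real.uniformContinuous_const_mul))
      exact ⟨_, fun _ => hv.scale hε⟩
    · exact ⟨0, fun h => absurd h hε⟩
  choose v hv using h
  refine ((inferInstance : (nhdsWithin (0 : ℝ) (Ioi 0)).NeBot).map fun ε => (ε, v ε)).mono ?_
  refine tendsto_inf.2 ⟨tendsto_comap_iff.2 tendsto_id, tendsto_principal.2 ?_⟩
  filter_upwards [self_mem_nhdsWithin] with ε hε using hv ε hε

theorem eventually_abs_sub_le_of_rescaledSolutions (ha0 : ∀ x, 0 ≤ a x) (ha1 : ∀ x, a x ≤ 1)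
    (hHb : ∀ R, ∃ B, 0 ≤ B ∧ ∀ p x, |p| ≤ R → |H p x| ≤ B) (hg : UniformContinuous g)
    {η : ℝ} (hη : 0 < η) : ∃ B, 0 ≤ B ∧ ∀ᶠ i in rescaledSolutions a H g,
      ∀ t, 0 ≤ t → ∀ x, |i.2 t x - g x| ≤ η + B * t := by
  obtain ⟨C, hC, hgC⟩ := exists_abs_sub_le_of_uniformContinuous hg (half_pos hη)
  obtain ⟨B, hB, hHB⟩ := hHb (C + 1)
  refine ⟨(C + 1) ^ 2 / (η / 2) + B + 1, by positivity, eventually_rescaledSolutions.2 ?_⟩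
  filter_upwards [Ioo_mem_nhdsGT (show (0 : ℝ) < 1 from one_pos)] with ε hε u hu t ht x
  have h := abs_sub_le_of_isViscositySolution (fun x => mul_nonneg hε.1.le (ha0 (x / ε)))
    (fun x => mul_le_one₀ hε.2.le (ha0 (x / ε)) (ha1 (x / ε))) (fun p x => hHB p (x / ε)) hC hB
    (half_pos hη) hu.1 hu.2.1.continuousOn hu.growth le_rfl
    (fun x y => by rw [hu.2.2, hu.2.2]; exact hgC x y) ht x
  rw [hu.2.2, sub_zero] at h
  linarith

theorem exists_isUCSolution_and_tendsto (ha0 : ∀ x, 0 ≤ a x) (ha1 : ∀ x, a x ≤ 1)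
    (hH : Continuous Hbar) (hHb : ∀ R, ∃ B, 0 ≤ B ∧ ∀ p x, |p| ≤ R → |H p x| ≤ B)
    (hup : ∀ θ δ, 0 < δ → ∃ K ρ, 0 ≤ K ∧ 0 < ρ ∧ HasUpperCorrectors a H θ (Hbar θ + δ) K ρ)
    (hlow : ∀ θ δ, 0 < δ → ∃ K ρ, 0 ≤ K ∧ 0 < ρ ∧ HasLowerCorrectors a H θ (Hbar θ - δ) K ρ)
    (hwp : ∀ g, UniformContinuous g → ∃ v, IsUCSolution a H g v) (hg : UniformContinuous g) :
    ∃ U : ℝ → ℝ → ℝ, IsUCSolution (fun _ => 0) (fun p _ => Hbar p) g U ∧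
      ∀ T M η : ℝ, 0 < η → ∃ ε₀ > (0 : ℝ), ∀ ε, 0 < ε → ε < ε₀ → ∀ u,
        IsUCSolution (fun x => ε * a (x / ε)) (fun p x => H p (x / ε)) g u →
        ∀ t ∈ Icc (0 : ℝ) T, ∀ x ∈ Icc (-M) M, |u t x - U t x| ≤ η := by
  have := rescaledSolutions_neBot hg hwp
  obtain ⟨l, hl⟩ : ∃ l, l = rescaledSolutions a H g := ⟨_, rfl⟩
  rw [← hl] at this
  obtain ⟨D, hD⟩ : ∃ D : Set (ℝ × ℝ), D = {q | 0 ≤ q.1} := ⟨_, rfl⟩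
  have hsol : ∀ᶠ i in l, IsUCSolution (fun x => i.1 * a (x / i.1)) (fun p x => H p (x / i.1)) g i.2 :=
    hl ▸ eventually_rescaledSolutions.2 (Eventually.of_forall fun ε u hu => hu)
  have hε : Tendsto Prod.fst l (nhdsWithin 0 (Ioi 0)) := hl ▸ tendsto_comap.mono_left inf_le_left
  have hbd : ∀ η > 0, ∃ B, 0 ≤ B ∧ ∀ᶠ i in l, ∀ t, 0 ≤ t → ∀ x, |i.2 t x - g x| ≤ η + B * t :=
    fun η hη => hl ▸ eventually_abs_sub_le_of_rescaledSolutions ha0 ha1 hHb hg hη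
  have hloc : ∀ q ∈ D, ∃ c, ∀ᶠ p : (ℝ × (ℝ → ℝ → ℝ)) × (ℝ × ℝ) in l ×ˢ nhdsWithin q D,
      |p.1.2 p.2.1 p.2.2| ≤ c := by
    intro q hq
    obtain ⟨B, hB, h⟩ := hbd 1 one_pos
    have hGc : Continuous fun q : ℝ × ℝ => |g q.2| + (1 + B * q.1) :=
      ((hg.continuous.comp continuous_snd).abs).add (by fun_prop)
    refine ⟨|g q.2| + (1 + B * q.1) + 1, ?_⟩
    filter_upwards [h.prod_mk ((hGc.continuousWithinAt.eventually_lt_const (lt_add_one _)).and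
      self_mem_nhdsWithin)] with p hp
    obtain ⟨h1, h2, h3⟩ := hp
    rw [hD] at h3
    have h4 := h1 p.2.1 h3 p.2.2
    have h5 := abs_sub_abs_le_abs_sub (p.1.2 p.2.1 p.2.2) (g p.2.2)
    linarith
  obtain ⟨U, hU⟩ := exists_isUpperRelaxedLimit (u := fun (i : ℝ × (ℝ → ℝ → ℝ)) (q : ℝ × ℝ) => i.2 q.1 q.2) hloc
  obtain ⟨W, hW⟩ := exists_isUpperRelaxedLimit (u := fun (i : ℝ × (ℝ → ℝ → ℝ)) (q : ℝ × ℝ) => -i.2 q.1 q.2)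
    (l := l) (D := D) (by simpa only [abs_neg] using hloc)
  have hbound : ∀ η > 0, ∃ B, 0 ≤ B ∧ ∀ t, 0 ≤ t → ∀ x,
      U (t, x) ≤ g x + η + B * t ∧ W (t, x) ≤ -g x + η + B * t := by
    intro η hη
    obtain ⟨B, hB, h⟩ := hbd η hη
    refine ⟨B, hB, fun t ht x => ⟨?_, ?_⟩⟩
    · refine hU.le_of_eventually (q := (t, x)) (G := fun q => g q.2 + η + B * q.1) (hD ▸ ht)
        (((hg.continuous.comp continuous_snd).add continuous_const).add
          (by fun_prop)).continuousWithinAt (h.mono fun i hi q hq => ?_)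
      rw [hD] at hq
      have := (abs_le.1 (hi q.1 hq q.2)).2
      linarith
    · refine hW.le_of_eventually (q := (t, x)) (G := fun q => -g q.2 + η + B * q.1) (hD ▸ ht)
        (((hg.continuous.comp continuous_snd).neg.add continuous_const).add
          (by fun_prop)).continuousWithinAt (h.mono fun i hi q hq => ?_)
      rw [hD] at hq
      have := (abs_le.1 (hi q.1 hq q.2)).1
      linarith
  have hUusc := hU.upperSemicontinuousOn
  have hWusc := hW.upperSemicontinuousOn
  have hUs := isViscositySubsolution_of_relaxed ha0 ha1 hε hup (hsol.mono fun i hi => hi.1.1)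
    (hsol.mono fun i hi => hi.2.1.continuousOn) (hD ▸ hU)
  have hWs := isViscositySubsolution_of_relaxed (H := fun p x => -H (-p) x)
    (Hbar := fun p => -Hbar (-p)) (u := fun (i : ℝ × (ℝ → ℝ → ℝ)) (q : ℝ × ℝ) => -i.2 q.1 q.2) ha0 ha1 hε
    (fun θ δ hδ => by
      obtain ⟨K, ρ, hK, hρ, h⟩ := hlow (-θ) δ hδ
      refine ⟨K, ρ, hK, hρ, ?_⟩
      rw [HasLowerCorrectors, neg_neg] at h
      convert h using 1
      ring)
    (hsol.mono fun i hi => subsolution_neg hi.1.2)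
    (hsol.mono fun i hi => hi.2.1.continuousOn.neg) (hD ▸ hW)
  have hUW : ∀ q ∈ D, W q = -U q := by
    intro q hq
    refine le_antisymm ?_ (by linarith [hU.neg_le hW hq])
    rw [hD] at hUusc hWusc hq
    have := add_nonpos_of_subsolutions hH hg hUusc hWusc hUs hWs
      (fun η hη => by
        obtain ⟨B, hB, h⟩ := hbound η hη
        exact ⟨B, hB, fun t ht x => (h t ht x).1⟩)
      (fun η hη => by
        obtain ⟨B, hB, h⟩ := hbound η hη
        exact ⟨B, hB, fun t ht x => (h t ht x).2⟩) hq q.2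
    linarith
  have hcont : ContinuousOn U D := by
    refine continuousOn_iff_lower_upperSemicontinuousOn.2 ⟨?_, hUusc⟩
    intro q hq c hc
    filter_upwards [hWusc q hq (-c) (show W q < -c by rw [hUW q hq]; linarith), self_mem_nhdsWithin] with q' h1 h2
    rw [hUW q' h2] at h1
    linarith
  have hUW' : ∀ q : ℝ × ℝ, 0 < q.1 → W q = -U q := fun q hq => hUW q (hD ▸ hq.le)
  have hsup : IsViscositySupersolution (fun _ => 0) (fun p _ => Hbar p) fun t x => U (t, x) := by
    refine supersolution_of_neg fun t₀ x₀ ht φ hφ hmax => hWs t₀ x₀ ht φ hφ ?_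
    have hev : ∀ᶠ q : ℝ × ℝ in nhds (t₀, x₀), 0 < q.1 :=
      (isOpen_lt continuous_const continuous_fst).mem_nhds ht
    refine hmax.congr (hev.mono fun q hq => ?_)
    simp only [hUW' q hq]
  have hUsol := isUCSolution_effective hH hg (hD ▸ hcont) ⟨hUs, hsup⟩ fun η hη => by
    obtain ⟨B, hB, h⟩ := hbound η hη
    refine ⟨B, hB, fun t ht x => abs_le.2 ⟨?_, ?_⟩⟩
    · have := (h t ht x).2
      rw [hUW (t, x) (hD ▸ ht)] at this
      linarith
    · linarith [(h t ht x).1]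
  refine ⟨fun t x => U (t, x), hUsol, fun T M η hη => ?_⟩
  have hsub : Icc (0 : ℝ) T ×ˢ Icc (-M) M ⊆ D := fun q hq => hD ▸ hq.1.1
  have hlim := IsCompact.eventually_forall_of_prod_nhdsWithin (l := l)
    (isCompact_Icc.prod isCompact_Icc) hsub (R := fun i q => |i.2 q.1 q.2 - U q| ≤ η)
    fun q hq => by
      have h1 := (hU q (hsub hq) (U q + η / 2)).1 (by linarith)
      have h2 := (hW q (hsub hq) (W q + η / 2)).1 (by linarith)
      have h3 : ∀ᶠ q' in nhdsWithin q D, U q' < U q + η / 2 :=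
        (hcont q (hsub hq)).eventually_lt_const (by linarith)
      have h4 : ∀ᶠ q' in nhdsWithin q D, U q - η / 2 < U q' :=
        (hcont q (hsub hq)).eventually_const_lt (by linarith)
      filter_upwards [h1, h2, (h3.and h4).prod_inr l] with p k1 k2 k3
      rw [hUW q (hsub hq)] at k2
      exact abs_le.2 ⟨by linarith [k3.1], by linarith [k3.2]⟩
  rw [hl, eventually_rescaledSolutions] at hlim
  obtain ⟨ε₀, hε₀, h⟩ := mem_nhdsGT_iff_exists_Ioo_subset.1 hlim
  exact ⟨ε₀, hε₀, fun ε h1 h2 u hu t ht x hx => h ⟨h1, h2⟩ u hu (t, x) ⟨ht, hx⟩⟩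

end homogenization

end HJ1D

theorem homogenization_uc_initial_data
    {Ω : Type} [MeasurableSpace Ω] (P : Measure Ω) (τ : ℝ → Ω → Ω)
    (a : ℝ → Ω → ℝ) (H : ℝ → ℝ → Ω → ℝ) (G_L G_U : ℝ → ℝ)
    (hset : HJSetting P τ a H G_L G_U)
    (hwp : ∀ ω, WellPosedUC (fun x => a x ω) (fun p x => H p x ω))
    (h22 : ∀ (ω : Ω) (θ : ℝ) (v : ℝ → ℝ → ℝ),
      IsViscositySolution (fun x => a x ω) (fun p x => H p x ω) v →
      UniformContinuousOn (fun q : ℝ × ℝ => v q.1 q.2) {q : ℝ × ℝ | 0 ≤ q.1} →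
      (∀ x, v 0 x = θ * x) →
      ∃ ℓ > (0:ℝ), ∀ t ≥ (0:ℝ), ∀ x y : ℝ, |v t x - v t y| ≤ ℓ * |x - y|) :
    ∃ Hbar : ℝ → ℝ,
      Tendsto Hbar (cocompact ℝ) atTop ∧
      (∀ R > (0:ℝ), ∃ K : NNReal, LipschitzOnWith K Hbar (Icc (-R) R)) ∧
      ∃ Ω₀ : Set Ω, MeasurableSet Ω₀ ∧ P Ω₀ = 1 ∧
        ∀ ω ∈ Ω₀, ∀ g : ℝ → ℝ, UniformContinuous g →
          (∃ ubar : ℝ → ℝ → ℝ,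
            IsViscositySolution (fun _ => 0) (fun p _ => Hbar p) ubar ∧
            UniformContinuousOn (fun q : ℝ × ℝ => ubar q.1 q.2) {q : ℝ × ℝ | 0 ≤ q.1} ∧
            ∀ x, ubar 0 x = g x) ∧
          ∀ ubar : ℝ → ℝ → ℝ,
            IsViscositySolution (fun _ => 0) (fun p _ => Hbar p) ubar →
            UniformContinuousOn (fun q : ℝ × ℝ => ubar q.1 q.2) {q : ℝ × ℝ | 0 ≤ q.1} →
            (∀ x, ubar 0 x = g x) →
            ∀ T > (0:ℝ), ∀ M > (0:ℝ), ∀ η > (0:ℝ), ∃ ε₀ > (0:ℝ),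
              ∀ ε : ℝ, 0 < ε → ε < ε₀ →
                ∀ uge : ℝ → ℝ → ℝ,
                  IsViscositySolution (fun x => ε * a (x / ε) ω)
                    (fun p x => H p (x / ε) ω) uge →
                  UniformContinuousOn (fun q : ℝ × ℝ => uge q.1 q.2) {q : ℝ × ℝ | 0 ≤ q.1} →
                  (∀ x, uge 0 x = g x) →
                  ∀ t ∈ Icc (0:ℝ) T, ∀ x ∈ Icc (-M) M, |uge t x - ubar t x| ≤ η := by
  have := hset.prob
  refine ⟨HJ1D.effectiveH P a H, HJ1D.tendsto_effectiveH hset,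
    fun R hR => HJ1D.lipschitzOnWith_effectiveH hset hR, ?_⟩
  obtain ⟨S, hS, hSm, hS0⟩ := exists_measurable_superset_of_null
    (ae_iff.1 (HJ1D.ae_forall_correctors hset))
  refine ⟨Sᶜ, hSm.compl, (prob_compl_eq_one_iff hSm).2 hS0, fun ω hω g hg => ?_⟩
  have hcor := not_not.1 fun h => hω (hS h)
  obtain ⟨U, hU, hconv⟩ := HJ1D.exists_isUCSolution_and_tendsto (a := fun x => a x ω)
    (H := fun p x => H p x ω) (fun x => (hset.a_pos x ω).le) (fun x => hset.a_le_one x ω)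
    (HJ1D.continuous_effectiveH hset)
    (fun R => ⟨max |G_L 0| |G_U R|, (abs_nonneg _).trans (le_max_left _ _), fun p x hp =>
      abs_le_max_abs_abs (HJ1D.GL_zero_le hset p x ω) (HJ1D.le_GU_of_abs_le hset hp x ω)⟩)
    (fun θ δ hδ => by
      obtain ⟨K, ρ, hK, hρ, h, -⟩ := hcor θ δ hδ
      exact ⟨K, ρ, hK, hρ, h⟩)
    (fun θ δ hδ => by
      obtain ⟨K, ρ, hK, hρ, -, h⟩ := hcor θ δ hδ
      exact ⟨K, ρ, hK, hρ, h⟩)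
    (hwp ω).1 hg
  refine ⟨⟨U, hU⟩, fun ubar h1 h2 h3 T _ M _ η hη => ?_⟩
  have hubar : HJ1D.IsUCSolution (fun _ => 0) (fun p _ => HJ1D.effectiveH P a H p) g ubar :=
    ⟨h1, h2, h3⟩
  obtain ⟨ε₀, hε₀, h⟩ := hconv T M η hη
  refine ⟨ε₀, hε₀, fun ε hε hεε uge k1 k2 k3 t ht x hx => ?_⟩
  have hH := HJ1D.continuous_effectiveH hset
  rw [le_antisymm (hubar.le_of_effective hH hg hU ht.1 x) (hU.le_of_effective hH hg hubar ht.1 x)]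
  exact h ε hε hεε uge ⟨k1, k2, k3⟩ t ht x hx
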